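/- arXiv:1302.6395 — 2 statements merged into one kernel-verified Lean document; each statement's English description precedes it below -/
import Mathlib

section
/- Let (R, m) be a commutative Noetherian local ring, let 𝔞 be a proper ideal of R, and let M be an R-module such that H^i_𝔞(M) = 0 for all i ≠ n. Then for every integer p there is an isomorphism Tor^R_p(R/m, H^n_𝔞(M)) ≅ Tor^R_{p−n}(R/m, M). -/
/-!
Definitions needed to state results of "On flat and Gorenstein flat dimensions of
local cohomology modules" by M.R. Zargar and H. Zakeri.
-/

open CategoryTheory IsLocalRing

universe u

namespace Paper

variable (R : Type u) [CommRing R]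

/-! ## Resolution/coresolution dimensions with respect to a class of modules -/

/-- `ResDimLE R P n M` : `M` admits a resolution `0 → Xₙ → ⋯ → X₀ → M → 0`
with each `Xᵢ` in the class `P`. -/
def ResDimLE (P : ModuleCat.{u} R → Prop) : ℕ → ModuleCat.{u} R → Prop
  | 0, M => P M
  | n + 1, M => ResDimLE P n M ∨
      ∃ (X : ModuleCat.{u} R) (f : X →ₗ[R] M), P X ∧ Function.Surjective f ∧
        ResDimLE P n (ModuleCat.of R (LinearMap.ker f))

/-- `CoresDimLE R P n M` : `M` admits a coresolution `0 → M → X₀ → ⋯ → Xₙ → 0`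
with each `Xᵢ` in the class `P`. -/
def CoresDimLE (P : ModuleCat.{u} R → Prop) : ℕ → ModuleCat.{u} R → Prop
  | 0, M => P M
  | n + 1, M => CoresDimLE P n M ∨
      ∃ (X : ModuleCat.{u} R) (f : M →ₗ[R] X), P X ∧ Function.Injective f ∧
        CoresDimLE P n (ModuleCat.of R (X ⧸ LinearMap.range f))

/-- The resolution dimension of `M` with respect to the class `P`, as an
extended natural number (`⊤` if there is no finite resolution). -/
noncomputable def ResDim (P : ModuleCat.{u} R → Prop) (M : ModuleCat.{u} R) : ℕ∞ :=
  sInf {n : ℕ∞ | ∃ k : ℕ, (k : ℕ∞) = n ∧ ResDimLE R P k M}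

/-- The coresolution dimension of `M` with respect to the class `P`. -/
noncomputable def CoresDim (P : ModuleCat.{u} R → Prop) (M : ModuleCat.{u} R) : ℕ∞ :=
  sInf {n : ℕ∞ | ∃ k : ℕ, (k : ℕ∞) = n ∧ CoresDimLE R P k M}

/-- Flat dimension `fd_R M`. -/
noncomputable def flatDim (M : Type u) [AddCommGroup M] [Module R M] : ℕ∞ :=
  ResDim R (fun N => Module.Flat R N) (ModuleCat.of R M)

/-- Projective dimension `pd_R M`. -/
noncomputable def projDim (M : Type u) [AddCommGroup M] [Module R M] : ℕ∞ :=
  ResDim R (fun N => Module.Projective R N) (ModuleCat.of R M)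

/-- Injective dimension `id_R M`. -/
noncomputable def injDim (M : Type u) [AddCommGroup M] [Module R M] : ℕ∞ :=
  CoresDim R (fun N => Module.Injective R N) (ModuleCat.of R M)

/-! ## Local cohomology -/

/-- The local cohomology module `H^i_𝔞(M)`, as an object of `ModuleCat R`. -/
noncomputable def lcoh (𝔞 : Ideal R) (i : ℕ) (M : Type u) [AddCommGroup M] [Module R M] :
    ModuleCat.{u} R :=
  (localCohomology 𝔞 i).obj (ModuleCat.of R M)

/-- `M` is relative Cohen-Macaulay with respect to `𝔞` with `ht_M 𝔞 = n`, i.e. the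
`n`-th local cohomology of `M` with respect to `𝔞` is the only non-vanishing one. -/
def IsRelCM (𝔞 : Ideal R) (n : ℕ) (M : Type u) [AddCommGroup M] [Module R M] : Prop :=
  (∀ i : ℕ, i ≠ n → Subsingleton (lcoh R 𝔞 i M)) ∧ ¬ Subsingleton (lcoh R 𝔞 n M)

/-! ## Depth, dimension, Cohen-Macaulay -/

/-- The depth of a module over a local ring: the supremum of the lengths of
`M`-regular sequences contained in the maximal ideal. -/
noncomputable def depth [IsLocalRing R] (M : Type u) [AddCommGroup M] [Module R M] : ℕ∞ :=
  sSup {n : ℕ∞ | ∃ rs : List R, (rs.length : ℕ∞) = n ∧ (∀ x ∈ rs, x ∈ maximalIdeal R) ∧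
    RingTheory.Sequence.IsRegular M rs}

/-- The (Krull) dimension of a module: the Krull dimension of `R` modulo
the annihilator of `M` (`⊥` for the zero module). -/
noncomputable def moduleDim (M : Type u) [AddCommGroup M] [Module R M] : WithBot ℕ∞ :=
  ringKrullDim (R ⧸ Module.annihilator R M)

/-- A finitely generated module over a local ring is Cohen-Macaulay
if its depth equals its dimension. -/
def IsCohenMacaulayModule [IsLocalRing R] (M : Type u) [AddCommGroup M] [Module R M] : Prop :=
  (depth R M : WithBot ℕ∞) = moduleDim R M

/-- A local ring is Cohen-Macaulay if it is so as a module over itself. -/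
def IsCohenMacaulayRing [IsLocalRing R] : Prop := IsCohenMacaulayModule R R

/-- A local ring is Gorenstein if it has finite injective dimension over itself. -/
def IsGorensteinRing : Prop := injDim R R ≠ ⊤

/-! ## Ext, Tor, semidualizing modules -/

/-- `Ext^i_R(A, B)`. -/
noncomputable def ext (i : ℕ) (A B : Type u) [AddCommGroup A] [Module R A]
    [AddCommGroup B] [Module R B] : ModuleCat.{u} R :=
  ((Ext R (ModuleCat.{u} R) i).obj (Opposite.op (ModuleCat.of R A))).obj (ModuleCat.of R B)

/-- `Tor^R_p(A, B)` indexed by `p : ℤ`, with the convention that it vanishes in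
negative degrees. -/
noncomputable def tor (p : ℤ) (A B : Type u) [AddCommGroup A] [Module R A]
    [AddCommGroup B] [Module R B] : ModuleCat.{u} R :=
  if 0 ≤ p then ((Tor (ModuleCat.{u} R) p.toNat).obj (ModuleCat.of R A)).obj (ModuleCat.of R B)
  else ModuleCat.of R PUnit

/-- A finitely generated module `C` is semidualizing if the natural map
`R → Hom_R(C, C)` is bijective and `Ext^i_R(C, C) = 0` for all `i ≥ 1`. -/
def IsSemidualizing (C : Type u) [AddCommGroup C] [Module R C] : Prop :=
  Module.Finite R C ∧
  Function.Bijective (fun r : R => (r • LinearMap.id : C →ₗ[R] C)) ∧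
  ∀ i : ℕ, 1 ≤ i → Subsingleton (ext R i C C)

/-! ## Gorenstein homological classes -/

/-- `N` is Gorenstein injective: it is the kernel of the `0`-th differential of some
exact complex `Y` of injective modules which stays exact under `Hom(I, -)` for every
injective module `I`. (The complex is written cohomologically.) -/
def IsGorensteinInjective (N : Type u) [AddCommGroup N] [Module R N] : Prop :=
  ∃ (Y : ℤ → ModuleCat.{u} R) (d : ∀ i : ℤ, Y i →ₗ[R] Y (i + 1)),
    (∀ i, Module.Injective R (Y i)) ∧
    (∀ i, Function.Exact (d i) (d (i + 1))) ∧
    (∀ (I : ModuleCat.{u} R), Module.Injective R I →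
      ∀ (i : ℤ) (g : I →ₗ[R] Y (i + 1)), (d (i + 1)).comp g = 0 →
        ∃ h : I →ₗ[R] Y i, (d i).comp h = g) ∧
    ∃ ι : N →ₗ[R] Y 0, Function.Injective ι ∧ Function.Exact ι (d 0)

/-- `N` is Gorenstein projective: it is the cokernel of a differential of some
exact complex `X` of projective modules which stays exact under `Hom(-, P)` for
every projective module `P`. -/
def IsGorensteinProjective (N : Type u) [AddCommGroup N] [Module R N] : Prop :=
  ∃ (X : ℤ → ModuleCat.{u} R) (d : ∀ i : ℤ, X i →ₗ[R] X (i + 1)),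
    (∀ i, Module.Projective R (X i)) ∧
    (∀ i, Function.Exact (d i) (d (i + 1))) ∧
    (∀ (P : ModuleCat.{u} R), Module.Projective R P →
      ∀ (i : ℤ) (g : X (i + 1) →ₗ[R] P), g.comp (d i) = 0 →
        ∃ h : X (i + 1 + 1) →ₗ[R] P, h.comp (d (i + 1)) = g) ∧
    ∃ π : X 0 →ₗ[R] N, Function.Surjective π ∧ Function.Exact (d (-1)) π

/-- `N` is Gorenstein flat: it is the cokernel of a differential of some exact
complex `Z` of flat modules which stays exact under `- ⊗ I` for every injective
module `I`. -/
def IsGorensteinFlat (N : Type u) [AddCommGroup N] [Module R N] : Prop :=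
  ∃ (Z : ℤ → ModuleCat.{u} R) (d : ∀ i : ℤ, Z i →ₗ[R] Z (i + 1)),
    (∀ i, Module.Flat R (Z i)) ∧
    (∀ i, Function.Exact (d i) (d (i + 1))) ∧
    (∀ (I : ModuleCat.{u} R), Module.Injective R I →
      ∀ i : ℤ, Function.Exact (LinearMap.rTensor (R := R) I (d i))
        (LinearMap.rTensor (R := R) I (d (i + 1)))) ∧
    ∃ π : Z 0 →ₗ[R] N, Function.Surjective π ∧ Function.Exact (d (-1)) π

/-- Gorenstein injective dimension `Gid_R M`. -/
noncomputable def GinjDim (M : Type u) [AddCommGroup M] [Module R M] : ℕ∞ :=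
  CoresDim R (fun N => IsGorensteinInjective R N) (ModuleCat.of R M)

/-- Gorenstein projective dimension `Gpd_R M`. -/
noncomputable def GprojDim (M : Type u) [AddCommGroup M] [Module R M] : ℕ∞ :=
  ResDim R (fun N => IsGorensteinProjective R N) (ModuleCat.of R M)

/-- Gorenstein flat dimension `Gfd_R M`. -/
noncomputable def GflatDim (M : Type u) [AddCommGroup M] [Module R M] : ℕ∞ :=
  ResDim R (fun N => IsGorensteinFlat R N) (ModuleCat.of R M)

/-! ## `C`-injective, `C`-projective, `C`-flat modules and the `G_C`-classes -/

/-- `N` is `C`-injective if `N ≅ Hom_R(C, I)` for some injective module `I`. -/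
def IsCInjective (C : Type u) [AddCommGroup C] [Module R C]
    (N : Type u) [AddCommGroup N] [Module R N] : Prop :=
  ∃ I : ModuleCat.{u} R, Module.Injective R I ∧ Nonempty (N ≃ₗ[R] (C →ₗ[R] I))

/-- `N` is `C`-projective if `N ≅ C ⊗_R P` for some projective module `P`. -/
def IsCProjective (C : Type u) [AddCommGroup C] [Module R C]
    (N : Type u) [AddCommGroup N] [Module R N] : Prop :=
  ∃ P : ModuleCat.{u} R, Module.Projective R P ∧ Nonempty (N ≃ₗ[R] TensorProduct R C P)

/-- `N` is `C`-flat if `N ≅ C ⊗_R F` for some flat module `F`. -/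
def IsCFlat (C : Type u) [AddCommGroup C] [Module R C]
    (N : Type u) [AddCommGroup N] [Module R N] : Prop :=
  ∃ F : ModuleCat.{u} R, Module.Flat R F ∧ Nonempty (N ≃ₗ[R] TensorProduct R C F)

/-- `C`-injective dimension `cid_R M`. -/
noncomputable def cInjDim (C : Type u) [AddCommGroup C] [Module R C]
    (M : Type u) [AddCommGroup M] [Module R M] : ℕ∞ :=
  CoresDim R (fun N => IsCInjective R C N) (ModuleCat.of R M)

/-- `C`-projective dimension `cpd_R M`. -/
noncomputable def cProjDim (C : Type u) [AddCommGroup C] [Module R C]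
    (M : Type u) [AddCommGroup M] [Module R M] : ℕ∞ :=
  ResDim R (fun N => IsCProjective R C N) (ModuleCat.of R M)

/-- `N` is `G_C`-injective: `N` is the kernel of the `0`-th differential of an exact
complex `Y` (a complete `I_C I`-coresolution) with `Y i` injective in degrees belonging
to the coresolution part and `C`-injective elsewhere, such that `Hom(I', Y)` is exact
for every `C`-injective module `I'`. -/
def IsGCInjective (C : Type u) [AddCommGroup C] [Module R C]
    (N : Type u) [AddCommGroup N] [Module R N] : Prop :=
  ∃ (Y : ℤ → ModuleCat.{u} R) (d : ∀ i : ℤ, Y i →ₗ[R] Y (i + 1)),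
    (∀ i : ℤ, 0 ≤ i → Module.Injective R (Y i)) ∧
    (∀ i : ℤ, i < 0 → IsCInjective R C (Y i)) ∧
    (∀ i, Function.Exact (d i) (d (i + 1))) ∧
    (∀ (I : ModuleCat.{u} R), IsCInjective R C I →
      ∀ (i : ℤ) (g : I →ₗ[R] Y (i + 1)), (d (i + 1)).comp g = 0 →
        ∃ h : I →ₗ[R] Y i, (d i).comp h = g) ∧
    ∃ ι : N →ₗ[R] Y 0, Function.Injective ι ∧ Function.Exact ι (d 0)

/-- `N` is `G_C`-projective: the cokernel of the degree `0` differential of a complete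
`P_C P`-resolution. -/
def IsGCProjective (C : Type u) [AddCommGroup C] [Module R C]
    (N : Type u) [AddCommGroup N] [Module R N] : Prop :=
  ∃ (X : ℤ → ModuleCat.{u} R) (d : ∀ i : ℤ, X i →ₗ[R] X (i + 1)),
    (∀ i : ℤ, i ≤ 0 → Module.Projective R (X i)) ∧
    (∀ i : ℤ, 0 < i → IsCProjective R C (X i)) ∧
    (∀ i, Function.Exact (d i) (d (i + 1))) ∧
    (∀ (Q : ModuleCat.{u} R), IsCProjective R C Q →
      ∀ (i : ℤ) (g : X (i + 1) →ₗ[R] Q), g.comp (d i) = 0 →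
        ∃ h : X (i + 1 + 1) →ₗ[R] Q, h.comp (d (i + 1)) = g) ∧
    ∃ π : X 0 →ₗ[R] N, Function.Surjective π ∧ Function.Exact (d (-1)) π

/-- `N` is `G_C`-flat: the cokernel of the degree `0` differential of a complete
`F_C F`-resolution. -/
def IsGCFlat (C : Type u) [AddCommGroup C] [Module R C]
    (N : Type u) [AddCommGroup N] [Module R N] : Prop :=
  ∃ (Z : ℤ → ModuleCat.{u} R) (d : ∀ i : ℤ, Z i →ₗ[R] Z (i + 1)),
    (∀ i : ℤ, i ≤ 0 → Module.Flat R (Z i)) ∧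
    (∀ i : ℤ, 0 < i → IsCFlat R C (Z i)) ∧
    (∀ i, Function.Exact (d i) (d (i + 1))) ∧
    (∀ (J : ModuleCat.{u} R), IsCInjective R C J →
      ∀ i : ℤ, Function.Exact (LinearMap.rTensor (R := R) J (d i))
        (LinearMap.rTensor (R := R) J (d (i + 1)))) ∧
    ∃ π : Z 0 →ₗ[R] N, Function.Surjective π ∧ Function.Exact (d (-1)) π

/-- `G_C`-injective dimension `Gid_C M`. -/
noncomputable def GCinjDim (C : Type u) [AddCommGroup C] [Module R C]
    (M : Type u) [AddCommGroup M] [Module R M] : ℕ∞ :=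
  CoresDim R (fun N => IsGCInjective R C N) (ModuleCat.of R M)

/-- `G_C`-projective dimension `G_C-pd_R M`. -/
noncomputable def GCprojDim (C : Type u) [AddCommGroup C] [Module R C]
    (M : Type u) [AddCommGroup M] [Module R M] : ℕ∞ :=
  ResDim R (fun N => IsGCProjective R C N) (ModuleCat.of R M)

/-- `G_C`-flat dimension `G_C-fd_R M`. -/
noncomputable def GCflatDim (C : Type u) [AddCommGroup C] [Module R C]
    (M : Type u) [AddCommGroup M] [Module R M] : ℕ∞ :=
  ResDim R (fun N => IsGCFlat R C N) (ModuleCat.of R M)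

end Paper

namespace LCAux
open Limits MonoidalCategory

section Tor
variable {R : Type u} [CommRing R]

/-- the complex `Q ⊗ N`, with `Q` a projective resolution of `K`. -/
noncomputable def TC (K : ModuleCat.{u} R) : ModuleCat.{u} R ⥤ ChainComplex (ModuleCat.{u} R) ℕ where
  obj N := (((tensoringRight (ModuleCat.{u} R)).obj N).mapHomologicalComplex _).obj
    (projectiveResolution K).complex
  map f := (NatTrans.mapHomologicalComplex ((tensoringRight (ModuleCat.{u} R)).map f) _).app
    (projectiveResolution K).complex

noncomputable def TT (K : ModuleCat.{u} R) (i : ℕ) : ModuleCat.{u} R ⥤ ModuleCat.{u} R :=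
  TC K ⋙ HomologicalComplex.homologyFunctor _ _ i

instance (K : ModuleCat.{u} R) : (TC K).Additive where
  map_add {X Y f g} := by
    ext i : 1
    exact MonoidalPreadditive.whiskerLeft_add f g

instance (K : ModuleCat.{u} R) (i : ℕ) : (TT K i).Additive := by
  unfold TT; infer_instance

lemma TC_smul (K : ModuleCat.{u} R) {X Y : ModuleCat.{u} R} (f : X ⟶ Y) (r : R) :
    (TC K).map (r • f) = r • (TC K).map f := by
  ext i : 1
  exact MonoidalLinear.whiskerLeft_smul ((projectiveResolution K).complex.X i) r f

lemma TT_smul (K : ModuleCat.{u} R) (i : ℕ) {X Y : ModuleCat.{u} R} (f : X ⟶ Y) (r : R) :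
    (TT K i).map (r • f) = r • (TT K i).map f := by
  simp only [TT, Functor.comp_map, TC_smul]
  exact ShortComplex.homologyMap_smul
    ((HomologicalComplex.shortComplexFunctor _ _ i).map ((TC K).map f)) r

lemma flat_Q (K : ModuleCat.{u} R) (i : ℕ) :
    Module.Flat R ((projectiveResolution K).complex.X i) := by
  have : Module.Projective R ((projectiveResolution K).complex.X i) :=
    (IsProjective.iff_projective _).2 ((projectiveResolution K).projective i)
  infer_instance

lemma TC_shortExact (K : ModuleCat.{u} R) {S : ShortComplex (ModuleCat.{u} R)}
    (hS : S.ShortExact) : (S.map (TC K)).ShortExact := by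
  apply HomologicalComplex.shortExact_of_degreewise_shortExact
  intro i
  have := flat_Q K i
  exact hS.map_of_exact (tensorLeft ((projectiveResolution K).complex.X i))

lemma TT_exact₂ (K : ModuleCat.{u} R) {S : ShortComplex (ModuleCat.{u} R)}
    (hS : S.ShortExact) (i : ℕ) : (S.map (TT K i)).Exact :=
  (TC_shortExact K hS).homology_exact₂ i

lemma TT_mono (K : ModuleCat.{u} R) {S : ShortComplex (ModuleCat.{u} R)}
    (hS : S.ShortExact) (i : ℕ) (h : IsZero ((TT K (i + 1)).obj S.X₃)) :
    Mono ((TT K i).map S.f) :=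
  ((TC_shortExact K hS).homology_exact₁ (i + 1) i rfl).mono_g (h.eq_of_src _ _)

lemma TT_epi (K : ModuleCat.{u} R) {S : ShortComplex (ModuleCat.{u} R)}
    (hS : S.ShortExact) (i : ℕ) (h : IsZero ((TT K i).obj S.X₃)) :
    Epi ((TT K i).map S.f) :=
  (TT_exact₂ K hS i).epi_f (h.eq_of_tgt _ _)

lemma TT_zero_epi (K : ModuleCat.{u} R) {S : ShortComplex (ModuleCat.{u} R)}
    (hS : S.ShortExact) : Epi ((TT K 0).map S.g) := by
  have := (TC_shortExact K hS).epi_g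
  have : Epi (HomologicalComplex.opcyclesMap ((TC K).map S.g) 0) :=
    have h0 : Epi ((S.map (TC K)).g.f 0) := inferInstance
    have h1 : Epi (((TC K).map S.g).f 0 ≫ ((TC K).obj S.X₃).pOpcycles 0) :=
      @epi_comp _ _ _ _ _ _ h0 _ (inferInstanceAs
        (Epi (HomologicalComplex.pOpcycles ((S.map (TC K)).X₃) 0)))
    epi_of_epi_fac (HomologicalComplex.p_opcyclesMap ((TC K).map S.g) 0)
  have e := HomologicalComplex.homologyι_naturality ((TC K).map S.g) 0
  have h1 : IsIso (((TC K).obj S.X₂).homologyι 0) := inferInstance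
  have h2 : IsIso (((TC K).obj S.X₃).homologyι 0) := inferInstance
  rw [← IsIso.eq_comp_inv] at e
  change Epi (HomologicalComplex.homologyMap ((TC K).map S.g) 0)
  rw [e]
  infer_instance

noncomputable def TTshift (K : ModuleCat.{u} R) {S : ShortComplex (ModuleCat.{u} R)}
    (hS : S.ShortExact) (i : ℕ) (h : IsZero ((TT K i).obj S.X₂))
    (h' : IsZero ((TT K (i + 1)).obj S.X₂)) :
    (TT K (i + 1)).obj S.X₃ ≅ (TT K i).obj S.X₁ :=
  (TC_shortExact K hS).δIso (i + 1) i rfl h' h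

lemma TT_projective (K P : ModuleCat.{u} R) [Projective P] (i : ℕ) :
    IsZero ((TT K (i + 1)).obj P) := by
  have : Module.Projective R P := (IsProjective.iff_projective _).2 inferInstance
  change IsZero (((TC K).obj P).homology (i + 1))
  rw [← HomologicalComplex.exactAt_iff_isZero_homology]
  exact Module.Flat.rTensor_shortComplex_exact P _
    ((projectiveResolution K).complex_exactAt_succ i)

/-- `T₁` of the cokernel is the kernel -/
noncomputable def TTone (K : ModuleCat.{u} R) {S : ShortComplex (ModuleCat.{u} R)}
    (hS : S.ShortExact) (h : IsZero ((TT K 1).obj S.X₂)) :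
    (TT K 1).obj S.X₃ ≅ kernel ((TT K 0).map S.f) := by
  have ex := ((TC_shortExact K hS).homology_exact₁ 1 0 rfl)
  have : Mono ((TC_shortExact K hS).δ 1 0 rfl) := (TC_shortExact K hS).mono_δ 1 0 rfl h
  exact (ex.fIsKernel.conePointUniqueUpToIso (limit.isLimit _))

noncomputable def TCopc (K N : ModuleCat.{u} R) : ((TC K).obj N).opcycles 0 ⟶ K ⊗ N :=
  (projectiveResolution K).fromLeftDerivedZero' ((tensoringRight (ModuleCat.{u} R)).obj N)

lemma p_TCopc (K N : ModuleCat.{u} R) : ((TC K).obj N).pOpcycles 0 ≫ TCopc K N =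
    (projectiveResolution K).π.f 0 ▷ N :=
  (projectiveResolution K).pOpcycles_comp_fromLeftDerivedZero'
    ((tensoringRight (ModuleCat.{u} R)).obj N)

instance (K N : ModuleCat.{u} R) : IsIso (TCopc K N) := by
  have : PreservesFiniteColimits ((tensoringRight (ModuleCat.{u} R)).obj N) :=
    inferInstanceAs (PreservesFiniteColimits (tensorRight N))
  exact inferInstanceAs (IsIso ((projectiveResolution K).fromLeftDerivedZero'
    ((tensoringRight (ModuleCat.{u} R)).obj N)))

lemma TCopc_nat (K : ModuleCat.{u} R) {N N' : ModuleCat.{u} R} (f : N ⟶ N') :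
    HomologicalComplex.opcyclesMap ((TC K).map f) 0 ≫ TCopc K N' = TCopc K N ≫ K ◁ f := by
  rw [← cancel_epi (HomologicalComplex.pOpcycles _ _)]
  rw [HomologicalComplex.p_opcyclesMap_assoc, p_TCopc, ← Category.assoc, p_TCopc]
  exact whisker_exchange _ _

noncomputable def TTzero' (K N : ModuleCat.{u} R) : ((TC K).obj N).homology 0 ⟶ K ⊗ N :=
    ((TC K).obj N).homologyι 0 ≫ TCopc K N

noncomputable def TTzeroApp (K N : ModuleCat.{u} R) : (TT K 0).obj N ⟶ K ⊗ N :=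
    TTzero' K N

instance (K N : ModuleCat.{u} R) : IsIso (TTzeroApp K N) := by
  have h1 : IsIso (((TC K).obj N).homologyι 0) := inferInstance
  change IsIso (TTzero' K N)
  unfold TTzero'
  infer_instance

lemma TTzeroApp_nat (K : ModuleCat.{u} R) {N N' : ModuleCat.{u} R} (f : N ⟶ N') :
    (TT K 0).map f ≫ TTzeroApp K N' = TTzeroApp K N ≫ K ◁ f := by
  change HomologicalComplex.homologyMap ((TC K).map f) 0 ≫ TTzero' K N' = TTzero' K N ≫ K ◁ f
  unfold TTzero'
  rw [HomologicalComplex.homologyι_naturality_assoc, TCopc_nat, Category.assoc]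


noncomputable def syzSC (N : ModuleCat.{u} R) (i : ℕ) : ShortComplex (ModuleCat.{u} R) :=
  ShortComplex.mk ((projectiveResolution N).complex.fromOpcycles (i + 1) i)
    ((projectiveResolution N).complex.pOpcycles i) (by
      rw [← cancel_epi ((projectiveResolution N).complex.pOpcycles (i + 1))]
      simp)

lemma syzSC_shortExact (N : ModuleCat.{u} R) (i : ℕ) : (syzSC N i).ShortExact := by
  have h1 : Mono (syzSC N i).f :=
    Preadditive.mono_of_isZero_kernel' _
      ((projectiveResolution N).complex.homologyIsKernel (i + 1) i (by simp))
      ((projectiveResolution N).complex_exactAt_succ i).isZero_homology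
  have h2 : Epi (syzSC N i).g := by dsimp [syzSC]; infer_instance
  refine ShortComplex.ShortExact.mk ?_
  let S' : ShortComplex (ModuleCat.{u} R) :=
    ShortComplex.mk _ _ ((projectiveResolution N).complex.d_pOpcycles (i + 1) i)
  have ex : S'.Exact := ShortComplex.exact_of_g_is_cokernel _
    ((projectiveResolution N).complex.opcyclesIsCokernel (i + 1) i (by simp))
  let φ : S' ⟶ syzSC N i :=
    { τ₁ := (projectiveResolution N).complex.pOpcycles (i + 1)
      τ₂ := 𝟙 _
      τ₃ := 𝟙 _
      comm₁₂ := by simp [S', syzSC]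
      comm₂₃ := by simp [S', syzSC] }
  have : Epi φ.τ₁ :=
    inferInstanceAs (Epi (HomologicalComplex.pOpcycles (projectiveResolution N).complex (i + 1)))
  have : IsIso φ.τ₂ := inferInstanceAs (IsIso (𝟙 ((projectiveResolution N).complex.X i)))
  have : Mono φ.τ₃ :=
    inferInstanceAs (Mono (𝟙 (HomologicalComplex.opcycles (projectiveResolution N).complex i)))
  exact (ShortComplex.exact_iff_of_epi_of_isIso_of_mono φ).1 ex

noncomputable def homologyMapIsoKernel {C : Type*} [Category.{u} C] {D : Type*} [Category.{u} D] [Abelian C]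
    [Abelian D] (F : C ⥤ D) [F.Additive] [PreservesFiniteColimits F] (X : ChainComplex C ℕ)
    (i : ℕ) : ((F.mapHomologicalComplex _).obj X).homology (i + 1) ≅
      kernel (F.map (X.fromOpcycles (i + 1) i)) := by
  let Y := (F.mapHomologicalComplex (ComplexShape.down ℕ)).obj X
  let e : Y.opcycles (i + 1) ≅ F.obj (X.opcycles (i + 1)) :=
    (Y.opcyclesIsCokernel (i + 2) (i + 1) (by simp)).coconePointUniqueUpToIso
      (CokernelCofork.mapIsColimit _ (X.opcyclesIsCokernel (i + 2) (i + 1) (by simp)) F)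
  have he : Y.pOpcycles (i + 1) ≫ e.hom = F.map (X.pOpcycles (i + 1)) :=
    (Y.opcyclesIsCokernel (i + 2) (i + 1) (by simp)).comp_coconePointUniqueUpToIso_hom
      (CokernelCofork.mapIsColimit _ (X.opcyclesIsCokernel (i + 2) (i + 1) (by simp)) F)
        WalkingParallelPair.one
  let a : F.obj (X.opcycles (i + 1)) ⟶ Y.X i := F.map (X.fromOpcycles (i + 1) i)
  have ha : F.map (X.pOpcycles (i + 1)) ≫ a = Y.d (i + 1) i := by
    change F.map (X.pOpcycles (i + 1)) ≫ F.map (X.fromOpcycles (i + 1) i) = F.map (X.d (i + 1) i)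
    rw [← F.map_comp, X.p_fromOpcycles]
  have hk' : Y.fromOpcycles (i + 1) i = e.hom ≫ a :=
    (cancel_epi (Y.pOpcycles (i + 1))).1 (by
      rw [Y.p_fromOpcycles, ← Category.assoc, he]; exact ha.symm)
  have hk : Y.fromOpcycles (i + 1) i ≫ 𝟙 (Y.X i) = e.hom ≫ a := by
    rw [Category.comp_id, hk']
  exact (Y.homologyIsKernel (i + 1) i (by simp)).conePointUniqueUpToIso (limit.isLimit _) ≪≫
    kernel.mapIso _ _ e (Iso.refl _) hk

lemma TT_syz (K N : ModuleCat.{u} R) (i j : ℕ) :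
    Nonempty ((TT K (i + 1)).obj ((projectiveResolution N).complex.opcycles j) ≅
      (TT K 1).obj ((projectiveResolution N).complex.opcycles (i + j))) := by
  induction i generalizing j with
  | zero => rw [zero_add, zero_add]; exact ⟨Iso.refl _⟩
  | succ i ih =>
    obtain ⟨e⟩ := ih (j + 1)
    have : Projective ((syzSC N j).X₂) := (projectiveResolution N).projective j
    have e' := TTshift K (syzSC_shortExact N j) (i + 1) (TT_projective K _ _) (TT_projective K _ _)
    rw [show i + 1 + j = i + (j + 1) by omega]
    exact ⟨e' ≪≫ e⟩

lemma tor_iso_TT (K N : ModuleCat.{u} R) (i : ℕ) :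
    Nonempty (((Tor (ModuleCat.{u} R) i).obj K).obj N ≅ (TT K i).obj N) := by
  have hF : PreservesFiniteColimits ((tensoringLeft (ModuleCat.{u} R)).obj K) :=
    inferInstanceAs (PreservesFiniteColimits (tensorLeft K))
  rcases i with - | i
  · exact ⟨((tensoringLeft (ModuleCat.{u} R)).obj K).leftDerivedZeroIsoSelf.app N ≪≫
      (asIso (TTzeroApp K N)).symm⟩
  · have e1 := (projectiveResolution N).isoLeftDerivedObj
      ((tensoringLeft (ModuleCat.{u} R)).obj K) (i + 1)
    have e2 := homologyMapIsoKernel ((tensoringLeft (ModuleCat.{u} R)).obj K)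
      (projectiveResolution N).complex i
    have : Projective ((syzSC N i).X₂) := (projectiveResolution N).projective i
    have e3 := TTone K (syzSC_shortExact N i) (TT_projective K _ _)
    have e4 : kernel ((TT K 0).map (syzSC N i).f) ≅ kernel (K ◁ (syzSC N i).f) :=
      kernel.mapIso _ _ (asIso (TTzeroApp K _)) (asIso (TTzeroApp K _)) (TTzeroApp_nat K _)
    obtain ⟨e5⟩ := TT_syz K N i 0
    let e6 : (projectiveResolution N).complex.opcycles 0 ≅ N :=
      ((projectiveResolution N).complex.opcyclesIsCokernel 1 0 (by simp)).coconePointUniqueUpToIso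
        ((projectiveResolution N).isColimitCokernelCofork)
    exact ⟨e1 ≪≫ e2 ≪≫ e4.symm ≪≫ e3.symm ≪≫ e5.symm ≪≫ (TT K (i + 1)).mapIso e6⟩

lemma smul_id_of_iso (r : R) {A B : ModuleCat.{u} R} (e : A ≅ B) (h : r • 𝟙 B = 0) :
    r • 𝟙 A = 0 := by
  rw [← cancel_mono e.hom, Linear.smul_comp, Category.id_comp, zero_comp,
    ← Category.comp_id e.hom, ← Linear.comp_smul, h, comp_zero]

lemma tor_smul_eq_zero (K N : ModuleCat.{u} R) (i : ℕ) (r : R) (hr : ∀ x : K, r • x = 0) :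
    r • 𝟙 (((Tor (ModuleCat.{u} R) i).obj K).obj N) = 0 := by
  let e := (projectiveResolution N).isoLeftDerivedObj
      ((tensoringLeft (ModuleCat.{u} R)).obj K) i
  let Y := (((tensoringLeft (ModuleCat.{u} R)).obj K).mapHomologicalComplex
    (ComplexShape.down ℕ)).obj (projectiveResolution N).complex
  have h0 : r • 𝟙 Y = 0 := by
    ext j : 1
    have h : r • 𝟙 K = 0 := by ext x; exact hr x
    have h2 : r • 𝟙 (K ⊗ (projectiveResolution N).complex.X j) = 0 := by
      rw [← MonoidalCategory.id_whiskerRight, ← MonoidalLinear.smul_whiskerRight, h]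
      exact MonoidalPreadditive.zero_whiskerRight
    exact h2
  have h1 : r • 𝟙 (Y.homology i) = 0 := by
    have := ShortComplex.homologyMap_smul
      ((HomologicalComplex.shortComplexFunctor _ _ i).map (𝟙 Y)) r
    have e1 : r • ((HomologicalComplex.shortComplexFunctor (ModuleCat.{u} R)
      (ComplexShape.down ℕ) i).map (𝟙 Y)) = 
      (HomologicalComplex.shortComplexFunctor _ _ i).map (r • 𝟙 Y) := rfl
    have e2 : (HomologicalComplex.shortComplexFunctor (ModuleCat.{u} R)
      (ComplexShape.down ℕ) i).map (0 : Y ⟶ Y) = 0 := rfl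
    rw [e1, h0, e2, ShortComplex.homologyMap_zero, CategoryTheory.Functor.map_id,
      ShortComplex.homologyMap_id] at this
    exact this.symm
  exact smul_id_of_iso r e h1

lemma TT_smul_eq_zero (K N : ModuleCat.{u} R) (i : ℕ) (r : R) (hr : ∀ x : K, r • x = 0) :
    r • 𝟙 ((TT K i).obj N) = 0 := by
  obtain ⟨e⟩ := tor_iso_TT K N i
  have := tor_smul_eq_zero K N i r hr
  rw [← cancel_epi e.hom, Linear.comp_smul, Category.comp_id, comp_zero,
    ← Category.id_comp e.hom, ← Linear.smul_comp, this, zero_comp]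

lemma TT_isZero_of_bijective (K N : ModuleCat.{u} R) (i : ℕ) (r : R) (hr : ∀ x : K, r • x = 0)
    (hN : IsIso (r • 𝟙 N)) : IsZero ((TT K i).obj N) := by
  have h := (TT K i).map_isIso (r • 𝟙 N)
  rw [TT_smul, CategoryTheory.Functor.map_id, TT_smul_eq_zero K N i r hr] at h
  exact ((isIsoZero_iff_source_target_isZero _ _).1 h).1

/-- if `T` vanishes on the middle term, and `r` kills everything -/
lemma TT_isZero_of_factor (K : ModuleCat.{u} R) (i : ℕ) {N E : ModuleCat.{u} R} (f : N ⟶ E)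
    (g : E ⟶ N) (h : f ≫ g = 𝟙 N) (hE : IsZero ((TT K i).obj E)) : IsZero ((TT K i).obj N) := by
  rw [IsZero.iff_id_eq_zero, ← CategoryTheory.Functor.map_id, ← h, Functor.map_comp,
    hE.eq_of_tgt ((TT K i).map f) 0, zero_comp]

end Tor
end LCAux

namespace LCAux
open Limits MonoidalCategory

section Good
variable {R : Type u} [CommRing R]

lemma injective_restrict {A : Type u} [CommRing A] [Algebra R A] [Module.Flat R A]
    {J : Type u} [AddCommGroup J] [Module R J] [Module A J] [IsScalarTower R A J]
    (hJ : Module.Injective A J) : Module.Injective R J where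
  out X Y _ _ _ _ f hf g := by
    have hinj : Function.Injective (f.baseChange A) :=
      Module.Flat.lTensor_preserves_injective_linearMap (M := A) f hf
    obtain ⟨l, hl⟩ := hJ.out (f.baseChange A) hinj (LinearMap.liftBaseChange A g)
    refine ⟨(l.restrictScalars R).comp ((TensorProduct.mk R A Y) 1), fun x => ?_⟩
    have := hl (1 ⊗ₜ x)
    simpa using this

lemma exists_Jx (x : R) (N : ModuleCat.{u} R) : ∃ (J : ModuleCat.{u} R) (f : N ⟶ J),
    Module.Injective R J ∧ IsIso (x • 𝟙 J) ∧ ∀ n : N, f n = 0 → ∃ k : ℕ, x ^ k • n = 0 := by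
  let A := Localization.Away x
  let Nx := ModuleCat.of A (LocalizedModule (Submonoid.powers x) N)
  let J' : ModuleCat.{u} A := Injective.under Nx
  let _ : Module R J' := Module.compHom J' (algebraMap R A)
  have : IsScalarTower R A J' := IsScalarTower.of_algebraMap_smul fun _ _ => rfl
  have hJ' : Module.Injective A J' :=
    @Module.injective_module_of_injective_object A J' _ _ _ (inferInstanceAs (Injective J'))
  have : Module.Flat R A := IsLocalization.flat A (Submonoid.powers x)
  let ι : (LocalizedModule (Submonoid.powers x) N) →ₗ[A] J' := (Injective.ι Nx).hom
  have hι : Function.Injective ι := (ModuleCat.mono_iff_injective (Injective.ι Nx)).1 inferInstance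
  let f : N →ₗ[R] J' := (ι.restrictScalars R).comp (LocalizedModule.mkLinearMap _ _)
  refine ⟨ModuleCat.of R J', ModuleCat.ofHom f, injective_restrict hJ', ?_, ?_⟩
  · have hb : Function.Bijective (fun j : J' => x • j) := by
      have hu : IsUnit (algebraMap R A x) := IsLocalization.Away.algebraMap_isUnit x
      exact MulAction.bijective hu.unit
    rw [ConcreteCategory.isIso_iff_bijective]
    exact hb
  · intro n hn
    have h1 : LocalizedModule.mkLinearMap (Submonoid.powers x) N n = 0 :=
      hι (by rw [map_zero]; exact hn)
    rw [IsLocalizedModule.eq_zero_iff (Submonoid.powers x)] at h1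
    obtain ⟨⟨_, k, rfl⟩, hk⟩ := h1
    exact ⟨k, hk⟩

/-- no elements killed by `a` -/
def TF (a : Ideal R) (N : ModuleCat.{u} R) : Prop := ∀ n : N, (∀ y ∈ a, y • n = 0) → n = 0

lemma TF.pow {a : Ideal R} {N : ModuleCat.{u} R} (h : TF a N) (t : ℕ) :
    ∀ n : N, (∀ y ∈ a ^ t, y • n = 0) → n = 0 := by
  induction t with
  | zero => intro n hn; simpa using hn 1 (by simp)
  | succ t ih =>
    intro n hn
    refine ih n fun z hz => h _ fun y hy => ?_
    rw [← mul_smul]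
    exact hn _ (by rw [pow_succ, mul_comm y z]; exact Ideal.mul_mem_mul hz hy)

structure Good (a : Ideal R) (K E : ModuleCat.{u} R) : Prop where
  inj : Injective E
  tf : TF a E
  van : ∀ i, IsZero ((TT K i).obj E)

lemma TT_isZero_pi (K : ModuleCat.{u} R) (i : ℕ) {ι : Type u} [Fintype ι] (J : ι → ModuleCat.{u} R)
    (h : ∀ x, IsZero ((TT K i).obj (J x))) :
    IsZero ((TT K i).obj (ModuleCat.of R (∀ x, J x))) := by
  classical
  have h1 : 𝟙 (ModuleCat.of R (∀ x, J x)) =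
      ∑ x, (ModuleCat.ofHom (LinearMap.proj x : (∀ x, J x) →ₗ[R] J x) ≫
        ModuleCat.ofHom (LinearMap.single R (fun x => J x) x)) := by
    refine ModuleCat.hom_ext (LinearMap.ext fun v => ?_)
    rw [ModuleCat.hom_sum, LinearMap.sum_apply]
    exact (Finset.univ_sum_single v).symm
  rw [IsZero.iff_id_eq_zero, ← CategoryTheory.Functor.map_id, h1, Functor.map_sum]
  refine Finset.sum_eq_zero fun x _ => ?_
  rw [Functor.map_comp, (h x).eq_of_tgt ((TT K i).map _) 0, zero_comp]

lemma exists_good (a : Ideal R) (ha : a.FG) (K : ModuleCat.{u} R)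
    (hK : ∀ r ∈ a, ∀ x : K, r • x = 0) (N : ModuleCat.{u} R) (hN : TF a N) :
    ∃ (E : ModuleCat.{u} R) (f : N ⟶ E), Mono f ∧ Good a K E := by
  obtain ⟨S, rfl⟩ := ha
  choose J f hJ hiso hker using fun x : R => exists_Jx x N
  let J' : S → ModuleCat.{u} R := fun j => J j.1
  have hmem : ∀ j : S, j.1 ∈ Ideal.span (S : Set R) :=
    fun j => Ideal.subset_span j.2
  let g : N →ₗ[R] (∀ j, J' j) := LinearMap.pi fun j => (f j.1).hom
  refine ⟨ModuleCat.of R (∀ j, J' j), ModuleCat.ofHom g, ?_, ?_, ?_, ?_⟩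
  · rw [ModuleCat.mono_iff_injective]
    change Function.Injective g
    rw [injective_iff_map_eq_zero]
    intro n hn
    have h1 : ∀ x ∈ S, ∃ k : ℕ, x ^ k • n = 0 := fun x hx => hker x n (by
      have := congr_fun hn ⟨x, hx⟩
      exact this)
    have h2 : Ideal.span (S : Set R) ≤ (Ideal.torsionOf R N n).radical := by
      rw [Ideal.span_le]
      intro x hx
      obtain ⟨k, hk⟩ := h1 x hx
      exact ⟨k, (Ideal.mem_torsionOf_iff _ _).2 hk⟩
    obtain ⟨t, ht⟩ := Ideal.exists_pow_le_of_le_radical_of_fg h2 ⟨S, rfl⟩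
    exact hN.pow t n fun y hy => (Ideal.mem_torsionOf_iff _ _).1 (ht hy)
  · have : ∀ j, Module.Injective R (J' j) := fun j => hJ _
    exact Module.injective_object_of_injective_module R (∀ j, J' j)
  · intro v hv
    funext j
    have h1 := hiso j.1
    rw [ConcreteCategory.isIso_iff_bijective] at h1
    have h2 := hv _ (hmem j)
    apply h1.1
    refine Eq.trans ?_ (map_zero _).symm
    exact congr_fun h2 j
  · intro i
    exact TT_isZero_pi K i J' fun j =>
      TT_isZero_of_bijective K _ i _ (hK _ (hmem j)) (hiso _)

end Good
end LCAux

namespace LCAux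
open Limits MonoidalCategory
open Abelian (Ext)
open Abelian.Ext (mk₀)

section ClaimA
variable {R : Type u} [CommRing R]

def G (a : Ideal R) (N : ModuleCat.{u} R) : Prop :=
  ∀ (X : ModuleCat.{u} R), (∀ r ∈ a, ∀ x : X, r • x = 0) →
    ∀ (i : ℕ) (α : Abelian.Ext X N i), α = 0

def QQ (y : R) (N : ModuleCat.{u} R) : Prop :=
  ∀ (X : ModuleCat.{u} R) (i : ℕ) (α : Abelian.Ext X N (i + 1)), ∃ t : ℕ, y ^ t • α = 0

variable {S : ShortComplex (ModuleCat.{u} R)}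

lemma G.three {a : Ideal R} (hS : S.ShortExact) (h1 : G a S.X₁) (h2 : G a S.X₂) : G a S.X₃ := by
  intro X hX i α
  obtain ⟨β, rfl⟩ := Abelian.Ext.covariant_sequence_exact₃ X hS α rfl (h1 X hX _ _)
  rw [h2 X hX i β, Abelian.Ext.zero_comp]

lemma G.two {a : Ideal R} (hS : S.ShortExact) (h1 : G a S.X₁) (h3 : G a S.X₃) : G a S.X₂ := by
  intro X hX i α
  obtain ⟨β, rfl⟩ := Abelian.Ext.covariant_sequence_exact₂ X hS α (h3 X hX _ _)
  rw [h1 X hX i β, Abelian.Ext.zero_comp]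

lemma QQ.three {y : R} (hS : S.ShortExact) (h1 : QQ y S.X₁) (h2 : QQ y S.X₂) : QQ y S.X₃ := by
  intro X i α
  obtain ⟨t, ht⟩ := h1 X (i + 1) (α.comp hS.extClass rfl)
  rw [← Abelian.Ext.smul_comp] at ht
  obtain ⟨β, hβ⟩ := Abelian.Ext.covariant_sequence_exact₃ X hS _ rfl ht
  obtain ⟨s, hs⟩ := h2 X i β
  refine ⟨s + t, ?_⟩
  rw [pow_add, mul_smul, ← hβ, ← Abelian.Ext.smul_comp, hs, Abelian.Ext.zero_comp]

lemma QQ.two {y : R} (hS : S.ShortExact) (h1 : QQ y S.X₁) (h3 : QQ y S.X₃) : QQ y S.X₂ := by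
  intro X i α
  obtain ⟨t, ht⟩ := h3 X i (α.comp (mk₀ S.g) (add_zero _))
  rw [← Abelian.Ext.smul_comp] at ht
  obtain ⟨β, hβ⟩ := Abelian.Ext.covariant_sequence_exact₂ X hS _ ht
  obtain ⟨s, hs⟩ := h1 X i β
  refine ⟨s + t, ?_⟩
  rw [pow_add, mul_smul, ← hβ, ← Abelian.Ext.smul_comp, hs, Abelian.Ext.zero_comp]

lemma QQ.of_injective (y : R) (E : ModuleCat.{u} R) [Injective E] : QQ y E :=
  fun _ _ α => ⟨0, by rw [Abelian.Ext.eq_zero_of_injective α, smul_zero]⟩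

lemma G.of_tf {a : Ideal R} {E : ModuleCat.{u} R} [Injective E] (h : TF a E) : G a E := by
  intro X hX i α
  rcases i with - | i
  · obtain ⟨f, rfl⟩ := (Abelian.Ext.mk₀_bijective X E).2 α
    have : f = 0 := by
      ext x
      exact h _ fun y hy => by
        rw [← map_smul, hX y hy, map_zero]
    rw [this, Abelian.Ext.mk₀_zero]
  · exact Abelian.Ext.eq_zero_of_injective α

lemma G.tf {a : Ideal R} {N : ModuleCat.{u} R} (h : G a N) : TF a N := by
  intro n hn
  let f : (R ⧸ a) →ₗ[R] N := Submodule.liftQ a (LinearMap.toSpanSingleton R N n) (by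
    intro y hy; exact hn y hy)
  have h1 := h (ModuleCat.of R (R ⧸ a)) (by
    intro r hr x
    obtain ⟨x, rfl⟩ := Submodule.Quotient.mk_surjective _ x
    rw [← Submodule.Quotient.mk_smul, Submodule.Quotient.mk_eq_zero]
    exact a.mul_mem_right _ hr) 0 (mk₀ (ModuleCat.ofHom f))
  rw [Abelian.Ext.mk₀_eq_zero_iff] at h1
  have h2 : f (Submodule.Quotient.mk 1) = 0 := by
    have := congr_arg (fun g => g.hom (Submodule.Quotient.mk (p := a) 1)) h1
    exact this
  have h3 : f (Submodule.Quotient.mk 1) = (1 : R) • n := rfl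
  rw [← one_smul R n, ← h3, h2]

lemma shortExact_mk {A B C : ModuleCat.{u} R} (f : A ⟶ B) (g : B ⟶ C) (w : f ≫ g = 0)
    (hf : Function.Injective f) (hg : Function.Surjective g)
    (he : ∀ b : B, g b = 0 → ∃ a, f a = b) : (ShortComplex.mk f g w).ShortExact where
  exact := by
    rw [ShortComplex.moduleCat_exact_iff]; exact he
  mono_f := (ModuleCat.mono_iff_injective _).2 hf
  epi_g := (ModuleCat.epi_iff_surjective _).2 hg

lemma injective_of_ext_one {N : ModuleCat.{u} R}
    (h : ∀ (I : Ideal R) (α : Abelian.Ext (ModuleCat.of R (R ⧸ I)) N 1), α = 0) : Injective N := by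
  have hb : Module.Baer R N := by
    intro I g
    have hS := shortExact_mk (ModuleCat.ofHom I.subtype) (ModuleCat.ofHom I.mkQ)
      (by ext x; exact (Submodule.Quotient.mk_eq_zero I).2 x.2) (Subtype.val_injective) (Submodule.mkQ_surjective I)
      (fun b hb => ⟨⟨b, (Submodule.Quotient.mk_eq_zero I).1 hb⟩, rfl⟩)
    obtain ⟨β, hβ⟩ := Abelian.Ext.contravariant_sequence_exact₁ hS N (mk₀ (ModuleCat.ofHom g))
      (add_zero 1) (h I _)
    obtain ⟨g', rfl⟩ := (Abelian.Ext.mk₀_bijective _ _).2 β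
    rw [Abelian.Ext.mk₀_comp_mk₀] at hβ
    have h2 := (Abelian.Ext.mk₀_bijective _ _).1 hβ
    refine ⟨g'.hom, fun x hx => ?_⟩
    exact congr_arg (fun f => f.hom (⟨x, hx⟩ : I)) h2
  have := hb.injective
  exact Module.injective_object_of_injective_module R N

lemma ext_one_step {N : ModuleCat.{u} R} {I J L : Ideal R} (y : R) (hJ : ∀ r, r ∈ J ↔ y * r ∈ I)
    (hIL : I ≤ L) (hyL : y ∈ L) (hL : ∀ r ∈ L, ∃ s, r - y * s ∈ I)
    (h1 : ∀ α : Abelian.Ext (ModuleCat.of R (R ⧸ J)) N 1, α = 0 ∨ (J = I ∧ ∃ t : ℕ, y ^ t • α = 0))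
    (h2 : ∀ α : Abelian.Ext (ModuleCat.of R (R ⧸ L)) N 1, α = 0) 
    (α : Abelian.Ext (ModuleCat.of R (R ⧸ I)) N 1) : α = 0 := by
  let f : (R ⧸ J) →ₗ[R] (R ⧸ I) := Submodule.mapQ J I (LinearMap.lsmul R R y) (fun r hr =>
    (hJ r).1 hr)
  have hf : ∀ r : R, f (Submodule.Quotient.mk r) = Submodule.Quotient.mk (y * r) := fun r => rfl
  let g : (R ⧸ I) →ₗ[R] (R ⧸ L) := Submodule.factor hIL
  have hg : ∀ r : R, g (Submodule.Quotient.mk r) = Submodule.Quotient.mk r := fun r => rfl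
  have hS := shortExact_mk (ModuleCat.ofHom f) (ModuleCat.ofHom g) (by
      refine ModuleCat.hom_ext (LinearMap.ext fun x => ?_)
      obtain ⟨r, rfl⟩ := Submodule.Quotient.mk_surjective _ x
      change g (f (Submodule.Quotient.mk r)) = 0
      rw [hf, hg, Submodule.Quotient.mk_eq_zero]
      exact L.mul_mem_right _ hyL)
    (by
      change Function.Injective f
      rw [injective_iff_map_eq_zero]
      intro x hx
      obtain ⟨r, rfl⟩ := Submodule.Quotient.mk_surjective _ x
      rw [hf, Submodule.Quotient.mk_eq_zero] at hx
      rw [Submodule.Quotient.mk_eq_zero]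
      exact (hJ r).2 hx)
    (by
      intro x
      obtain ⟨r, rfl⟩ := Submodule.Quotient.mk_surjective _ x
      exact ⟨Submodule.Quotient.mk r, rfl⟩)
    (by
      intro x hx
      obtain ⟨r, rfl⟩ := Submodule.Quotient.mk_surjective _ x
      have hx' : r ∈ L := (Submodule.Quotient.mk_eq_zero L).1 hx
      obtain ⟨s, hs⟩ := hL r hx'
      refine ⟨Submodule.Quotient.mk s, ?_⟩
      exact ((Submodule.Quotient.eq I).2 hs).symm)
  have key : ∀ β : Abelian.Ext (ModuleCat.of R (R ⧸ I)) N 1,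
      (mk₀ (ModuleCat.ofHom f)).comp β (zero_add 1) = 0 → β = 0 := by
    intro β hβ
    obtain ⟨γ, rfl⟩ := Abelian.Ext.contravariant_sequence_exact₂ hS N β hβ
    rw [h2 γ, Abelian.Ext.comp_zero]
  by_cases hJI : J = I
  · subst hJI
    have hf' : ModuleCat.ofHom f = y • 𝟙 _ := by
      refine ModuleCat.hom_ext (LinearMap.ext fun x => ?_)
      obtain ⟨r, rfl⟩ := Submodule.Quotient.mk_surjective _ x
      rfl
    have key' : ∀ β : Abelian.Ext (ModuleCat.of R (R ⧸ J)) N 1, y • β = 0 → β = 0 := by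
      intro β hβ
      apply key
      rw [hf', Abelian.Ext.mk₀_smul, Abelian.Ext.smul_comp, Abelian.Ext.mk₀_id_comp, hβ]
    have key2 : ∀ (t : ℕ) (β : Abelian.Ext (ModuleCat.of R (R ⧸ J)) N 1),
        y ^ t • β = 0 → β = 0 := by
      intro t
      induction t with
      | zero => intro β h; simpa using h
      | succ t ih => intro β h; exact key' _ (ih _ (by rw [← mul_smul, ← pow_succ, h]))
    rcases h1 α with h | ⟨-, t, ht⟩
    · exact h
    · exact key2 t _ ht
  · apply key
    rcases h1 ((mk₀ (ModuleCat.ofHom f)).comp α (zero_add 1)) with h | h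
    · exact h
    · exact absurd h.1 hJI

lemma injective_base [IsNoetherianRing R] (s : Finset R) (N : ModuleCat.{u} R)
    (hG : G (Ideal.span (s : Set R)) N) (hQ : ∀ y ∈ s, QQ y N) : Injective N := by
  apply injective_of_ext_one
  intro I
  induction I using IsNoetherian.induction with
  | hgt I ih =>
    by_cases hI : Ideal.span (s : Set R) ≤ I
    · intro α
      refine hG _ ?_ _ α
      intro r hr x
      obtain ⟨x, rfl⟩ := Submodule.Quotient.mk_surjective _ x
      rw [← Submodule.Quotient.mk_smul, Submodule.Quotient.mk_eq_zero]
      exact Ideal.mul_mem_right _ I (hI hr)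
    · rw [Ideal.span_le, Set.not_subset] at hI
      obtain ⟨y, hy, hyI⟩ := hI
      let J : Ideal R := Submodule.comap (LinearMap.lsmul R R y) I
      have hIJ : I ≤ J := fun r hr => Ideal.mul_mem_left I y hr
      refine ext_one_step (I := I) (J := J) (L := I ⊔ Ideal.span {y}) y (fun r => Iff.rfl)
        le_sup_left (Ideal.mem_sup_right (Ideal.mem_span_singleton_self y)) ?_ ?_ ?_
      · intro r hr
        obtain ⟨i, hi, z, hz, rfl⟩ := Submodule.mem_sup.1 hr
        obtain ⟨c, rfl⟩ := Ideal.mem_span_singleton.1 hz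
        exact ⟨c, by simpa using hi⟩
      · intro α
        by_cases h : J = I
        · exact Or.inr ⟨h, hQ y hy _ 0 α⟩
        · exact Or.inl (ih J (lt_of_le_of_ne hIJ (Ne.symm h)) α)
      · apply ih
        refine lt_of_le_of_ne le_sup_left fun h => hyI ?_
        rw [h]
        exact Ideal.mem_sup_right (Ideal.mem_span_singleton_self y)


lemma biprod_shortExact (A B : ModuleCat.{u} R) :
    (ShortComplex.mk (biprod.inl : A ⟶ A ⊞ B) biprod.snd (by simp)).ShortExact :=
  (ShortComplex.Splitting.ofHasBinaryBiproduct A B).shortExact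

lemma QQ.cone {N E : ModuleCat.{u} R} [Injective E] (x : R) (ι : N ⟶ E)
    {C : ModuleCat.{u} R} {f : N ⟶ N ⊞ E} {g : N ⊞ E ⟶ C} {w : f ≫ g = 0}
    (hS : (ShortComplex.mk f g w).ShortExact) (hf : f = biprod.lift (x • 𝟙 N) ι) : QQ x C := by
  intro X i α
  have h1 : x • (α.comp hS.extClass rfl) = 0 := by
    have h : ((α.comp hS.extClass rfl).comp (mk₀ f) (add_zero (i + 2))).comp
        (mk₀ (biprod.fst : N ⊞ E ⟶ N)) (add_zero (i + 2)) = 0 := by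
      have : hS.extClass.comp (mk₀ f) (add_zero 1) = 0 := hS.extClass_comp
      rw [Abelian.Ext.comp_assoc_of_third_deg_zero α, this, Abelian.Ext.comp_zero,
        Abelian.Ext.zero_comp]
    have hff : f ≫ biprod.fst = x • 𝟙 N := by rw [hf, biprod.lift_fst]
    rw [Abelian.Ext.comp_assoc_of_third_deg_zero, Abelian.Ext.mk₀_comp_mk₀, hff,
      Abelian.Ext.mk₀_smul, Abelian.Ext.comp_smul, Abelian.Ext.comp_mk₀_id] at h
    exact h
  rw [← Abelian.Ext.smul_comp] at h1
  obtain ⟨β, hβ⟩ := Abelian.Ext.covariant_sequence_exact₃ X hS _ rfl h1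
  refine ⟨2, ?_⟩
  rw [pow_two, mul_smul, ← hβ]
  change x • β.comp (mk₀ g) (add_zero (i + 1)) = 0
  have e1 : x • 𝟙 (N ⊞ E) = biprod.fst ≫ f + biprod.snd ≫ (x • biprod.inr)
      - biprod.fst ≫ ι ≫ biprod.inr := by
    rw [hf]
    apply biprod.hom_ext' <;> apply biprod.hom_ext <;> simp
  have e2 : (x • 𝟙 (N ⊞ E)) ≫ g = biprod.snd ≫ (x • biprod.inr) ≫ g
      + biprod.fst ≫ ι ≫ (- biprod.inr) ≫ g := by
    rw [e1, Preadditive.sub_comp, Preadditive.add_comp, Category.assoc, w]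
    simp [sub_eq_add_neg]
  have e3 : x • β.comp (mk₀ g) (add_zero (i + 1)) =
      β.comp (mk₀ ((x • 𝟙 (N ⊞ E)) ≫ g)) (add_zero (i + 1)) := by
    rw [Linear.smul_comp, Category.id_comp, Abelian.Ext.mk₀_smul, Abelian.Ext.comp_smul]
  rw [e3, e2, Abelian.Ext.mk₀_add, Abelian.Ext.comp_add, ← Abelian.Ext.mk₀_comp_mk₀,
    ← Abelian.Ext.comp_assoc_of_third_deg_zero, ← Category.assoc biprod.fst,
    ← Abelian.Ext.mk₀_comp_mk₀ (biprod.fst ≫ ι),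
    ← Abelian.Ext.comp_assoc_of_third_deg_zero,
    Abelian.Ext.eq_zero_of_injective (β.comp (mk₀ (biprod.snd : N ⊞ E ⟶ E)) (add_zero (i + 1))),
    Abelian.Ext.eq_zero_of_injective (β.comp (mk₀ (biprod.fst ≫ ι : N ⊞ E ⟶ E)) (add_zero (i + 1))),
    Abelian.Ext.zero_comp, Abelian.Ext.zero_comp, add_zero]

lemma TT_cone {K N E : ModuleCat.{u} R} (x : R) (ι : N ⟶ E)
    (hS : (ShortComplex.mk (biprod.lift (x • 𝟙 N) ι) (cokernel.π (biprod.lift (x • 𝟙 N) ι))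
      (cokernel.condition _)).ShortExact) (hx : ∀ k : K, x • k = 0) (i : ℕ)
    (hE : IsZero ((TT K i).obj E))
    (hC : IsZero ((TT K (i + 1)).obj (cokernel (biprod.lift (x • 𝟙 N) ι)))) :
    IsZero ((TT K i).obj N) := by
  have h1 : Mono ((TT K i).map (biprod.lift (x • 𝟙 N) ι)) := TT_mono K hS i hC
  have e1 : biprod.lift (x • 𝟙 N) ι = x • biprod.inl + ι ≫ biprod.inr := by
    apply biprod.hom_ext <;> simp
  have h2 : (TT K i).map (biprod.lift (x • 𝟙 N) ι) = 0 := by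
    rw [e1, Functor.map_add, TT_smul, Functor.map_comp, hE.eq_of_tgt ((TT K i).map ι) 0,
      zero_comp, add_zero, ← Category.id_comp ((TT K i).map biprod.inl), ← Linear.smul_comp,
      TT_smul_eq_zero K N i x hx, zero_comp]
  rw [h2] at h1
  rw [IsZero.iff_id_eq_zero]
  exact (cancel_mono (0 : (TT K i).obj N ⟶ (TT K i).obj (N ⊞ E))).1 (by simp)

lemma claimA_aux [IsNoetherianRing R] (s : Finset R) (K : ModuleCat.{u} R)
    (hK : ∀ r ∈ Ideal.span (s : Set R), ∀ x : K, r • x = 0) (U : Finset R) (hU : U ⊆ s) :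
    ∀ N : ModuleCat.{u} R, G (Ideal.span (s : Set R)) N → (∀ y ∈ s, y ∉ U → QQ y N) →
      ∀ i, IsZero ((TT K i).obj N) := by
  classical
  induction U using Finset.induction_on with
  | empty =>
    intro N hG hQ i
    have := injective_base s N hG (fun y hy => hQ y hy (by simp))
    obtain ⟨E, f, hf, hE⟩ := exists_good _ ⟨s, rfl⟩ K hK N hG.tf
    exact TT_isZero_of_factor K i f (Injective.factorThru (𝟙 N) f)
      (Injective.comp_factorThru _ _) (hE.van i)
  | insert x U hxU ih =>
    intro N hG hQ i
    obtain ⟨E, ι, hι, hE⟩ := exists_good _ ⟨s, rfl⟩ K hK N hG.tf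
    have := hE.inj
    have hm : Mono (biprod.lift (x • 𝟙 N) ι) := by
      have : Mono (biprod.lift (x • 𝟙 N) ι ≫ biprod.snd) := by rw [biprod.lift_snd]; exact hι
      exact mono_of_mono _ biprod.snd
    have hS : (ShortComplex.mk (biprod.lift (x • 𝟙 N) ι) (cokernel.π (biprod.lift (x • 𝟙 N) ι))
      (cokernel.condition _)).ShortExact :=
      { exact := ShortComplex.exact_cokernel _
        mono_f := hm
        epi_g := inferInstanceAs (Epi (cokernel.π (biprod.lift (x • 𝟙 N) ι))) }
    have hxs : x ∈ s := hU (Finset.mem_insert_self x U)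
    have hG2 : G (Ideal.span (s : Set R)) (N ⊞ E) :=
      G.two (biprod_shortExact N E) hG (G.of_tf hE.tf)
    have hC := ih (fun y hy => hU (Finset.mem_insert_of_mem hy))
      (cokernel (biprod.lift (x • 𝟙 N) ι))
      (G.three hS hG hG2) (by
        intro y hy hyU
        by_cases hyx : y = x
        · subst hyx; exact QQ.cone y ι hS rfl
        · have hN : QQ y N := hQ y hy (by simp [hyx, hyU])
          have hQ2 : QQ y (N ⊞ E) :=
            QQ.two (biprod_shortExact N E) hN (QQ.of_injective y E)
          exact QQ.three hS hN hQ2)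
    exact TT_cone x ι hS (hK x (Ideal.subset_span hxs)) i (hE.van i) (hC (i + 1))

theorem claimA [IsNoetherianRing R] (a : Ideal R) (K : ModuleCat.{u} R)
    (hK : ∀ r ∈ a, ∀ x : K, r • x = 0) (N : ModuleCat.{u} R) (hG : G a N) (i : ℕ) :
    IsZero ((TT K i).obj N) := by
  obtain ⟨s, rfl⟩ := IsNoetherian.noetherian a
  exact claimA_aux s K hK s le_rfl N hG (fun y hy h => absurd hy h) i

end ClaimA
end LCAux

namespace LCAux
open Limits MonoidalCategory
open Abelian.Ext (mk₀)

section VV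
variable {R : Type u} [CommRing R]

/-- `R / a ^ t` -/
abbrev P (a : Ideal R) (t : ℕ) : ModuleCat.{u} R := ModuleCat.of R (R ⧸ a ^ t)

def pr (a : Ideal R) {t s : ℕ} (h : t ≤ s) : P a s ⟶ P a t :=
  ModuleCat.ofHom (Submodule.factor (Ideal.pow_le_pow_right h))

lemma pr_pr (a : Ideal R) {t s r : ℕ} (h : t ≤ s) (h' : s ≤ r) :
    pr a h' ≫ pr a h = pr a (h.trans h') := by
  refine ModuleCat.hom_ext (LinearMap.ext fun x => ?_)
  obtain ⟨x, rfl⟩ := Submodule.Quotient.mk_surjective _ x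
  rfl

/-- restriction -/
noncomputable def res {a : Ideal R} {M : ModuleCat.{u} R} {i t s : ℕ} (h : t ≤ s)
    (ξ : Abelian.Ext (P a t) M i) : Abelian.Ext (P a s) M i :=
  (mk₀ (pr a h)).comp ξ (zero_add i)

section
variable {a : Ideal R} {M N : ModuleCat.{u} R} {i t s r : ℕ}

lemma res_res (h : t ≤ s) (h' : s ≤ r) (ξ : Abelian.Ext (P a t) M i) :
    res h' (res h ξ) = res (h.trans h') ξ := by
  unfold res
  rw [Abelian.Ext.mk₀_comp_mk₀_assoc, pr_pr]

lemma res_add (h : t ≤ s) (ξ η : Abelian.Ext (P a t) M i) :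
    res h (ξ + η) = res h ξ + res h η := Abelian.Ext.comp_add _ _ _ _

lemma res_smul (h : t ≤ s) (r : R) (ξ : Abelian.Ext (P a t) M i) :
    res h (r • ξ) = r • res h ξ := Abelian.Ext.comp_smul _ _ _ _

lemma res_zero (h : t ≤ s) : res h (0 : Abelian.Ext (P a t) M i) = 0 :=
  Abelian.Ext.comp_zero _ _ _ _ _

lemma res_comp (h : t ≤ s) (ξ : Abelian.Ext (P a t) M i) {j k : ℕ} (β : Abelian.Ext M N j)
    (hk : i + j = k) : res h (ξ.comp β hk) = (res h ξ).comp β hk := by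
  unfold res
  rw [Abelian.Ext.comp_assoc _ _ _ (zero_add i) hk (by omega)]

end

def V (a : Ideal R) (i : ℕ) (M : ModuleCat.{u} R) : Prop :=
  ∀ (t : ℕ) (ξ : Abelian.Ext (P a t) M i), ∃ (s : ℕ) (h : t ≤ s), res h ξ = 0

lemma V.of_injective (a : Ideal R) (i : ℕ) (M : ModuleCat.{u} R) [Injective M] :
    V a (i + 1) M := fun t ξ => ⟨t, le_rfl, by
  rw [Abelian.Ext.eq_zero_of_injective ξ, res_zero]⟩

variable {S : ShortComplex (ModuleCat.{u} R)}

lemma V.three {a : Ideal R} {i : ℕ} (hS : S.ShortExact) (h2 : V a i S.X₂) (h1 : V a (i + 1) S.X₁) :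
    V a i S.X₃ := by
  intro t ξ
  obtain ⟨s, hs, h⟩ := h1 t (ξ.comp hS.extClass rfl)
  rw [res_comp] at h
  obtain ⟨β, hβ⟩ := Abelian.Ext.covariant_sequence_exact₃ _ hS _ rfl h
  obtain ⟨r, hr, h'⟩ := h2 s β
  refine ⟨r, hs.trans hr, ?_⟩
  rw [← res_res hs hr, ← hβ, res_comp, h', Abelian.Ext.zero_comp]

lemma V.shift {a : Ideal R} {i : ℕ} (hS : S.ShortExact) [Injective S.X₂] (h3 : V a i S.X₃) :
    V a (i + 1) S.X₁ := by
  intro t ξ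
  obtain ⟨η, rfl⟩ := Abelian.Ext.covariant_sequence_exact₁ _ hS ξ
    (Abelian.Ext.eq_zero_of_injective _) rfl
  obtain ⟨s, hs, h⟩ := h3 t η
  exact ⟨s, hs, by rw [res_comp, h, Abelian.Ext.zero_comp]⟩

lemma P_kill (a : Ideal R) (t : ℕ) (r : R) (hr : r ∈ a ^ t) (x : P a t) : r • x = 0 := by
  obtain ⟨x, rfl⟩ := Submodule.Quotient.mk_surjective _ x
  rw [← Submodule.Quotient.mk_smul, Submodule.Quotient.mk_eq_zero]
  exact Ideal.mul_mem_right _ _ hr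

/-- the map `R/a^t → M` given by an element killed by `a^t` -/
def toM (a : Ideal R) (t : ℕ) {M : ModuleCat.{u} R} (m : M) (h : ∀ y ∈ a ^ t, y • m = 0) :
    P a t ⟶ M :=
  ModuleCat.ofHom (Submodule.liftQ (a ^ t) (LinearMap.toSpanSingleton R M m) (fun y hy => h y hy))

def one (a : Ideal R) (t : ℕ) : P a t := Submodule.Quotient.mk 1

lemma pr_one (a : Ideal R) {t s : ℕ} (h : t ≤ s) : pr a h (one a s) = one a t := rfl

lemma one_kill (a : Ideal R) (t : ℕ) {M : ModuleCat.{u} R} (f : P a t ⟶ M) (y : R)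
    (hy : y ∈ a ^ t) : y • f (one a t) = 0 := by
  rw [← map_smul, P_kill a t y hy, map_zero]

lemma toM_one (a : Ideal R) (t : ℕ) {M : ModuleCat.{u} R} (m : M) (h : ∀ y ∈ a ^ t, y • m = 0) :
    toM a t m h (one a t) = m := by
  have : toM a t m h (one a t) = (1 : R) • m := rfl
  rw [this, one_smul]

lemma P_ext (a : Ideal R) (t : ℕ) {M : ModuleCat.{u} R} {f g : P a t ⟶ M}
    (h : f (one a t) = g (one a t)) : f = g := by
  refine ModuleCat.hom_ext (LinearMap.ext fun x => ?_)
  obtain ⟨x, rfl⟩ := Submodule.Quotient.mk_surjective _ x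
  have e : (Submodule.Quotient.mk x : R ⧸ a ^ t) = x • (one a t) := by
    change _ = x • (Submodule.Quotient.mk 1 : R ⧸ a ^ t)
    rw [← Submodule.Quotient.mk_smul, smul_eq_mul, mul_one]
  rw [e]
  have h' : f.hom (one a t) = g.hom (one a t) := h
  rw [map_smul, map_smul, h']

lemma ext_P_zero {a : Ideal R} {N : ModuleCat.{u} R} (h : TF a N) (t : ℕ)
    (ξ : Abelian.Ext (P a t) N 0) : ξ = 0 := by
  obtain ⟨f, rfl⟩ := (Abelian.Ext.mk₀_bijective _ _).2 ξ
  have : f = 0 := P_ext a t (h.pow t _ fun y hy => one_kill a t f y hy)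
  rw [this, Abelian.Ext.mk₀_zero]

lemma ext_P_good {a : Ideal R} {E : ModuleCat.{u} R} [Injective E] (h : TF a E) (t i : ℕ)
    (ξ : Abelian.Ext (P a t) E i) : ξ = 0 := by
  rcases i with - | i
  · exact ext_P_zero h t ξ
  · exact Abelian.Ext.eq_zero_of_injective ξ

lemma V.of_forall {a : Ideal R} {N : ModuleCat.{u} R} {i : ℕ}
    (h : ∀ t (ξ : Abelian.Ext (P a t) N i), ξ = 0) : V a i N :=
  fun t ξ => ⟨t, le_rfl, by rw [h t ξ, res_zero]⟩

lemma V.tf {a : Ideal R} {N : ModuleCat.{u} R} (h : V a 0 N) : TF a N := by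
  intro n hn
  rw [← pow_one a] at hn
  obtain ⟨s, hs, h'⟩ := h 1 (mk₀ (toM a 1 n hn))
  unfold res at h'
  rw [Abelian.Ext.mk₀_comp_mk₀, Abelian.Ext.mk₀_eq_zero_iff] at h'
  have : (pr a hs ≫ toM a 1 n hn) (one a s) = n := toM_one a 1 n hn
  rw [← this, h']
  rfl

lemma cok_shortExact {A B : ModuleCat.{u} R} (f : A ⟶ B) [Mono f] :
    (ShortComplex.mk f (cokernel.π f) (cokernel.condition f)).ShortExact :=
  { exact := ShortComplex.exact_cokernel _
    mono_f := inferInstanceAs (Mono f)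
    epi_g := inferInstanceAs (Epi (cokernel.π f)) }

lemma V.toG (a : Ideal R) (ha : a.FG) (N : ModuleCat.{u} R) (h : ∀ i, V a i N) : G a N := by
  intro X hX i
  induction i generalizing N with
  | zero =>
    intro α
    obtain ⟨f, rfl⟩ := (Abelian.Ext.mk₀_bijective _ _).2 α
    have : f = 0 := by
      ext x
      exact (h 0).tf _ fun y hy => by rw [← map_smul, hX y hy, map_zero]
    rw [this, Abelian.Ext.mk₀_zero]
  | succ i ih =>
    intro α
    obtain ⟨E, f, hf, hE⟩ := exists_good a ha (ModuleCat.of R PUnit)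
      (fun _ _ _ => rfl) N (h 0).tf
    have := hE.inj
    have hS := cok_shortExact f
    have h2 : ∀ i, V a i E := fun i => V.of_forall fun t ξ => ext_P_good hE.tf t i ξ
    have h3 : ∀ i, V a i (cokernel f) := fun i => V.three hS (h2 i) (h (i + 1))
    obtain ⟨β, rfl⟩ := Abelian.Ext.covariant_sequence_exact₁ X hS α
      (Abelian.Ext.eq_zero_of_injective _) rfl
    rw [ih _ h3 β, Abelian.Ext.zero_comp]

/-- torsion submodule -/
def Gam (a : Ideal R) (M : ModuleCat.{u} R) : Submodule R M where
  carrier := {m | ∃ t : ℕ, ∀ y ∈ a ^ t, y • m = 0}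
  add_mem' := by
    rintro m n ⟨t, ht⟩ ⟨s, hs⟩
    refine ⟨t + s, fun y hy => ?_⟩
    rw [smul_add, ht y (Ideal.pow_le_pow_right (by omega) hy),
      hs y (Ideal.pow_le_pow_right (by omega) hy), add_zero]
  zero_mem' := ⟨0, fun y _ => smul_zero y⟩
  smul_mem' := by
    rintro r m ⟨t, ht⟩
    exact ⟨t, fun y hy => by rw [smul_comm, ht y hy, smul_zero]⟩

def Tors (a : Ideal R) (M : ModuleCat.{u} R) : Prop :=
  ∀ m : M, ∃ t : ℕ, ∀ y ∈ a ^ t, y • m = 0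

lemma Gam_tors (a : Ideal R) (M : ModuleCat.{u} R) : Tors a (ModuleCat.of R (Gam a M)) := by
  rintro ⟨m, t, ht⟩
  exact ⟨t, fun y hy => Subtype.ext (ht y hy)⟩

/-- uniform exponent on a f.g. submodule -/
lemma exists_uniform (a : Ideal R) (M : ModuleCat.{u} R) (L : Submodule R M) (hL : L.FG)
    (h : L ≤ Gam a M) : ∃ t : ℕ, ∀ y ∈ a ^ t, ∀ m ∈ L, y • m = 0 := by
  induction L, hL using Submodule.fg_induction with
  | singleton m =>
    obtain ⟨t, ht⟩ := h (Submodule.mem_span_singleton_self m)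
    refine ⟨t, fun y hy n hn => ?_⟩
    obtain ⟨c, rfl⟩ := Submodule.mem_span_singleton.1 hn
    rw [smul_comm, ht y hy, smul_zero]
  | sup L₁ L₂ h₁ h₂ ih₁ ih₂ =>
    obtain ⟨t, ht⟩ := ih₁ (le_sup_left.trans h)
    obtain ⟨s, hs⟩ := ih₂ (le_sup_right.trans h)
    refine ⟨t + s, fun y hy n hn => ?_⟩
    obtain ⟨m₁, h1, m₂, h2, rfl⟩ := Submodule.mem_sup.1 hn
    rw [smul_add, ht y (Ideal.pow_le_pow_right (by omega) hy) _ h1,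
      hs y (Ideal.pow_le_pow_right (by omega) hy) _ h2, add_zero]

lemma Gam_injective [IsNoetherianRing R] (a : Ideal R) (E : ModuleCat.{u} R) [Injective E] :
    Injective (ModuleCat.of R (Gam a E)) := by
  have hE : Module.Injective R E :=
    @Module.injective_module_of_injective_object R E _ _ _ (inferInstanceAs (Injective E))
  have hb : Module.Baer R (Gam a E) := by
    intro I g
    let g' : I →ₗ[R] E := (Gam a E).subtype.comp g
    obtain ⟨t, ht⟩ := exists_uniform a E (LinearMap.range g')
      ((Submodule.fg_top _).1 (IsNoetherian.noetherian _) |>.map g' |> fun h => by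
        rw [LinearMap.range_eq_map]; exact h)
      (by rintro _ ⟨x, rfl⟩; exact (g x).2)
    obtain ⟨k, hk⟩ := Ideal.exists_pow_inf_eq_pow_smul a (M := R) I
    have hz : ∀ x : I, (x : R) ∈ a ^ (t + k) → g' x = 0 := by
      rintro ⟨x, hx⟩ hxa
      have h1 : x ∈ a ^ (t + k) • (⊤ : Submodule R R) ⊓ I :=
        ⟨by rw [smul_eq_mul, Ideal.mul_top]; exact hxa, hx⟩
      rw [hk (t + k) (by omega), Nat.add_sub_cancel] at h1
      have h2 : x ∈ (LinearMap.ker g').map I.subtype := by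
        refine Submodule.smul_induction_on h1 ?_ ?_
        · intro r hr n hn
          refine ⟨r • ⟨n, hn.2⟩, ?_, rfl⟩
          rw [SetLike.mem_coe, LinearMap.mem_ker, map_smul]
          exact ht r hr _ ⟨_, rfl⟩
        · intro y z hy hz
          exact add_mem hy hz
      obtain ⟨y, hy, hyx⟩ := h2
      have : y = ⟨x, hx⟩ := Subtype.ext hyx
      rw [← this]
      exact hy
    let j : I →ₗ[R] (R ⧸ a ^ (t + k)) := (Submodule.mkQ (a ^ (t + k))).comp I.subtype
    have hj : LinearMap.ker j ≤ LinearMap.ker g' := fun x hx =>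
      hz x ((Submodule.Quotient.mk_eq_zero _).1 hx)
    obtain ⟨l, hl⟩ := hE.out ((LinearMap.ker j).liftQ j le_rfl)
      (LinearMap.ker_eq_bot.1 (Submodule.ker_liftQ_eq_bot' _ _ rfl))
      ((LinearMap.ker j).liftQ g' hj)
    let e : Gam a E := ⟨l (Submodule.Quotient.mk 1), t + k, fun y hy => by
      rw [← map_smul, P_kill a (t + k) y hy, map_zero]⟩
    refine ⟨LinearMap.toSpanSingleton R _ e, fun x hx => Subtype.ext ?_⟩
    have h3 : l (Submodule.Quotient.mk x) = g' ⟨x, hx⟩ := hl (Submodule.Quotient.mk ⟨x, hx⟩)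
    change x • l (Submodule.Quotient.mk 1) = g' ⟨x, hx⟩
    rw [← h3, ← map_smul, ← Submodule.Quotient.mk_smul, smul_eq_mul, mul_one]
  have := hb.injective
  exact Module.injective_object_of_injective_module R (Gam a E)

lemma exists_tors [IsNoetherianRing R] (a : Ideal R) (T : ModuleCat.{u} R) (hT : Tors a T) :
    ∃ (F : ModuleCat.{u} R) (f : T ⟶ F), Mono f ∧ Injective F ∧ Tors a F := by
  let F := ModuleCat.of R (Gam a (Injective.under T))
  have : Injective F := Gam_injective a _
  let f : T ⟶ F := ModuleCat.ofHom (LinearMap.codRestrict _ (Injective.ι T).hom (fun m => by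
    obtain ⟨t, ht⟩ := hT m
    exact ⟨t, fun y hy => by rw [← map_smul, ht y hy, map_zero]⟩))
  have hf : Mono f := by
    rw [ModuleCat.mono_iff_injective]
    intro x y hxy
    exact (ModuleCat.mono_iff_injective (Injective.ι T)).1 inferInstance
      (congr_arg Subtype.val hxy)
  exact ⟨F, f, hf, inferInstance, Gam_tors a _⟩

lemma V.of_tors [IsNoetherianRing R] (a : Ideal R) (i : ℕ) (T : ModuleCat.{u} R) (hT : Tors a T) :
    V a (i + 1) T := by
  induction i generalizing T with
  | zero =>
    obtain ⟨F, f, hf, hFi, hF⟩ := exists_tors a T hT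
    have hS := cok_shortExact f
    have hsurj : Function.Surjective (cokernel.π f) :=
      (ModuleCat.epi_iff_surjective _).1 inferInstance
    intro t ξ
    obtain ⟨η, rfl⟩ := Abelian.Ext.covariant_sequence_exact₁ _ hS ξ
      (Abelian.Ext.eq_zero_of_injective _) rfl
    obtain ⟨φ, rfl⟩ := (Abelian.Ext.mk₀_bijective _ _).2 η
    obtain ⟨e, he⟩ := hsurj (φ (one a t))
    obtain ⟨s, hs⟩ := hF e
    have hs' : ∀ y ∈ a ^ (t + s), y • e = 0 := fun y hy =>
      hs y (Ideal.pow_le_pow_right (by omega) hy)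
    refine ⟨t + s, by omega, ?_⟩
    have e1 : pr a (show t ≤ t + s by omega) ≫ φ = toM a (t + s) e hs' ≫ cokernel.π f := by
      apply P_ext
      change φ (one a t) = cokernel.π f (toM a (t + s) e hs' (one a (t + s)))
      rw [toM_one, he]
    rw [res_comp]
    have e2 : res (show t ≤ t + s by omega) (mk₀ φ) =
        (mk₀ (toM a (t + s) e hs')).comp (mk₀ (cokernel.π f)) (add_zero 0) := by
      unfold res
      rw [Abelian.Ext.mk₀_comp_mk₀, Abelian.Ext.mk₀_comp_mk₀, ← e1]
    have e3 : (mk₀ (cokernel.π f)).comp hS.extClass (zero_add 1) = 0 := hS.comp_extClass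
    erw [e2]
    rw [Abelian.Ext.comp_assoc _ _ _ (add_zero 0) (zero_add 1) (by omega)]
    erw [e3]
    exact Abelian.Ext.comp_zero _ _ _ _ _
  | succ i ih =>
    obtain ⟨F, f, hf, hFi, hF⟩ := exists_tors a T hT
    have hS := cok_shortExact f
    have hsurj : Function.Surjective (cokernel.π f) :=
      (ModuleCat.epi_iff_surjective _).1 inferInstance
    have hT' : Tors a (cokernel f) := fun m => by
      obtain ⟨e, rfl⟩ := hsurj m
      obtain ⟨s, hs⟩ := hF e
      exact ⟨s, fun y hy => by rw [← map_smul, hs y hy, map_zero]⟩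
    have h3 := ih (cokernel f) hT'
    exact V.shift hS h3

end VV
end LCAux

namespace LCAux
open Limits MonoidalCategory
open Abelian.Ext (mk₀)

section EE
variable {R : Type u} [CommRing R]

/-- `H` is a colimit of `Ext^n(R/a^t, M)` -/
def IsLC (a : Ideal R) (n : ℕ) (M H : ModuleCat.{u} R) : Prop :=
  ∃ c : ∀ t, Abelian.Ext (P a t) M n →ₗ[R] H,
    (∀ (t s : ℕ) (h : t ≤ s) (ξ : Abelian.Ext (P a t) M n), c s (res h ξ) = c t ξ) ∧
    (∀ x : H, ∃ (t : ℕ) (ξ : Abelian.Ext (P a t) M n), c t ξ = x) ∧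
    (∀ (t : ℕ) (ξ : Abelian.Ext (P a t) M n), c t ξ = 0 → ∃ (s : ℕ) (h : t ≤ s), res h ξ = 0)

lemma IsLC.v {a : Ideal R} {n : ℕ} {M H : ModuleCat.{u} R} (h : IsLC a n M H)
    (hH : Subsingleton H) : V a n M := by
  obtain ⟨c, h1, h2, h3⟩ := h
  exact fun t ξ => h3 t ξ (Subsingleton.elim _ _)

/-- composition with an `Ext` class, as a linear map -/
noncomputable def compL (X : ModuleCat.{u} R) {A B : ModuleCat.{u} R} (n : ℕ)
    (β : Abelian.Ext A B 1) : Abelian.Ext X A n →ₗ[R] Abelian.Ext X B (n + 1) where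
  toFun ξ := ξ.comp β rfl
  map_add' ξ η := Abelian.Ext.add_comp _ _ _ _
  map_smul' r ξ := Abelian.Ext.smul_comp _ _ _ _

lemma IsLC.shift {a : Ideal R} {n : ℕ} {S : ShortComplex (ModuleCat.{u} R)} {H : ModuleCat.{u} R}
    (hS : S.ShortExact) (hE : ∀ (t i : ℕ) (ξ : Abelian.Ext (P a t) S.X₂ i), ξ = 0)
    (h : IsLC a (n + 1) S.X₁ H) : IsLC a n S.X₃ H := by
  obtain ⟨c, h1, h2, h3⟩ := h
  refine ⟨fun t => (c t).comp (compL (P a t) n hS.extClass), ?_, ?_, ?_⟩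
  · intro t s h ξ
    change c s ((res h ξ).comp hS.extClass rfl) = c t (ξ.comp hS.extClass rfl)
    rw [← res_comp, h1]
  · intro x
    obtain ⟨t, ξ, rfl⟩ := h2 x
    obtain ⟨η, rfl⟩ := Abelian.Ext.covariant_sequence_exact₁ _ hS ξ (hE _ _ _) rfl
    exact ⟨t, η, rfl⟩
  · intro t ξ hξ
    obtain ⟨s, hs, h⟩ := h3 t (ξ.comp hS.extClass rfl) hξ
    rw [res_comp] at h
    obtain ⟨β, hβ⟩ := Abelian.Ext.covariant_sequence_exact₃ _ hS _ rfl h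
    refine ⟨s, hs, ?_⟩
    rw [← hβ, hE _ _ β, Abelian.Ext.zero_comp]

lemma res_toM (a : Ideal R) {t s : ℕ} (h : t ≤ s) {M : ModuleCat.{u} R} (m : M)
    (ht : ∀ y ∈ a ^ t, y • m = 0) (hs : ∀ y ∈ a ^ s, y • m = 0) :
    res h (mk₀ (toM a t m ht)) = mk₀ (toM a s m hs) := by
  unfold res
  rw [Abelian.Ext.mk₀_comp_mk₀]
  congr 1
  apply P_ext
  rw [toM_one]
  exact toM_one a t m ht

lemma IsLC.gam {a : Ideal R} {M H : ModuleCat.{u} R} (h : IsLC a 0 M H) :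
    Nonempty (ModuleCat.of R (Gam a M) ≅ H) := by
  obtain ⟨c, h1, h2, h3⟩ := h
  have hk : ∀ {t s : ℕ} {m : M}, t ≤ s → (∀ y ∈ a ^ t, y • m = 0) → (∀ y ∈ a ^ s, y • m = 0) :=
    fun h h' y hy => h' y (Ideal.pow_le_pow_right h hy)
  have key : ∀ (m : M) (t s : ℕ) (ht : ∀ y ∈ a ^ t, y • m = 0) (hs : ∀ y ∈ a ^ s, y • m = 0),
      c t (mk₀ (toM a t m ht)) = c s (mk₀ (toM a s m hs)) := by
    intro m t s ht hs
    rw [← h1 t (t + s) (by omega), ← h1 s (t + s) (by omega),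
      res_toM a (show t ≤ t + s by omega) m ht (hk (by omega) ht),
      res_toM a (show s ≤ t + s by omega) m hs (hk (by omega) ht)]
  let φ : Gam a M → H := fun m => c m.2.choose (mk₀ (toM a _ m.1 m.2.choose_spec))
  have hφ : ∀ (m : Gam a M) (t : ℕ) (ht : ∀ y ∈ a ^ t, y • m.1 = 0),
      φ m = c t (mk₀ (toM a t m.1 ht)) := fun m t ht => key _ _ _ _ _
  let Φ : Gam a M →ₗ[R] H :=
    { toFun := φ
      map_add' := by
        rintro ⟨m, t, ht⟩ ⟨n, s, hs⟩
        have ht' := hk (show t ≤ t + s by omega) ht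
        have hs' := hk (show s ≤ t + s by omega) hs
        have hts : ∀ y ∈ a ^ (t + s), y • (m + n) = 0 := fun y hy => by
          rw [smul_add, ht' y hy, hs' y hy, add_zero]
        rw [hφ ⟨m, t, ht⟩ (t + s) ht', hφ ⟨n, s, hs⟩ (t + s) hs', ← map_add,
          ← Abelian.Ext.mk₀_add]
        refine (hφ _ (t + s) hts).trans ?_
        congr 2
        apply P_ext
        rw [toM_one]
        change m + n = toM a _ m ht' (one a _) + toM a _ n hs' (one a _)
        rw [toM_one, toM_one]
      map_smul' := by
        rintro r ⟨m, t, ht⟩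
        have hts : ∀ y ∈ a ^ t, y • (r • m) = 0 := fun y hy => by
          rw [smul_comm, ht y hy, smul_zero]
        rw [hφ ⟨m, t, ht⟩ t ht, RingHom.id_apply, ← map_smul, ← Abelian.Ext.mk₀_smul]
        refine (hφ _ t hts).trans ?_
        congr 2
        apply P_ext
        rw [toM_one]
        change r • m = r • toM a _ m ht (one a _)
        rw [toM_one] }
  have hb : Function.Bijective Φ := by
    constructor
    · rw [injective_iff_map_eq_zero]
      rintro ⟨m, t, ht⟩ hm
      have h4 : c t (mk₀ (toM a t m ht)) = 0 := (hφ ⟨m, t, ht⟩ t ht).symm.trans hm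
      obtain ⟨s, hs, h5⟩ := h3 _ _ h4
      rw [res_toM a hs m ht (hk hs ht), Abelian.Ext.mk₀_eq_zero_iff] at h5
      have h6 := toM_one a s m (hk hs ht)
      rw [h5] at h6
      exact Subtype.ext h6.symm
    · intro x
      obtain ⟨t, ξ, rfl⟩ := h2 x
      obtain ⟨f, rfl⟩ := (Abelian.Ext.mk₀_bijective _ _).2 ξ
      refine ⟨⟨f (one a t), t, fun y hy => one_kill a t f y hy⟩, ?_⟩
      refine (hφ _ t (fun y hy => one_kill a t f y hy)).trans ?_
      congr 2
      apply P_ext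
      rw [toM_one]
  exact ⟨(LinearEquiv.ofBijective Φ hb).toModuleIso⟩

lemma quot_tf {a : Ideal R} (ha : a.FG) (M : ModuleCat.{u} R) :
    TF a (ModuleCat.of R (M ⧸ Gam a M)) := by
  intro n hn
  obtain ⟨m, rfl⟩ := Submodule.Quotient.mk_surjective _ n
  rw [Submodule.Quotient.mk_eq_zero]
  obtain ⟨t, ht⟩ := exists_uniform a M (Submodule.map (LinearMap.toSpanSingleton R M m) a)
    (Submodule.FG.map _ ha) (by
      rintro _ ⟨y, hy, rfl⟩
      have := hn y hy
      erw [← Submodule.Quotient.mk_smul, Submodule.Quotient.mk_eq_zero] at this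
      exact this)
  refine ⟨t + 1, fun y hy => ?_⟩
  rw [pow_succ] at hy
  refine Submodule.mul_induction_on hy ?_ ?_
  · intro z hz x hx
    rw [mul_smul]
    exact ht z hz _ ⟨x, hx, rfl⟩
  · intro y z hy hz
    rw [add_smul, hy, hz, add_zero]

theorem core [IsNoetherianRing R] (a : Ideal R) (K : ModuleCat.{u} R)
    (hK : ∀ r ∈ a, ∀ x : K, r • x = 0) (n : ℕ) (M H : ModuleCat.{u} R)
    (hV : ∀ i, i ≠ n → V a i M) (hH : IsLC a n M H) :
    (∀ i, Nonempty ((TT K (n + i)).obj H ≅ (TT K i).obj M)) ∧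
      ∀ i < n, IsZero ((TT K i).obj H) := by
  have ha : a.FG := IsNoetherian.noetherian a
  induction n generalizing M with
  | zero =>
    refine ⟨fun i => ?_, fun i hi => absurd hi (by omega)⟩
    obtain ⟨e⟩ := hH.gam
    have hS := shortExact_mk (ModuleCat.ofHom (Gam a M).subtype)
      (ModuleCat.ofHom (Gam a M).mkQ)
      (by ext x; exact (Submodule.Quotient.mk_eq_zero _).2 x.2) (Subtype.val_injective)
      (Submodule.mkQ_surjective _)
      (fun b hb => ⟨⟨b, (Submodule.Quotient.mk_eq_zero _).1 hb⟩, rfl⟩)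
    have hN : ∀ i, V a i (ModuleCat.of R (M ⧸ Gam a M)) := by
      intro i
      rcases i with - | i
      · exact V.of_forall fun t ξ => ext_P_zero (quot_tf ha M) t ξ
      · exact V.three hS (hV _ (by omega)) (V.of_tors a _ _ (Gam_tors a M))
    have hz := claimA a K hK _ (V.toG a ha _ hN)
    have h1 := TT_mono K hS i (hz _)
    have h2 := TT_epi K hS i (hz _)
    have h3 : IsIso ((TT K i).map (ModuleCat.ofHom (Gam a M).subtype)) :=
      @isIso_of_mono_of_epi _ _ _ _ _ _ h1 h2
    rw [Nat.zero_add]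
    exact ⟨(TT K i).mapIso e.symm ≪≫ asIso ((TT K i).map (ModuleCat.ofHom (Gam a M).subtype))⟩
  | succ n ih =>
    have htf := (hV 0 (by omega)).tf
    obtain ⟨E, f, hf, hE⟩ := exists_good a ha K hK M htf
    have := hE.inj
    have hS := cok_shortExact f
    have hE0 : ∀ (t i : ℕ) (ξ : Abelian.Ext (P a t) E i), ξ = 0 := fun t i ξ =>
      ext_P_good hE.tf t i ξ
    obtain ⟨ih1, ih2⟩ := ih (cokernel f)
      (fun i hi => V.three hS (V.of_forall fun t ξ => hE0 t i ξ) (hV (i + 1) (by omega)))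
      (IsLC.shift hS hE0 hH)
    refine ⟨fun i => ?_, fun i hi => ?_⟩
    · obtain ⟨e⟩ := ih1 (i + 1)
      rw [show n + 1 + i = n + (i + 1) by omega]
      exact ⟨e ≪≫ TTshift K hS i (hE.van _) (hE.van _)⟩
    · rcases Nat.lt_succ_iff_lt_or_eq.1 hi with h | rfl
      · exact ih2 i h
      · obtain ⟨e⟩ := ih1 0
        have he := TT_zero_epi K hS
        refine IsZero.of_iso ?_ e
        exact @IsZero.of_epi _ _ _ _ _ _ he (hE.van 0)

end EE
end LCAux

namespace LCAux
open Limits MonoidalCategory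
open Abelian.Ext (mk₀)

section OpComplex
variable {R : Type u} [CommRing R] (K : ChainComplex (ModuleCat.{u} R)ᵒᵖ ℕ) (n : ℕ)

/-- cocycles -/
noncomputable abbrev ZZ : ModuleCat.{u} R := (K.opcycles n).unop

noncomputable def zi : ZZ K n ⟶ (K.X n).unop := (K.pOpcycles n).unop

noncomputable def zp : ZZ K n ⟶ (K.homology n).unop := (K.homologyι n).unop

lemma zi_d (z : ZZ K n) : (K.d (n + 1) n).unop (zi K n z) = 0 := by
  have h : zi K n ≫ (K.d (n + 1) n).unop = 0 := by
    unfold zi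
    rw [← unop_comp, K.d_pOpcycles, unop_zero]
  exact ConcreteCategory.congr_hom h z

lemma zi_injective : Function.Injective (zi K n) := by
  rw [← ModuleCat.mono_iff_injective]
  unfold zi
  infer_instance

lemma zp_surjective : Function.Surjective (zp K n) := by
  rw [← ModuleCat.epi_iff_surjective]
  unfold zp
  infer_instance

lemma zi_lift (x : (K.X n).unop) (hx : (K.d (n + 1) n).unop x = 0) : ∃ z, zi K n z = x := by
  let k : ModuleCat.of R R ⟶ (K.X n).unop := ModuleCat.ofHom (LinearMap.toSpanSingleton R _ x)
  have hk : k ≫ (K.d (n + 1) n).unop = 0 := by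
    refine ModuleCat.hom_ext (LinearMap.ext fun r => ?_)
    change (K.d (n + 1) n).unop (r • x) = 0
    rw [map_smul, hx, smul_zero]
  have hk' : K.d (n + 1) n ≫ k.op = 0 := Quiver.Hom.unop_inj hk
  let l := (K.descOpcycles k.op (n + 1) (by simp) hk').unop
  have hl : l ≫ zi K n = k := by
    unfold zi
    rw [← unop_comp, K.p_descOpcycles]
    rfl
  refine ⟨l (1 : R), ?_⟩
  have := ConcreteCategory.congr_hom hl (1 : R)
  refine this.trans ?_
  change (1 : R) • x = x
  rw [one_smul]

lemma zp_zero_iff_succ (z : ZZ K (n + 1)) :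
    zp K (n + 1) z = 0 ↔ ∃ y, zi K (n + 1) z = (K.d (n + 1) n).unop y := by
  have hex : (ShortComplex.mk (K.homologyι (n + 1)) (K.fromOpcycles (n + 1) n)
      (K.homologyι_comp_fromOpcycles (n + 1) n)).Exact :=
    ShortComplex.exact_of_f_is_kernel _ (K.homologyIsKernel (n + 1) n (by simp))
  have hex' := hex.unop
  rw [ShortComplex.moduleCat_exact_iff] at hex'
  have hw : (K.fromOpcycles (n + 1) n).unop ≫ zi K (n + 1) = (K.d (n + 1) n).unop := by
    unfold zi
    rw [← unop_comp, K.p_fromOpcycles]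
  constructor
  · intro hz
    obtain ⟨y, hy⟩ := hex' z hz
    refine ⟨y, ?_⟩
    have h1 : (K.fromOpcycles (n + 1) n).unop y = z := hy
    rw [← hw, ← h1]
    rfl
  · rintro ⟨y, hy⟩
    have h1 : (K.fromOpcycles (n + 1) n).unop y = z := by
      apply zi_injective
      rw [hy, ← hw]
      rfl
    rw [← h1]
    have h2 : (K.fromOpcycles (n + 1) n).unop ≫ zp K (n + 1) = 0 := by
      unfold zp
      rw [← unop_comp, K.homologyι_comp_fromOpcycles, unop_zero]
    exact ConcreteCategory.congr_hom h2 y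

lemma zp_zero_iff_zero (z : ZZ K 0) : zp K 0 z = 0 ↔ zi K 0 z = 0 := by
  have h1 : Function.Injective (zp K 0) := by
    rw [← ModuleCat.mono_iff_injective]
    unfold zp
    infer_instance
  rw [map_eq_zero_iff _ h1, map_eq_zero_iff _ (zi_injective K 0)]

variable {K} {L : ChainComplex (ModuleCat.{u} R)ᵒᵖ ℕ} (φ : K ⟶ L)

noncomputable def zmap : ZZ L n ⟶ ZZ K n := (HomologicalComplex.opcyclesMap φ n).unop

lemma zmap_zi (z : ZZ L n) : zi K n (zmap n φ z) = (φ.f n).unop (zi L n z) := by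
  have h : zmap n φ ≫ zi K n = zi L n ≫ (φ.f n).unop := by
    unfold zi zmap
    rw [← unop_comp, HomologicalComplex.p_opcyclesMap, unop_comp]
  exact ConcreteCategory.congr_hom h z

lemma zmap_zp (z : ZZ L n) :
    zp K n (zmap n φ z) = (HomologicalComplex.homologyMap φ n).unop (zp L n z) := by
  have h : zmap n φ ≫ zp K n = zp L n ≫ (HomologicalComplex.homologyMap φ n).unop := by
    unfold zp zmap
    rw [← unop_comp, ← HomologicalComplex.homologyι_naturality, unop_comp]
  exact ConcreteCategory.congr_hom h z

end OpComplex

section Bridge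
variable {R : Type u} [CommRing R]

lemma extMk_zero_iff {X Y : ModuleCat.{u} R} (Q : ProjectiveResolution X)
    (f : Q.complex.X 0 ⟶ Y) (hf : Q.complex.d 1 0 ≫ f = 0) :
    Q.extMk f 1 rfl hf = 0 ↔ f = 0 := by
  constructor
  · intro h
    unfold ProjectiveResolution.extMk at h
    rw [Equiv.symm_apply_eq, ProjectiveResolution.extEquivCohomologyClass_zero,
      CochainComplex.HomComplex.CohomologyClass.mk_eq_zero_iff,
      CochainComplex.HomComplex.Cocycle.toSingleMk_mem_coboundaries_iff _ _ _ _ _ 1 (by simp)] at h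
    obtain ⟨g, hg⟩ := h
    have hz : IsZero (Q.cochainComplex.X 1) := Q.cochainComplex.isZero_of_isStrictlyLE 0 1
    rw [hz.eq_of_src g 0, comp_zero] at hg
    rw [← cancel_epi (Q.cochainComplexXIso (-(0 : ℕ)) 0 rfl).hom, ← hg, comp_zero]
  · rintro rfl
    simp

/-- `Hom(-, Y)` into the opposite category -/
noncomputable abbrev FY (Y : ModuleCat.{u} R) : ModuleCat.{u} R ⥤ (ModuleCat.{u} R)ᵒᵖ :=
  ((linearYoneda R (ModuleCat.{u} R)).obj Y).rightOp

noncomputable abbrev KC {X : ModuleCat.{u} R} (Q : ProjectiveResolution X) (Y : ModuleCat.{u} R) :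
    ChainComplex (ModuleCat.{u} R)ᵒᵖ ℕ :=
  ((FY Y).mapHomologicalComplex _).obj Q.complex

/-- old Ext -/
noncomputable abbrev OE (X Y : ModuleCat.{u} R) (n : ℕ) : ModuleCat.{u} R :=
  ((_root_.Ext R (ModuleCat.{u} R) n).obj (Opposite.op X)).obj Y

/-- the underlying morphism of a cocycle -/
noncomputable def zh {X Y : ModuleCat.{u} R} (Q : ProjectiveResolution X) (n : ℕ) :
    ZZ (KC Q Y) n →ₗ[R] (Q.complex.X n ⟶ Y) := (zi (KC Q Y) n).hom

lemma KC_d {X Y : ModuleCat.{u} R} (Q : ProjectiveResolution X) (n m : ℕ)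
    (f : Q.complex.X m ⟶ Y) :
    ((KC Q Y).d n m).unop.hom f = (Q.complex.d n m ≫ f : Q.complex.X n ⟶ Y) := rfl

lemma zh_d {X Y : ModuleCat.{u} R} (Q : ProjectiveResolution X) (n : ℕ) (z : ZZ (KC Q Y) n) :
    Q.complex.d (n + 1) n ≫ zh Q n z = 0 := zi_d (KC Q Y) n z

noncomputable def be {X Y : ModuleCat.{u} R} (Q : ProjectiveResolution X) (n : ℕ) :
    ZZ (KC Q Y) n →ₗ[R] Abelian.Ext X Y n where
  toFun z := Q.extMk (zh Q n z) (n + 1) rfl (zh_d Q n z)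
  map_add' z w := by
    rw [Q.add_extMk]
    congr 1
    rw [map_add]
  map_smul' r z := by
    rw [RingHom.id_apply, Abelian.Ext.smul_eq_comp_mk₀, Q.extMk_comp_mk₀]
    congr 1
    rw [map_smul, Linear.comp_smul, Category.comp_id]

lemma be_surjective {X Y : ModuleCat.{u} R} (Q : ProjectiveResolution X) (n : ℕ) :
    Function.Surjective (be (Y := Y) Q n) := by
  intro α
  obtain ⟨f, hf, rfl⟩ := Q.extMk_surjective α (n + 1) rfl
  obtain ⟨z, hz⟩ := zi_lift (KC Q Y) n f hf
  refine ⟨z, ?_⟩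
  have hz' : zh Q n z = f := hz
  change Q.extMk (zh Q n z) (n + 1) rfl (zh_d Q n z) = _
  congr 1

lemma be_zero_iff {X Y : ModuleCat.{u} R} (Q : ProjectiveResolution X) (n : ℕ)
    (z : ZZ (KC Q Y) n) : be Q n z = 0 ↔ zp (KC Q Y) n z = 0 := by
  change Q.extMk (zh Q n z) (n + 1) rfl (zh_d Q n z) = 0 ↔ _
  rcases n with - | n
  · rw [zp_zero_iff_zero]
    exact extMk_zero_iff Q _ _
  · rw [zp_zero_iff_succ, Q.extMk_eq_zero_iff _ _ _ _ n rfl]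
    exact ⟨fun ⟨g, hg⟩ => ⟨g, hg.symm⟩, fun ⟨g, hg⟩ => ⟨g, hg.symm⟩⟩

noncomputable def isoOE {X : ModuleCat.{u} R} (Q : ProjectiveResolution X) (Y : ModuleCat.{u} R)
    (n : ℕ) : ((KC Q Y).homology n).unop ≅ OE X Y n :=
  (Q.isoLeftDerivedObj (FY Y) n).unop

noncomputable def pz {X Y : ModuleCat.{u} R} (Q : ProjectiveResolution X) (n : ℕ) :
    ZZ (KC Q Y) n →ₗ[R] OE X Y n := (zp (KC Q Y) n ≫ (isoOE Q Y n).hom).hom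

lemma isoOE_bij {X : ModuleCat.{u} R} (Q : ProjectiveResolution X) (Y : ModuleCat.{u} R)
    (n : ℕ) : Function.Bijective (isoOE Q Y n).hom :=
  (ConcreteCategory.isIso_iff_bijective _).1 inferInstance

lemma pz_surjective {X Y : ModuleCat.{u} R} (Q : ProjectiveResolution X) (n : ℕ) :
    Function.Surjective (pz (Y := Y) Q n) :=
  (isoOE_bij Q Y n).2.comp (zp_surjective (KC Q Y) n)

lemma ker_eq {X Y : ModuleCat.{u} R} (Q : ProjectiveResolution X) (n : ℕ) :
    LinearMap.ker (be (Y := Y) Q n) = LinearMap.ker (pz Q n) := by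
  ext z
  rw [LinearMap.mem_ker, LinearMap.mem_ker, be_zero_iff]
  exact (map_eq_zero_iff (isoOE Q Y n).hom.hom (isoOE_bij Q Y n).1).symm

noncomputable def The (X Y : ModuleCat.{u} R) (n : ℕ) : Abelian.Ext X Y n ≃ₗ[R] OE X Y n :=
  ((be (Y := Y) (projectiveResolution X) n).quotKerEquivOfSurjective (be_surjective _ n)).symm ≪≫ₗ
    Submodule.quotEquivOfEq _ _ (ker_eq (projectiveResolution X) n) ≪≫ₗ
    (pz (Y := Y) (projectiveResolution X) n).quotKerEquivOfSurjective (pz_surjective _ n)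

lemma The_be (X Y : ModuleCat.{u} R) (n : ℕ) (z : ZZ (KC (projectiveResolution X) Y) n) :
    The X Y n (be _ n z) = pz _ n z := by
  have h : ((be (Y := Y) (projectiveResolution X) n).quotKerEquivOfSurjective
      (be_surjective _ n)).symm (be _ n z) = Submodule.Quotient.mk z := by
    rw [LinearEquiv.symm_apply_eq]
    rfl
  unfold The
  rw [LinearEquiv.trans_apply, LinearEquiv.trans_apply, h]
  rfl

lemma The_nat {X X' : ModuleCat.{u} R} (f : X ⟶ X') (Y : ModuleCat.{u} R) (n : ℕ)
    (ξ : Abelian.Ext X' Y n) :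
    The X Y n ((mk₀ f).comp ξ (zero_add n)) =
      (((_root_.Ext R (ModuleCat.{u} R) n).map f.op).app Y).hom (The X' Y n ξ) := by
  let Q := projectiveResolution X
  let Q' := projectiveResolution X'
  obtain ⟨z, rfl⟩ := be_surjective Q' n ξ
  let φ : ProjectiveResolution.Hom Q Q' f :=
    { hom := ProjectiveResolution.lift f Q Q'
      hom_f_zero_comp_π_f_zero := by
        rw [ProjectiveResolution.lift_commutes_zero]; rfl }
  let ψ : KC Q Y ⟶ KC Q' Y := ((FY Y).mapHomologicalComplex _).map φ.hom
  have h1 : (mk₀ f).comp (be Q' n z) (zero_add n) = be Q n (zmap n ψ z) := by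
    refine (ProjectiveResolution.mk₀_comp_extMk (zh Q' n z) (n + 1) rfl (zh_d Q' n z) φ).trans ?_
    change _ = Q.extMk (zh Q n (zmap n ψ z)) (n + 1) rfl (zh_d Q n (zmap n ψ z))
    congr 1
    exact (zmap_zi n ψ z).symm
  rw [h1, The_be, The_be]
  have h2 := ProjectiveResolution.isoLeftDerivedObj_hom_naturality f Q Q' φ.hom
    (ProjectiveResolution.lift_commutes_zero f Q Q') (FY Y) n
  have h3 : (isoOE Q' Y n).hom ≫ ((_root_.Ext R (ModuleCat.{u} R) n).map f.op).app Y =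
      (HomologicalComplex.homologyMap ψ n).unop ≫ (isoOE Q Y n).hom :=
    congr_arg Quiver.Hom.unop h2
  have h4 := ConcreteCategory.congr_hom h3 (zp (KC Q' Y) n z)
  refine Eq.trans ?_ h4.symm
  change (isoOE Q Y n).hom (zp (KC Q Y) n (zmap n ψ z)) = _
  rw [zmap_zp]
  rfl

end Bridge
end LCAux

namespace LCAux
open Limits MonoidalCategory
open Abelian.Ext (mk₀)

section Colim
variable {R : Type u} [CommRing R]

lemma IsLC.lc (a : Ideal R) (n : ℕ) (M : ModuleCat.{u} R) :
    IsLC a n M ((localCohomology a n).obj M) := by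
  have : PreservesFilteredColimitsOfSize.{0, 0} (forget (ModuleCat.{u} R)) :=
    preservesFilteredColimitsOfSize_shrink.{0, u, 0, u} _
  have : PreservesColimitsOfShape ℕᵒᵖᵒᵖ (forget (ModuleCat.{u} R)) :=
    PreservesFilteredColimitsOfSize.preserves_filtered_colimits _
  let D := localCohomology.diagram (localCohomology.idealPowersDiagram a) n
  let ev := (evaluation (ModuleCat.{u} R) (ModuleCat.{u} R)).obj M
  have hcol : IsColimit (ev.mapCocone (colimit.cocone D)) :=
    isColimitOfPreserves ev (colimit.isColimit D)
  let cc : ∀ t : ℕ, OE (P a t) M n ⟶ (localCohomology a n).obj M := fun t =>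
    (ev.mapCocone (colimit.cocone D)).ι.app (Opposite.op (Opposite.op t))
  have hmap : ∀ (t s : ℕ) (h : t ≤ s),
      ((_root_.Ext R (ModuleCat.{u} R) n).map (pr a h).op).app M =
        (D ⋙ ev).map (homOfLE h).op.op := fun t s h => rfl
  refine ⟨fun t => (cc t).hom.comp (The (P a t) M n).toLinearMap, ?_, ?_, ?_⟩
  · intro t s h ξ
    change (cc s).hom (The _ _ _ ((mk₀ (pr a h)).comp ξ (zero_add n))) = (cc t).hom (The _ _ _ ξ)
    rw [The_nat, hmap]
    exact ConcreteCategory.congr_hom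
      ((ev.mapCocone (colimit.cocone D)).w (homOfLE h).op.op) (The _ _ _ ξ)
  · intro x
    obtain ⟨⟨⟨t⟩⟩, y, hy⟩ := Concrete.isColimit_exists_rep _ hcol x
    refine ⟨t, (The (P a t) M n).symm y, ?_⟩
    refine Eq.trans ?_ hy
    exact congr_arg (cc t).hom ((The (P a t) M n).apply_symm_apply y)
  · intro t ξ hξ
    have h0 : (ev.mapCocone (colimit.cocone D)).ι.app (Opposite.op (Opposite.op t))
        (The (P a t) M n ξ) =
        (ev.mapCocone (colimit.cocone D)).ι.app (Opposite.op (Opposite.op t)) 0 := by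
      refine Eq.trans ?_ (map_zero _).symm
      exact hξ
    obtain ⟨⟨⟨s⟩⟩, f, g, hfg⟩ := Concrete.isColimit_exists_of_rep_eq (D ⋙ ev) hcol _ _ h0
    have hts : t ≤ s := leOfHom f.unop.unop
    refine ⟨s, hts, ?_⟩
    apply (The (P a s) M n).injective
    rw [map_zero]
    unfold res
    rw [The_nat, hmap]
    refine Eq.trans hfg ?_
    exact map_zero _

end Colim
end LCAux

open Paper IsLocalRing

/-- **(3.2) in the proof of Theorem 3.1.** If `H^i_𝔞(M) = 0` for all `i ≠ n`, then for
every integer `p` one has `Tor^R_p(R/𝔪, H^n_𝔞(M)) ≅ Tor^R_{p-n}(R/𝔪, M)`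
(with `Tor` vanishing in negative degrees). -/
theorem tor_localCohomology_iso
    (R : Type u) [CommRing R] [IsNoetherianRing R] [IsLocalRing R]
    (𝔞 : Ideal R) (h𝔞 : 𝔞 ≠ ⊤)
    (M : Type u) [AddCommGroup M] [Module R M] (n : ℕ)
    (hvan : ∀ i : ℕ, i ≠ n → Subsingleton (lcoh R 𝔞 i M)) (p : ℤ) :
    Nonempty ((tor R p (R ⧸ maximalIdeal R) (lcoh R 𝔞 n M)) ≃ₗ[R]
      (tor R (p - n) (R ⧸ maximalIdeal R) M)) := by
  have hle : 𝔞 ≤ maximalIdeal R := le_maximalIdeal h𝔞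
  have hK : ∀ r ∈ 𝔞, ∀ x : ModuleCat.of R (R ⧸ maximalIdeal R), r • x = 0 := by
    intro r hr x
    obtain ⟨x, rfl⟩ := Submodule.Quotient.mk_surjective _ x
    erw [← Submodule.Quotient.mk_smul, Submodule.Quotient.mk_eq_zero]
    exact Ideal.mul_mem_right _ _ (hle hr)
  obtain ⟨h1, h2⟩ := LCAux.core 𝔞 (ModuleCat.of R (R ⧸ maximalIdeal R)) hK n (ModuleCat.of R M)
    (lcoh R 𝔞 n M)
    (fun i hi => (LCAux.IsLC.lc 𝔞 i (ModuleCat.of R M)).v (hvan i hi))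
    (LCAux.IsLC.lc 𝔞 n (ModuleCat.of R M))
  unfold tor
  rcases lt_or_ge p 0 with hp | hp
  · rw [if_neg (by omega), if_neg (by omega)]
    exact ⟨LinearEquiv.refl R _⟩
  rcases lt_or_ge p n with hpn | hpn
  · rw [if_pos hp, if_neg (by omega)]
    obtain ⟨e⟩ := LCAux.tor_iso_TT (ModuleCat.of R (R ⧸ maximalIdeal R)) (lcoh R 𝔞 n M) p.toNat
    have hz := Limits.IsZero.of_iso (h2 p.toNat (by omega)) e
    exact ⟨(hz.iso (ModuleCat.isZero_of_subsingleton (ModuleCat.of R PUnit))).toLinearEquiv⟩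
  · obtain ⟨i, rfl⟩ := Int.le.dest hpn
    rw [if_pos hp, if_pos (by omega), show ((n : ℤ) + i).toNat = n + i by omega,
      show ((n : ℤ) + i - n).toNat = i by omega]
    obtain ⟨e⟩ := LCAux.tor_iso_TT (ModuleCat.of R (R ⧸ maximalIdeal R)) (lcoh R 𝔞 n M) (n + i)
    obtain ⟨e'⟩ := LCAux.tor_iso_TT (ModuleCat.of R (R ⧸ maximalIdeal R)) (ModuleCat.of R M) i
    obtain ⟨e1⟩ := h1 i
    exact ⟨(e ≪≫ e1 ≪≫ e'.symm).toLinearEquiv⟩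
end

section
/- Let (R, m) be a commutative Noetherian local ring and let 𝔞 be a proper ideal of R such that R is relative Cohen-Macaulay with respect to 𝔞 with ht_R 𝔞 = n. Then for every non-zero faithfully flat R-module M, one has fd_R H^n_𝔞(M) = n. -/
/-!
Definitions needed to state results of "On flat and Gorenstein flat dimensions of
local cohomology modules" by M.R. Zargar and H. Zakeri.
-/

open CategoryTheory IsLocalRing

universe u

section LCsection
open CategoryTheory Limits
open scoped TensorProduct
noncomputable section
namespace LC
variable {R : Type u} [CommRing R]

abbrev FY (N : ModuleCat.{u} R) : ModuleCat.{u} R ⥤ (ModuleCat.{u} R)ᵒᵖ :=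
  ((linearYoneda R (ModuleCat.{u} R)).obj N).rightOp

abbrev FYm {N N' : ModuleCat.{u} R} (f : N ⟶ N') : FY N' ⟶ FY N :=
  NatTrans.rightOp ((linearYoneda R (ModuleCat.{u} R)).map f)

abbrev FC (N : ModuleCat.{u} R) (P : ChainComplex (ModuleCat.{u} R) ℕ) :
    ChainComplex (ModuleCat.{u} R)ᵒᵖ ℕ :=
  ((FY N).mapHomologicalComplex _).obj P

abbrev SP (S : ShortComplex (ModuleCat.{u} R)) (P : ChainComplex (ModuleCat.{u} R) ℕ) :
    ShortComplex (ChainComplex (ModuleCat.{u} R)ᵒᵖ ℕ) :=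
  ShortComplex.mk (X₁ := FC S.X₃ P) (X₂ := FC S.X₂ P) (X₃ := FC S.X₁ P)
    ((NatTrans.mapHomologicalComplex (FYm S.g) _).app P)
    ((NatTrans.mapHomologicalComplex (FYm S.f) _).app P) (by
      ext i
      apply Quiver.Hom.unop_inj
      ext (x : P.X i ⟶ S.X₁)
      change (x ≫ S.f) ≫ S.g = 0
      simp)

lemma SP_shortExact {S : ShortComplex (ModuleCat.{u} R)} (hS : S.ShortExact)
    (P : ChainComplex (ModuleCat.{u} R) ℕ) (hP : ∀ i, Projective (P.X i)) :
    (SP S P).ShortExact := by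
  apply HomologicalComplex.shortExact_of_degreewise_shortExact
  intro i
  have := hP i
  have hm := hS.mono_f
  have he := hS.epi_g
  let T : ShortComplex (ModuleCat.{u} R) := ShortComplex.mk
    (((linearYoneda R (ModuleCat.{u} R)).map S.f).app (Opposite.op (P.X i)))
    (((linearYoneda R (ModuleCat.{u} R)).map S.g).app (Opposite.op (P.X i))) (by
      ext (x : P.X i ⟶ S.X₁)
      change (x ≫ S.f) ≫ S.g = 0
      simp)
  have hT : T.ShortExact := by
    refine { exact := ?_, mono_f := ?_, epi_g := ?_ }
    · rw [ShortComplex.moduleCat_exact_iff]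
      intro (x : P.X i ⟶ S.X₂) (hx : x ≫ S.g = 0)
      exact ⟨hS.exact.lift x hx, hS.exact.lift_f x hx⟩
    · rw [ModuleCat.mono_iff_injective]
      intro (x : P.X i ⟶ S.X₁) (y : P.X i ⟶ S.X₁) (h : x ≫ S.f = y ≫ S.f)
      exact (cancel_mono _).1 h
    · rw [ModuleCat.epi_iff_surjective]
      intro (x : P.X i ⟶ S.X₃)
      exact ⟨Projective.factorThru x S.g, Projective.factorThru_comp x S.g⟩
  exact hT.op

def SPm (S : ShortComplex (ModuleCat.{u} R)) {P P' : ChainComplex (ModuleCat.{u} R) ℕ}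
    (φ : P ⟶ P') : SP S P ⟶ SP S P' where
  τ₁ := ((FY S.X₃).mapHomologicalComplex _).map φ
  τ₂ := ((FY S.X₂).mapHomologicalComplex _).map φ
  τ₃ := ((FY S.X₁).mapHomologicalComplex _).map φ
  comm₁₂ := by
    exact (NatTrans.mapHomologicalComplex (FYm S.g) _).naturality φ
  comm₂₃ := by
    exact (NatTrans.mapHomologicalComplex (FYm S.f) _).naturality φ

lemma isZero_injective (I : ModuleCat.{u} R) [Injective I] {X : ModuleCat.{u} R}
    (P : ProjectiveResolution X) (n : ℕ) : IsZero ((FC I P.complex).homology (n + 1)) := by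
  rw [← HomologicalComplex.exactAt_iff_isZero_homology]
  rw [HomologicalComplex.exactAt_iff' _ (n+2) (n+1) n (by simp) (by simp)]
  rw [← ShortComplex.exact_unop_iff]
  rw [ShortComplex.moduleCat_exact_iff]
  intro (x : P.complex.X (n+1) ⟶ I) (hx : P.complex.d (n+2) (n+1) ≫ x = 0)
  have hex := P.complex_exactAt_succ n
  rw [HomologicalComplex.exactAt_iff' _ (n+2) (n+1) n (by simp) (by simp)] at hex
  exact ⟨hex.descToInjective x hx, hex.comp_descToInjective x hx⟩


abbrev PR (X : ModuleCat.{u} R) : ChainComplex (ModuleCat.{u} R) ℕ :=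
  (projectiveResolution X).complex

def iL (N X : ModuleCat.{u} R) (n : ℕ) :
    ((FY N).leftDerived n).obj X ≅ (FC N (PR X)).homology n :=
  (projectiveResolution X).isoLeftDerivedObj (FY N) n

abbrev FCm (N : ModuleCat.{u} R) {P P' : ChainComplex (ModuleCat.{u} R) ℕ} (φ : P ⟶ P') :
    FC N P ⟶ FC N P' := ((FY N).mapHomologicalComplex _).map φ

abbrev FCn {N N' : ModuleCat.{u} R} (f : N ⟶ N') (P : ChainComplex (ModuleCat.{u} R) ℕ) :
    FC N' P ⟶ FC N P := (NatTrans.mapHomologicalComplex (FYm f) _).app P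

lemma iL_nat (N : ModuleCat.{u} R) {X Y : ModuleCat.{u} R} (f : X ⟶ Y) (n : ℕ) :
    ((FY N).leftDerived n).map f ≫ (iL N Y n).hom = (iL N X n).hom ≫
      HomologicalComplex.homologyMap (FCm N (ProjectiveResolution.lift f
        (projectiveResolution X) (projectiveResolution Y))) n :=
  ProjectiveResolution.isoLeftDerivedObj_hom_naturality f _ _ _
    (ProjectiveResolution.lift_commutes_zero f _ _) _ _

lemma iL_nat' {N N' : ModuleCat.{u} R} (f : N ⟶ N') (X : ModuleCat.{u} R) (n : ℕ) :
    (NatTrans.leftDerived (FYm f) n).app X = (iL N' X n).hom ≫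
      HomologicalComplex.homologyMap (FCn f (PR X)) n ≫ (iL N X n).inv :=
  ProjectiveResolution.leftDerived_app_eq _ (projectiveResolution X) n

def dd {S : ShortComplex (ModuleCat.{u} R)} (hS : S.ShortExact) (n : ℕ) (X : ModuleCat.{u} R) :
    (FC S.X₁ (PR X)).homology (n + 1) ⟶ (FC S.X₃ (PR X)).homology n :=
  (SP_shortExact hS (PR X) (fun i => inferInstance)).δ (n + 1) n (by simp)

lemma dd_nat {S : ShortComplex (ModuleCat.{u} R)} (hS : S.ShortExact) (n : ℕ)
    {X Y : ModuleCat.{u} R} (f : X ⟶ Y) :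
    HomologicalComplex.homologyMap (FCm S.X₁ (ProjectiveResolution.lift f
        (projectiveResolution X) (projectiveResolution Y))) (n + 1) ≫ dd hS n Y =
    dd hS n X ≫ HomologicalComplex.homologyMap (FCm S.X₃ (ProjectiveResolution.lift f
        (projectiveResolution X) (projectiveResolution Y))) n :=
  (HomologicalComplex.HomologySequence.δ_naturality (SPm S (ProjectiveResolution.lift f
        (projectiveResolution X) (projectiveResolution Y)))
      (SP_shortExact hS (PR X) (fun i => inferInstance))
      (SP_shortExact hS (PR Y) (fun i => inferInstance)) (n+1) n (by simp)).symm

lemma dd_comp {S : ShortComplex (ModuleCat.{u} R)} (hS : S.ShortExact) (n : ℕ)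
    (X : ModuleCat.{u} R) :
    dd hS n X ≫ HomologicalComplex.homologyMap (FCn S.g (PR X)) n = 0 :=
  (SP_shortExact hS (PR X) (fun i => inferInstance)).δ_comp (n+1) n (by simp)

lemma dd_exact {S : ShortComplex (ModuleCat.{u} R)} (hS : S.ShortExact) (n : ℕ)
    (X : ModuleCat.{u} R) :
    (ShortComplex.mk _ _ (dd_comp hS n X)).Exact :=
  (SP_shortExact hS (PR X) (fun i => inferInstance)).homology_exact₁ (n+1) n (by simp)

lemma dd_isIso {S : ShortComplex (ModuleCat.{u} R)} (hS : S.ShortExact) (n : ℕ)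
    [Injective S.X₂] (X : ModuleCat.{u} R) : IsIso (dd hS (n + 1) X) := by
  apply ShortComplex.ShortExact.isIso_δ
  · exact isZero_injective S.X₂ _ _
  · exact isZero_injective S.X₂ _ _

lemma dd_mono {S : ShortComplex (ModuleCat.{u} R)} (hS : S.ShortExact)
    [Injective S.X₂] (X : ModuleCat.{u} R) : Mono (dd hS 0 X) := by
  apply ((SP_shortExact hS (PR X)
        (fun i => inferInstance)).homology_exact₃ 1 0 (by simp)).mono_g
  exact (isZero_injective S.X₂ _ _).eq_of_src _ _

def dnat {S : ShortComplex (ModuleCat.{u} R)} (hS : S.ShortExact) (n : ℕ) :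
    (FY S.X₁).leftDerived (n + 1) ⟶ (FY S.X₃).leftDerived n where
  app X := (iL S.X₁ X (n + 1)).hom ≫ dd hS n X ≫ (iL S.X₃ X n).inv
  naturality X Y f := by
    rw [← cancel_mono (iL S.X₃ Y n).hom]
    simp only [Category.assoc, Iso.inv_hom_id, Category.comp_id]
    rw [iL_nat, ← Category.assoc, iL_nat, Category.assoc, dd_nat]
    simp

lemma dnat_isIso {S : ShortComplex (ModuleCat.{u} R)} (hS : S.ShortExact) (n : ℕ)
    [Injective S.X₂] : IsIso (dnat hS (n + 1)) := by
  have : ∀ X, IsIso ((dnat hS (n + 1)).app X) := by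
    intro X
    have := dd_isIso hS n X
    dsimp only [dnat]
    infer_instance
  exact NatIso.isIso_of_isIso_app _

lemma dnat_mono {S : ShortComplex (ModuleCat.{u} R)} (hS : S.ShortExact)
    [Injective S.X₂] (X) : Mono ((dnat hS 0).app X) := by
  have := dd_mono hS X
  dsimp only [dnat]
  infer_instance

lemma dnat_comp {S : ShortComplex (ModuleCat.{u} R)} (hS : S.ShortExact) (n : ℕ) (X) :
    (dnat hS n).app X ≫ (NatTrans.leftDerived (FYm S.g) n).app X = 0 := by
  rw [iL_nat']
  dsimp only [dnat]
  simp only [Category.assoc, Iso.inv_hom_id_assoc]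
  rw [reassoc_of% (dd_comp hS n X)]
  simp

lemma dnat_exact {S : ShortComplex (ModuleCat.{u} R)} (hS : S.ShortExact) (n : ℕ) (X) :
    (ShortComplex.mk _ _ (dnat_comp hS n X)).Exact := by
  refine (ShortComplex.exact_iff_of_iso ?_).1 (dd_exact hS n X)
  refine ShortComplex.isoMk (iL S.X₁ X (n + 1)).symm (iL S.X₃ X n).symm (iL S.X₂ X n).symm ?_ ?_
  · simp [dnat]
  · dsimp
    rw [iL_nat']
    simp

lemma fromLeftDerivedZero_nat {N N' : ModuleCat.{u} R} (f : N ⟶ N') (X : ModuleCat.{u} R) :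
    (NatTrans.leftDerived (FYm f) 0).app X ≫ (FY N).fromLeftDerivedZero.app X =
      (FY N').fromLeftDerivedZero.app X ≫ (FYm f).app X := by
  have h (N : ModuleCat.{u} R) : (FY N).fromLeftDerivedZero.app X = (iL N X 0).hom ≫
      (ChainComplex.isoHomologyι₀ (FC N (PR X))).hom ≫
        (projectiveResolution X).fromLeftDerivedZero' (FY N) :=
    (projectiveResolution X).fromLeftDerivedZero_eq _
  rw [h, h, iL_nat']
  simp only [Category.assoc, Iso.inv_hom_id_assoc]
  congr 1
  have h2 : HomologicalComplex.homologyMap (FCn f (PR X)) 0 ≫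
    (ChainComplex.isoHomologyι₀ (FC N (PR X))).hom =
    (ChainComplex.isoHomologyι₀ (FC N' (PR X))).hom ≫
      HomologicalComplex.opcyclesMap (FCn f (PR X)) 0 := by
    simp [ChainComplex.isoHomologyι₀]
  rw [reassoc_of% h2]
  congr 1
  rw [← cancel_epi (HomologicalComplex.pOpcycles _ _)]
  rw [HomologicalComplex.p_opcyclesMap_assoc]
  erw [ProjectiveResolution.pOpcycles_comp_fromLeftDerivedZero',
   ProjectiveResolution.pOpcycles_comp_fromLeftDerivedZero'_assoc]
  exact (FYm f).naturality _

abbrev HomF (N : ModuleCat.{u} R) : (ModuleCat.{u} R)ᵒᵖ ⥤ ModuleCat.{u} R :=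
  (linearYoneda R (ModuleCat.{u} R)).obj N

abbrev HomFm {N N' : ModuleCat.{u} R} (f : N ⟶ N') : HomF N ⟶ HomF N' :=
  (linearYoneda R (ModuleCat.{u} R)).map f

def EF (n : ℕ) (N : ModuleCat.{u} R) : (ModuleCat.{u} R)ᵒᵖ ⥤ ModuleCat.{u} R :=
  ((FY N).leftDerived n).leftOp

instance (N : ModuleCat.{u} R) : PreservesFiniteLimits (HomF N) := by
  have h1 : PreservesFiniteLimits (HomF N ⋙ forget (ModuleCat.{u} R)) := by
    change PreservesFiniteLimits (yoneda.obj N)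
    infer_instance
  exact preservesFiniteLimits_of_reflects_of_preserves (HomF N) (forget (ModuleCat.{u} R))

instance (N : ModuleCat.{u} R) : PreservesFiniteColimits (FY N) := 
  preservesFiniteColimits_rightOp _

lemma colim_equiv {J : Type} [SmallCategory J] [IsFiltered J] (F G : J ⥤ ModuleCat.{u} R)
    (δ : F ⟶ G) (hδ : ∀ j, Function.Surjective (δ.app j)) (c : Cocone F)
    (hs : ∀ x : c.pt, ∃ (j : J) (y : F.obj j), c.ι.app j y = x)
    (h1 : ∀ j (y : F.obj j), δ.app j y = 0 → c.ι.app j y = 0)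
    (h2 : ∀ j (y : F.obj j), c.ι.app j y = 0 → ∃ (k : J) (φ : j ⟶ k), δ.app k (F.map φ y) = 0) :
    Nonempty ((colimit G : ModuleCat.{u} R) ≃ₗ[R] c.pt) := by
  have hk : ∀ j, LinearMap.ker (δ.app j).hom ≤ LinearMap.ker (c.ι.app j).hom := fun j y hy => h1 j y hy
  let p : ∀ j, G.obj j →ₗ[R] c.pt := fun j =>
    ((LinearMap.ker (δ.app j).hom).liftQ (c.ι.app j).hom (hk j)).comp
      ((δ.app j).hom.quotKerEquivOfSurjective (hδ j)).symm.toLinearMap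
  have hp : ∀ j (y : F.obj j), p j (δ.app j y) = c.ι.app j y := by
    intro j y
    have : ((δ.app j).hom.quotKerEquivOfSurjective (hδ j)).symm (δ.app j y) = Submodule.Quotient.mk y := by
      rw [LinearEquiv.symm_apply_eq]
      rfl
    simp [p, this]
  have hnat : ∀ i j (f : i ⟶ j), G.map f ≫ ModuleCat.ofHom (p j) = ModuleCat.ofHom (p i) := by
    intro i j f
    ext z
    obtain ⟨y, rfl⟩ := hδ i z
    have e1 : G.map f (δ.app i y) = δ.app j (F.map f y) := by
      have := congrArg (fun g => g.hom y) (δ.naturality f)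
      exact this.symm
    have e2 : c.ι.app j (F.map f y) = c.ι.app i y := by
      exact congrArg (fun g => g.hom y) (c.w f)
    change p j (G.map f (δ.app i y)) = p i (δ.app i y)
    rw [e1, hp, hp, e2]
  let c' : Cocone G :=
    { pt := c.pt
      ι := { app := fun j => ModuleCat.ofHom (p j)
             naturality := fun i j f => by
              rw [hnat]
              rfl } }
  refine ⟨LinearEquiv.ofBijective (colimit.desc G c').hom ⟨?_, ?_⟩⟩
  · rw [injective_iff_map_eq_zero]
    intro z hz
    have := preservesSmallestFilteredColimits_of_preservesFilteredColimits (forget (ModuleCat.{u} R))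
    have : PreservesColimitsOfShape J (forget (ModuleCat.{u} R)) :=
      PreservesFilteredColimitsOfSize.preserves_filtered_colimits J
    obtain ⟨j, w, rfl⟩ := Concrete.colimit_exists_rep G z
    obtain ⟨y, rfl⟩ := hδ j w
    have h3 : p j (δ.app j y) = 0 := by
      rw [← hz]
      exact (congrArg (fun g => g.hom (δ.app j y)) (colimit.ι_desc c' j)).symm
    rw [hp] at h3
    obtain ⟨k, φ, hφ⟩ := h2 j y h3
    have e1 : G.map φ (δ.app j y) = δ.app k (F.map φ y) := by
        have := congrArg (fun g => g.hom y) (δ.naturality φ)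
        exact this.symm
    have e3 : colimit.ι G k (G.map φ (δ.app j y)) = colimit.ι G j (δ.app j y) := 
      (congrArg (fun g => g.hom (δ.app j y)) (colimit.w G φ))
    rw [← e3, e1, hφ, map_zero]
  · intro x
    obtain ⟨j, y, hy⟩ := hs x
    refine ⟨colimit.ι G j (δ.app j y), ?_⟩
    rw [← hy, ← hp]
    exact (congrArg (fun g => g.hom (δ.app j y)) (colimit.ι_desc c' j))

def tors (a : Ideal R) (N : Type*) [AddCommGroup N] [Module R N] : Submodule R N where
  carrier := {x | ∃ t : ℕ, ∀ r ∈ a ^ t, r • x = 0}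
  zero_mem' := ⟨0, by simp⟩
  add_mem' := by
    rintro x y ⟨s, hs⟩ ⟨t, ht⟩
    refine ⟨s + t, fun r hr => ?_⟩
    rw [smul_add, hs r (Ideal.pow_le_pow_right (Nat.le_add_right _ _) hr),
      ht r (Ideal.pow_le_pow_right (Nat.le_add_left _ _) hr), add_zero]
  smul_mem' := by
    rintro c x ⟨s, hs⟩
    exact ⟨s, fun r hr => by rw [smul_comm, hs r hr, smul_zero]⟩

lemma mem_tors {a : Ideal R} {N : Type*} [AddCommGroup N] [Module R N] {x : N} :
    x ∈ tors a N ↔ ∃ t : ℕ, ∀ r ∈ a ^ t, r • x = 0 := Iff.rfl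

def torsMap (a : Ideal R) {N N' : Type*} [AddCommGroup N] [Module R N] [AddCommGroup N'] [Module R N']
    (f : N →ₗ[R] N') : tors a N →ₗ[R] tors a N' :=
  f.restrict (by
    rintro x ⟨s, hs⟩
    exact ⟨s, fun r hr => by rw [← map_smul, hs r hr, map_zero]⟩)

def KK (a : Ideal R) : ℕᵒᵖᵒᵖ ⥤ (ModuleCat.{u} R)ᵒᵖ :=
  (localCohomology.ringModIdeals (localCohomology.idealPowersDiagram a)).op

lemma lcoh_iso (a : Ideal R) (i : ℕ) (N : ModuleCat.{u} R) :
    Nonempty ((localCohomology a i).obj N ≅ colimit (KK a ⋙ EF i N)) := by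
  have := localCohomology.hasColimitDiagram.{u, 0} (localCohomology.idealPowersDiagram a) i
  exact ⟨colimitObjIsoColimitCompEvaluation
    (localCohomology.diagram (localCohomology.idealPowersDiagram a) i) N⟩

def evalOne (a : Ideal R) (N : ModuleCat.{u} R) : Cocone (KK a ⋙ HomF N) where
  pt := ModuleCat.of R (tors a N)
  ι := { app := fun t => ModuleCat.ofHom
          { toFun := fun f => ⟨(show (ModuleCat.of R (R ⧸ a ^ t.unop.unop) ⟶ N) from f).hom (Submodule.Quotient.mk 1), 
              t.unop.unop, fun r hr => by
                rw [← map_smul, ← Submodule.Quotient.mk_smul, smul_eq_mul, mul_one,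
                  (Submodule.Quotient.mk_eq_zero _).2 hr, map_zero]⟩
            map_add' := fun f g => rfl
            map_smul' := fun f g => rfl }
         naturality := by
          intro i j f
          ext x
          rfl }

def del0 (N : ModuleCat.{u} R) : HomF N ⟶ EF 0 N := NatTrans.leftOp (FY N).fromLeftDerivedZero

instance (N X) : IsIso ((del0 (R := R) N).app X) :=
  inferInstanceAs (IsIso ((FY N).fromLeftDerivedZero.app X.unop).unop)

lemma del0_bij (N : ModuleCat.{u} R) (X) : Function.Bijective ((del0 N).app X) := by
  have h := (inferInstance : IsIso ((del0 N).app X))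
  exact ⟨(ModuleCat.mono_iff_injective _).1 (IsIso.mono_of_iso _),
    (ModuleCat.epi_iff_surjective _).1 (IsIso.epi_of_iso _)⟩

def del1 {S : ShortComplex (ModuleCat.{u} R)} (hS : S.ShortExact) : HomF S.X₃ ⟶ EF 1 S.X₁ :=
  NatTrans.leftOp (dnat hS 0 ≫ (FY S.X₃).fromLeftDerivedZero)

lemma del1_epi {S : ShortComplex (ModuleCat.{u} R)} (hS : S.ShortExact) [Injective S.X₂] (X) :
    Epi ((del1 hS).app X) := by
  have := dnat_mono hS X.unop
  exact inferInstanceAs (Epi ((dnat hS 0).app X.unop ≫ (FY S.X₃).fromLeftDerivedZero.app X.unop).unop)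

lemma del1_comp_aux {S : ShortComplex (ModuleCat.{u} R)} (hS : S.ShortExact) (X) :
    ((dnat hS 0).app X ≫ (FY S.X₃).fromLeftDerivedZero.app X) ≫ (FYm S.g).app X = 0 := by
  rw [Category.assoc, ← fromLeftDerivedZero_nat, ← Category.assoc, dnat_comp, zero_comp]

lemma del1_exact_aux {S : ShortComplex (ModuleCat.{u} R)} (hS : S.ShortExact) (X) :
    (ShortComplex.mk _ _ (del1_comp_aux hS X)).Exact := by
  refine (ShortComplex.exact_iff_of_iso ?_).1 (dnat_exact hS 0 X)
  refine ShortComplex.isoMk (Iso.refl _) ((FY S.X₃).leftDerivedZeroIsoSelf.app X)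
    ((FY S.X₂).leftDerivedZeroIsoSelf.app X) ?_ ?_
  · exact Category.id_comp _
  · exact (fromLeftDerivedZero_nat S.g X).symm

lemma del1_exact {S : ShortComplex (ModuleCat.{u} R)} (hS : S.ShortExact) (X)
    (y : (HomF S.X₃).obj X) : (del1 hS).app X y = 0 ↔
      ∃ z : (HomF S.X₂).obj X, (HomFm S.g).app X z = y := by
  have := (del1_exact_aux hS X.unop).unop
  rw [ShortComplex.moduleCat_exact_iff] at this
  constructor
  · exact this y
  · rintro ⟨z, rfl⟩
    exact congrArg (fun g => g.hom z) (congrArg Quiver.Hom.unop (del1_comp_aux hS X.unop))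

lemma evalOne_surj (a : Ideal R) (N : ModuleCat.{u} R) (x : N) (t : ℕ) (hx : ∀ r ∈ a ^ t, r • x = 0) :
    ∃ y : (KK a ⋙ HomF N).obj (Opposite.op (Opposite.op t)), ((evalOne a N).ι.app _ y).val = x := by
  let g : R →ₗ[R] N := LinearMap.toSpanSingleton R N x
  have hg : a ^ t ≤ LinearMap.ker g := fun r hr => by simp [g, hx r hr]
  refine ⟨(ModuleCat.ofHom ((a ^ t).liftQ g hg) :  ModuleCat.of R (R ⧸ a ^ t) ⟶ N), ?_⟩
  change g 1 = x
  simp [g]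

lemma evalOne_inj (a : Ideal R) (N : ModuleCat.{u} R) (t) : 
    Function.Injective ((evalOne a N).ι.app t) := by
  intro (x : ModuleCat.of R (R ⧸ a ^ t.unop.unop) ⟶ N) (y : ModuleCat.of R (R ⧸ a ^ t.unop.unop) ⟶ N) h
  have h : x.hom (Submodule.Quotient.mk 1) = y.hom (Submodule.Quotient.mk 1) := congrArg Subtype.val h
  refine ModuleCat.hom_ext ?_
  apply Submodule.linearMap_qext
  ext
  exact h

theorem R0 (a : Ideal R) (N : ModuleCat.{u} R) :
    Nonempty ((localCohomology a 0).obj N ≃ₗ[R] tors a N) := by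
  obtain ⟨e⟩ := lcoh_iso a 0 N
  obtain ⟨f⟩ := colim_equiv (KK a ⋙ HomF N) (KK a ⋙ EF 0 N) (Functor.whiskerLeft (KK a) (del0 N))
    (fun j => (del0_bij N _).2)
    (evalOne a N) (by
      rintro ⟨x, t, ht⟩
      obtain ⟨y, hy⟩ := evalOne_surj a N x t ht
      exact ⟨_, y, Subtype.ext hy⟩) (by
      intro j y hy
      have : y = 0 := (del0_bij N _).1 (by rw [map_zero]; exact hy)
      rw [this, map_zero]) (by
      intro j y hy
      have : y = 0 := evalOne_inj a N j (by rw [map_zero]; exact hy)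
      refine ⟨j, 𝟙 _, ?_⟩
      rw [this, map_zero, map_zero])
  exact ⟨e.toLinearEquiv.trans f⟩

def KK2 (a : Ideal R) {S : ShortComplex (ModuleCat.{u} R)} : Cocone (KK a ⋙ HomF S.X₃) where
  pt := ModuleCat.of R (tors a S.X₃ ⧸ LinearMap.range (torsMap a S.g.hom))
  ι := (evalOne a S.X₃).ι ≫ (Functor.const _).map (ModuleCat.ofHom (Submodule.mkQ _))

theorem R1 (a : Ideal R) {S : ShortComplex (ModuleCat.{u} R)} (hS : S.ShortExact) [Injective S.X₂] :
    Nonempty ((localCohomology a 1).obj S.X₁ ≃ₗ[R]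
      (tors a S.X₃ ⧸ LinearMap.range (torsMap a S.g.hom))) := by
  obtain ⟨e⟩ := lcoh_iso a 1 S.X₁
  have hz (j) (y : (KK a ⋙ HomF S.X₃).obj j) : (KK2 a).ι.app j y = Submodule.Quotient.mk ((evalOne a S.X₃).ι.app j y) := rfl
  have hn (j) (y : (KK a ⋙ HomF S.X₂).obj j) : 
    (evalOne a S.X₃).ι.app j ((HomFm S.g).app _ y) = torsMap a S.g.hom ((evalOne a S.X₂).ι.app j y) := rfl
  obtain ⟨f⟩ := colim_equiv (KK a ⋙ HomF S.X₃) (KK a ⋙ EF 1 S.X₁) (Functor.whiskerLeft (KK a) (del1 hS))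
    (fun j => (ModuleCat.epi_iff_surjective _).1 (del1_epi hS _))
    (KK2 a) (by
      intro x
      obtain ⟨⟨x, t, ht⟩, rfl⟩ := Submodule.Quotient.mk_surjective _ x
      obtain ⟨y, hy⟩ := evalOne_surj a S.X₃ x t ht
      refine ⟨_, y, ?_⟩
      rw [hz]
      congr 1
      exact Subtype.ext hy) (by
      intro j y hy
      obtain ⟨z, rfl⟩ := (del1_exact hS _ _).1 hy
      rw [hz, hn]
      exact (Submodule.Quotient.mk_eq_zero _).2 ⟨_, rfl⟩) (by
      intro j y hy
      rw [hz] at hy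
      obtain ⟨⟨w, t, ht⟩, hw⟩ := (Submodule.Quotient.mk_eq_zero _).1 hy
      let s := max t j.unop.unop
      let k : ℕᵒᵖᵒᵖ := Opposite.op (Opposite.op s)
      let φ : j ⟶ k := (homOfLE (le_max_right t j.unop.unop)).op.op
      obtain ⟨z, hz⟩ := evalOne_surj a S.X₂ w s (fun r hr => ht r (Ideal.pow_le_pow_right (le_max_left _ _) hr))
      refine ⟨k, φ, (del1_exact hS _ _).2 ⟨z, ?_⟩⟩
      apply evalOne_inj a S.X₃ k
      rw [hn]
      have e2 : (evalOne a S.X₃).ι.app k ((KK a ⋙ HomF S.X₃).map φ y) = (evalOne a S.X₃).ι.app j y :=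
        congrArg (fun g => g.hom y) ((evalOne a S.X₃).w φ)
      rw [e2, ← hw]
      congr 1
      exact Subtype.ext hz)
  exact ⟨e.toLinearEquiv.trans f⟩

theorem R2 (a : Ideal R) {S : ShortComplex (ModuleCat.{u} R)} (hS : S.ShortExact) [Injective S.X₂] (n : ℕ) :
    Nonempty ((localCohomology a (n + 2)).obj S.X₁ ≃ₗ[R] (localCohomology a (n + 1)).obj S.X₃) := by
  obtain ⟨e⟩ := lcoh_iso a (n + 2) S.X₁
  obtain ⟨e'⟩ := lcoh_iso a (n + 1) S.X₃
  have := dnat_isIso hS n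
  let i : EF (n + 1) S.X₃ ≅ EF (n + 2) S.X₁ := NatIso.ofComponents
    (fun X => ((asIso (dnat hS (n + 1))).app X.unop).unop) (fun f =>
      (NatTrans.leftOp (dnat hS (n+1))).naturality f)
  exact ⟨(e ≪≫ (HasColimit.isoOfNatIso (Functor.isoWhiskerLeft (KK a) i)).symm ≪≫ e'.symm).toLinearEquiv⟩

open scoped TensorProduct

lemma inj_extend {Q X Y : Type u} [AddCommGroup Q] [Module R Q] [AddCommGroup X] [Module R X]
    [AddCommGroup Y] [Module R Y] (hQ : Module.Injective R Q) (f : X →ₗ[R] Y) (g : X →ₗ[R] Q)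
    (h : LinearMap.ker f ≤ LinearMap.ker g) : ∃ k : Y →ₗ[R] Q, ∀ x, k (f x) = g x := by
  obtain ⟨k, hk⟩ := hQ.out ((LinearMap.ker f).liftQ f le_rfl)
    (LinearMap.ker_eq_bot.1 (Submodule.ker_liftQ_eq_bot _ _ _ le_rfl)) ((LinearMap.ker f).liftQ g h)
  exact ⟨k, fun x => hk (Submodule.Quotient.mk x)⟩

lemma tors_injective [IsNoetherianRing R] (b : Ideal R) (Q : Type u) [AddCommGroup Q] [Module R Q]
    (hQ : Module.Injective R Q) : Module.Injective R (tors b Q) := by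
  apply Module.Baer.injective
  intro J g
  have h1 : ∃ t : ℕ, ∀ r ∈ b ^ t, ∀ j, r • g j = 0 := by
    have hfg : (⊤ : Submodule R J).FG := IsNoetherian.noetherian _
    obtain ⟨s, hs⟩ := hfg
    have : ∀ j : J, ∃ t : ℕ, ∀ r ∈ b ^ t, r • (g j).val = 0 := fun j => (g j).2
    choose t ht using this
    refine ⟨s.sup t, fun r hr => ?_⟩
    have : (⊤ : Submodule R J) ≤ LinearMap.ker (r • g) := by
      rw [← hs, Submodule.span_le]
      intro j hj
      apply Subtype.ext
      exact ht j r (Ideal.pow_le_pow_right (Finset.le_sup hj) hr)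
    intro j
    exact this (Submodule.mem_top (x := j))
  obtain ⟨t, ht⟩ := h1
  obtain ⟨k, hk⟩ := Ideal.exists_pow_inf_eq_pow_smul b (M := R) J
  have h2 : ∀ j : J, j.val ∈ b ^ (t + k) → g j = 0 := by
    intro j hj
    have h3 := hk (t + k) (by omega)
    have h4 : j.val ∈ b ^ (t + k) • (⊤ : Ideal R) ⊓ J := ⟨by simpa using hj, j.2⟩
    rw [h3, Nat.add_sub_cancel] at h4
    have h5 : j.val ∈ b ^ t • J := Submodule.smul_mono le_rfl inf_le_right h4
    have h6 : b ^ t • J ≤ (LinearMap.ker g).map J.subtype := by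
      rw [Submodule.smul_le]
      intro r hr n hn
      refine ⟨r • ⟨n, hn⟩, ?_, rfl⟩
      change g (r • _) = 0
      rw [map_smul, ht r hr]
    obtain ⟨j', hj', he⟩ := h6 h5
    have : j' = j := Subtype.ext he
    rw [← this]; exact hj'
  obtain ⟨h, hh⟩ := inj_extend hQ ((b ^ (t + k)).mkQ.comp J.subtype)
    ((tors b Q).subtype.comp g) (by
      intro j hj
      have : j.val ∈ b ^ (t + k) := (Submodule.Quotient.mk_eq_zero _).1 hj
      simp [h2 j this])
  have hy : h (Submodule.Quotient.mk 1) ∈ tors b Q := ⟨t + k, fun r hr => by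
    rw [← map_smul, ← Submodule.Quotient.mk_smul, smul_eq_mul, mul_one,
      (Submodule.Quotient.mk_eq_zero _).2 hr, map_zero]⟩
  refine ⟨LinearMap.toSpanSingleton R _ ⟨_, hy⟩, fun x hx => ?_⟩
  apply Subtype.ext
  have := hh ⟨x, hx⟩
  rw [LinearMap.comp_apply, LinearMap.comp_apply] at this
  change x • h (Submodule.Quotient.mk 1) = _
  rw [← map_smul, ← Submodule.Quotient.mk_smul, smul_eq_mul, mul_one]
  exact this

lemma loc_surj [IsNoetherianRing R] (x : R) (J : Type u) [AddCommGroup J] [Module R J]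
    (hJ : Module.Injective R J) (w : Localization.Away x ⊗[R] J) :
    ∃ j : J, (1 : Localization.Away x) ⊗ₜ[R] j = w := by
  obtain ⟨⟨y, ⟨_, k, rfl⟩⟩, hy⟩ := IsLocalizedModule.surj (Submonoid.powers x)
    (TensorProduct.mk R (Localization.Away x) J 1) w
  replace hy : x ^ k • w = 1 ⊗ₜ[R] y := hy
  let f : ℕ →o Ideal R := 
    { toFun := fun n => LinearMap.ker (LinearMap.toSpanSingleton R R (x ^ n))
      monotone' := by
        intro m n hmn r hr
        simp only [LinearMap.mem_ker, LinearMap.toSpanSingleton_apply, smul_eq_mul] at hr ⊢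
        rw [← Nat.add_sub_cancel' hmn, pow_add, ← mul_assoc, hr, zero_mul] }
  obtain ⟨m, hm⟩ := monotone_stabilizes_iff_noetherian.mpr (inferInstanceAs (IsNoetherian R R)) f
  obtain ⟨h, hh⟩ := inj_extend hJ (LinearMap.toSpanSingleton R R (x ^ (m + k)))
    (LinearMap.toSpanSingleton R J (x ^ m • y)) (by
      intro r hr
      have h2 : r ∈ f m := by
        rw [hm (m + k) (by omega)]
        exact hr
      have h2 : r * x ^ m = 0 := h2
      simp [smul_smul, h2])
  refine ⟨h 1, ?_⟩
  have h3 := hh 1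
  simp only [LinearMap.toSpanSingleton_apply, one_smul] at h3
  have h4 : x ^ (m + k) • h 1 = x ^ m • y := by
    rw [← map_smul, smul_eq_mul, mul_one, h3]
  apply IsLocalizedModule.smul_injective (TensorProduct.mk R (Localization.Away x) J 1)
    (⟨x ^ (m + k), m + k, rfl⟩ : Submonoid.powers x)
  change x ^ (m + k) • _ = x ^ (m + k) • w
  rw [← TensorProduct.tmul_smul, h4, pow_add, mul_smul, hy, TensorProduct.tmul_smul]

lemma mem_tors_sup {b : Ideal R} {x : R} {N : Type*} [AddCommGroup N] [Module R N] {z : N} :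
    z ∈ tors (Ideal.span {x} ⊔ b) N ↔ z ∈ tors b N ∧ ∃ k : ℕ, x ^ k • z = 0 := by
  constructor
  · rintro ⟨t, ht⟩
    exact ⟨⟨t, fun r hr => ht r (Ideal.pow_right_mono le_sup_right _ hr)⟩, t,
      ht _ (Ideal.pow_mem_pow (Ideal.mem_sup_left (Ideal.mem_span_singleton_self x)) t)⟩
  · rintro ⟨⟨t, ht⟩, k, hk⟩
    refine ⟨k + t, fun r hr => ?_⟩
    have := Ideal.sup_pow_add_le_pow_sup_pow hr
    rw [Submodule.mem_sup] at this
    obtain ⟨p, hp, q, hq, rfl⟩ := this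
    rw [Ideal.span_singleton_pow, Ideal.mem_span_singleton'] at hp
    obtain ⟨c, rfl⟩ := hp
    rw [add_smul, mul_smul, hk, smul_zero, ht q hq, add_zero]


structure IsCech (b : Ideal R) (X : ℕ → ModuleCat.{u} R) (d : ∀ i, X i →ₗ[R] X (i + 1)) : Prop where
  dd : ∀ i z, d (i + 1) (d i z) = 0
  flat : ∀ i, Module.Flat R (X i)
  bdd : ∃ r : ℕ, ∀ i, r < i → Subsingleton (X i)
  zero : Nonempty (X 0 ≃ₗ[R] R)
  tors : ∀ (N : Type u) [AddCommGroup N] [Module R N] (z : X 0 ⊗[R] N),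
    (d 0).rTensor N z = 0 ↔ z ∈ tors b (X 0 ⊗[R] N)
  exact : ∀ (N : Type u) [AddCommGroup N] [Module R N], Module.Injective R N →
    ∀ i (z : X (i + 1) ⊗[R] N), (d (i + 1)).rTensor N z = 0 → ∃ y, (d i).rTensor N y = z

abbrev adjX (x : R) (X : ℕ → ModuleCat.{u} R) : ℕ → ModuleCat.{u} R
  | 0 => X 0
  | i + 1 => ModuleCat.of R (X (i + 1) × (Localization.Away x ⊗[R] X i))

abbrev adjd0 (x : R) (X : ℕ → ModuleCat.{u} R) (d : ∀ i, X i →ₗ[R] X (i + 1)) :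
    X 0 →ₗ[R] (X 1 × (Localization.Away x ⊗[R] X 0)) :=
  LinearMap.prod (d 0) (TensorProduct.mk R (Localization.Away x) (X 0) 1)

abbrev adjd1 (x : R) (X : ℕ → ModuleCat.{u} R) (d : ∀ i, X i →ₗ[R] X (i + 1)) (i : ℕ) :
    (X (i + 1) × (Localization.Away x ⊗[R] X i)) →ₗ[R]
      (X (i + 2) × (Localization.Away x ⊗[R] X (i + 1))) :=
  LinearMap.prod ((d (i + 1)).comp (LinearMap.fst R _ _))
    ((TensorProduct.mk R (Localization.Away x) (X (i + 1)) 1).comp (LinearMap.fst R _ _) -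
      ((d i).lTensor (Localization.Away x)).comp (LinearMap.snd R _ _))

lemma adjd0_apply (x : R) (X : ℕ → ModuleCat.{u} R) (d : ∀ i, X i →ₗ[R] X (i + 1)) (z) :
    adjd0 x X d z = (d 0 z, 1 ⊗ₜ z) := rfl

lemma adjd1_apply (x : R) (X : ℕ → ModuleCat.{u} R) (d : ∀ i, X i →ₗ[R] X (i + 1)) (i : ℕ) (z v) :
    adjd1 x X d i (z, v) = (d (i + 1) z, 1 ⊗ₜ z - (d i).lTensor (Localization.Away x) v) := rfl

abbrev adjd (x : R) (X : ℕ → ModuleCat.{u} R) (d : ∀ i, X i →ₗ[R] X (i + 1)) :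
    ∀ i, adjX x X i →ₗ[R] adjX x X (i + 1)
  | 0 => adjd0 x X d
  | i + 1 => adjd1 x X d i

def eqv (L A B N : Type u) [AddCommGroup L] [Module R L] [AddCommGroup A] [Module R A]
    [AddCommGroup B] [Module R B] [AddCommGroup N] [Module R N] :
    (A × (L ⊗[R] B)) ⊗[R] N ≃ₗ[R] (A ⊗[R] N) × (L ⊗[R] (B ⊗[R] N)) :=
  TensorProduct.prodLeft R R A (L ⊗[R] B) N ≪≫ₗ
    (LinearEquiv.refl R _).prodCongr (TensorProduct.assoc R L B N)

lemma eqv_adjd0 (x : R) (X : ℕ → ModuleCat.{u} R) (d : ∀ i, X i →ₗ[R] X (i + 1))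
    (N : Type u) [AddCommGroup N] [Module R N] (z : X 0 ⊗[R] N) :
    eqv (Localization.Away x) (X 1) (X 0) N ((adjd0 x X d).rTensor N z) =
      ((d 0).rTensor N z, 1 ⊗ₜ z) := by
  induction z with
  | zero => simp; rfl
  | add a b ha hb => rw [map_add, map_add, ha, hb, map_add, TensorProduct.tmul_add]; rfl
  | tmul a n => simp [eqv]

lemma eqv_adjd1 (x : R) (X : ℕ → ModuleCat.{u} R) (d : ∀ i, X i →ₗ[R] X (i + 1)) (i : ℕ)
    (N : Type u) [AddCommGroup N] [Module R N]
    (z : (X (i + 1) × (Localization.Away x ⊗[R] X i)) ⊗[R] N) :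
    eqv (Localization.Away x) (X (i + 2)) (X (i + 1)) N ((adjd1 x X d i).rTensor N z) =
      ((d (i + 1)).rTensor N (eqv _ _ _ _ z).1,
        1 ⊗ₜ (eqv _ _ _ _ z).1 - ((d i).rTensor N).lTensor _ (eqv _ _ _ _ z).2) := by
  induction z with
  | zero => simp; rfl
  | add a b ha hb =>
    rw [map_add, map_add, ha, hb, map_add, Prod.fst_add, Prod.snd_add, map_add, map_add,
      TensorProduct.tmul_add, Prod.mk_add_mk, add_sub_add_comm]
  | tmul a n =>
    obtain ⟨a, c⟩ := a
    induction c with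
    | zero => simp [eqv]
    | tmul l c => simp [eqv, TensorProduct.sub_tmul]
    | add c c' hc hc' =>
      have h : ((a, c + c') : X (i + 1) × (Localization.Away x ⊗[R] X i)) = (a, c) + (a, c') - (a, 0) := by
        ext <;> simp
      have h0 : eqv (Localization.Away x) (X (i + 2)) (X (i + 1)) N
          ((adjd1 x X d i).rTensor N ((a, 0) ⊗ₜ n)) =
        ((d (i + 1)).rTensor N (eqv (Localization.Away x) (X (i + 1)) (X i) N ((a, 0) ⊗ₜ n)).1,
          1 ⊗ₜ (eqv (Localization.Away x) (X (i + 1)) (X i) N ((a, 0) ⊗ₜ n)).1 -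
            ((d i).rTensor N).lTensor (Localization.Away x)
              (eqv (Localization.Away x) (X (i + 1)) (X i) N ((a, 0) ⊗ₜ n)).2) := by
        simp [eqv]
      rw [h, TensorProduct.sub_tmul, TensorProduct.add_tmul]
      simp only [map_add, map_sub, hc, hc', h0, Prod.fst_add, Prod.snd_add, Prod.fst_sub, Prod.snd_sub,
        TensorProduct.tmul_add, TensorProduct.tmul_sub]
      ext <;> simp
      abel

lemma isCech_bot : ∃ X d, IsCech (⊥ : Ideal R) X d := by
  let X : ℕ → ModuleCat.{u} R := fun i => match i with
    | 0 => ModuleCat.of R R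
    | i + 1 => ModuleCat.of R PUnit.{u+1}
  have hs : ∀ i, Subsingleton (X (i + 1)) := fun i => inferInstanceAs (Subsingleton PUnit.{u+1})
  refine ⟨X, fun i => 0, fun i z => rfl, fun i => ?_, ⟨0, fun i hi => ?_⟩, ⟨LinearEquiv.refl R R⟩,
    fun N _ _ z => ?_, fun N _ _ _ i z _ => ⟨0, ?_⟩⟩
  · cases i with
    | zero => exact inferInstanceAs (Module.Flat R R)
    | succ i => exact inferInstanceAs (Module.Flat R PUnit.{u+1})
  · obtain ⟨j, rfl⟩ := Nat.exists_eq_add_of_lt hi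
    rw [zero_add]
    exact hs j
  · simp only [LinearMap.rTensor_zero, LinearMap.zero_apply, true_iff]
    refine ⟨1, fun r hr => ?_⟩
    rw [pow_one, Ideal.mem_bot] at hr
    rw [hr, zero_smul]
  · have := hs i
    exact Subsingleton.elim _ _


lemma flat_prod (A B : Type u) [AddCommGroup A] [Module R A] [AddCommGroup B] [Module R B]
    [Module.Flat R A] [Module.Flat R B] : Module.Flat R (A × B) := by
  rw [Module.Flat.iff_lTensor_preserves_injective_linearMap]
  intro N P _ _ _ _ f hf
  have key : ∀ z, TensorProduct.prodLeft R R A B P (f.lTensor (A × B) z) =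
      (f.lTensor A (TensorProduct.prodLeft R R A B N z).1,
        f.lTensor B (TensorProduct.prodLeft R R A B N z).2) := by
    intro z
    induction z with
    | zero => simp; rfl
    | add a b ha hb => simp only [map_add, ha, hb, Prod.fst_add, Prod.snd_add, Prod.mk_add_mk]
    | tmul a b =>
      obtain ⟨a, a'⟩ := a
      simp
  rw [injective_iff_map_eq_zero]
  intro z hz
  have h1 := key z
  rw [hz, map_zero] at h1
  have h2 := congrArg Prod.fst h1
  have h3 := congrArg Prod.snd h1
  apply (TensorProduct.prodLeft R R A B N).injective
  rw [map_zero]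
  ext
  · exact Module.Flat.lTensor_preserves_injective_linearMap (M := A) f hf (h2.symm.trans (map_zero _).symm)
  · exact Module.Flat.lTensor_preserves_injective_linearMap (M := B) f hf (h3.symm.trans (map_zero _).symm)

lemma isCech_adj [IsNoetherianRing R] {b : Ideal R} {X : ℕ → ModuleCat.{u} R}
    {d : ∀ i, X i →ₗ[R] X (i + 1)} (h : IsCech b X d) (x : R) :
    IsCech (Ideal.span {x} ⊔ b) (adjX x X) (adjd x X d) := by
  have hflat := h.flat
  refine ⟨fun i z => ?_, fun i => ?_, ?_, h.zero, fun N _ _ z => ?_, fun N _ _ hN i z hz => ?_⟩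
  · have hc : ∀ i, (d (i + 1)).comp (d i) = 0 := fun i => LinearMap.ext (h.dd i)
    cases i with
    | zero =>
      change adjd1 x X d 0 (adjd0 x X d z) = 0
      rw [adjd0_apply, adjd1_apply, h.dd, LinearMap.lTensor_tmul, sub_self]
      rfl
    | succ i =>
      obtain ⟨u, v⟩ := z
      change adjd1 x X d (i + 1) (adjd1 x X d i (u, v)) = 0
      rw [adjd1_apply, adjd1_apply, h.dd, map_sub, LinearMap.lTensor_tmul, ← LinearMap.comp_apply,
        ← LinearMap.lTensor_comp, hc, LinearMap.lTensor_zero]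
      simp
  · cases i with
    | zero => exact h.flat 0
    | succ i => exact flat_prod (X (i + 1)) (Localization.Away x ⊗[R] X i)
  · obtain ⟨r, hr⟩ := h.bdd
    refine ⟨r + 1, fun i hi => ?_⟩
    cases i with
    | zero => omega
    | succ i =>
      have := hr (i + 1) (by omega)
      have := hr i (by omega)
      exact inferInstanceAs (Subsingleton (X (i + 1) × (Localization.Away x ⊗[R] X i)))
  · change (adjd0 x X d).rTensor N z = 0 ↔ z ∈ tors _ (X 0 ⊗[R] N)
    rw [← (eqv (Localization.Away x) (X 1) (X 0) N).map_eq_zero_iff, eqv_adjd0, mem_tors_sup,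
      Prod.mk_eq_zero, h.tors]
    refine and_congr_right fun _ => ?_
    have := IsLocalizedModule.eq_zero_iff (Submonoid.powers x)
      (TensorProduct.mk R (Localization.Away x) (X 0 ⊗[R] N) 1) (m := z)
    rw [TensorProduct.mk_apply] at this
    rw [this]
    constructor
    · rintro ⟨⟨_, k, rfl⟩, hk⟩
      exact ⟨k, hk⟩
    · rintro ⟨k, hk⟩
      exact ⟨⟨_, k, rfl⟩, hk⟩
  · let L := Localization.Away x
    change (X (i + 1) × (L ⊗[R] X i)) ⊗[R] N at z
    have hz' : (adjd1 x X d i).rTensor N z = 0 := hz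
    rw [← (eqv (Localization.Away x) (X (i + 2)) (X (i + 1)) N).map_eq_zero_iff, eqv_adjd1,
      Prod.mk_eq_zero] at hz'
    obtain ⟨h1, h2⟩ := hz'
    obtain ⟨u0, hu0⟩ := h.exact N hN i _ h1
    rw [← hu0] at h2
    have h3 : ((d i).rTensor N).lTensor L (1 ⊗ₜ u0 - (eqv L (X (i + 1)) (X i) N z).2) = 0 := by
      rw [map_sub, LinearMap.lTensor_tmul]
      exact h2
    cases i with
    | zero =>
      let K := LinearMap.ker ((d 0).rTensor N)
      have hK : Module.Injective R K := by
        have h4 : K = tors b (X 0 ⊗[R] N) := by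
          ext w
          exact h.tors N w
        rw [h4]
        apply tors_injective
        obtain ⟨e⟩ := h.zero
        have hb := (Module.Baer.of_injective hN)
        exact (hb.of_equiv ((TensorProduct.congr e (LinearEquiv.refl R N)) ≪≫ₗ TensorProduct.lid R N).symm).injective
      have hex : Function.Exact (K.subtype.lTensor L) (((d 0).rTensor N).lTensor L) :=
        Module.Flat.lTensor_exact L (LinearMap.exact_subtype_ker_map _)
      obtain ⟨w, hw⟩ := (hex _).1 h3
      obtain ⟨j, rfl⟩ := loc_surj x K hK w
      refine ⟨u0 - j.val, ?_⟩
      apply (eqv (Localization.Away x) (X 1) (X 0) N).injective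
      change eqv (Localization.Away x) (X 1) (X 0) N ((adjd0 x X d).rTensor N _) = _
      rw [eqv_adjd0]
      have hj : (d 0).rTensor N j.val = 0 := j.2
      ext
      · change _ = (eqv (Localization.Away x) (X 1) (X 0) N z).1
        rw [map_sub, hj, sub_zero, hu0]
      · change _ = (eqv (Localization.Away x) (X 1) (X 0) N z).2
        rw [LinearMap.lTensor_tmul] at hw
        rw [TensorProduct.tmul_sub]
        rw [eq_sub_iff_add_eq, ← eq_sub_iff_add_eq'] at hw
        exact hw.symm
    | succ i =>
      have hex : Function.Exact (((d i).rTensor N).lTensor L) (((d (i + 1)).rTensor N).lTensor L) := by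
        apply Module.Flat.lTensor_exact L
        intro y
        constructor
        · exact h.exact N hN i y
        · rintro ⟨y, rfl⟩
          rw [← LinearMap.comp_apply, ← LinearMap.rTensor_comp,
            show (d (i + 1)).comp (d i) = 0 from LinearMap.ext (h.dd i), LinearMap.rTensor_zero]
          rfl
      obtain ⟨w, hw⟩ := (hex _).1 h3
      refine ⟨(eqv L (X (i + 1)) (X i) N).symm (u0, w), ?_⟩
      apply (eqv L (X (i + 2)) (X (i + 1)) N).injective
      change eqv L (X (i + 2)) (X (i + 1)) N ((adjd1 x X d i).rTensor N _) = _
      rw [eqv_adjd1, LinearEquiv.apply_symm_apply]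
      ext
      · exact hu0
      · change 1 ⊗ₜ u0 - _ = (eqv L (X (i + 2)) (X (i + 1)) N z).2
        rw [hw]
        abel

theorem exists_cech [IsNoetherianRing R] (b : Ideal R) : ∃ X d, IsCech b X d := by
  classical
  obtain ⟨s, rfl⟩ : b.FG := IsNoetherian.noetherian b
  induction s using Finset.induction_on with
  | empty => simpa using isCech_bot
  | insert x s _ ih =>
    obtain ⟨X, d, h⟩ := ih
    rw [Finset.coe_insert, Ideal.span_insert]
    exact ⟨_, _, isCech_adj h x⟩


abbrev Hm {A B C : Type u} [AddCommGroup A] [Module R A] [AddCommGroup B] [Module R B]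
    [AddCommGroup C] [Module R C] (f : A →ₗ[R] B) (g : B →ₗ[R] C) : Type u :=
  (LinearMap.ker g) ⧸ (LinearMap.range f).submoduleOf (LinearMap.ker g)

lemma equiv_of_surj {P A B : Type u} [AddCommGroup P] [Module R P] [AddCommGroup A] [Module R A]
    [AddCommGroup B] [Module R B] (f : P →ₗ[R] A) (g : P →ₗ[R] B) (hf : Function.Surjective f)
    (hg : Function.Surjective g) (h : ∀ p, f p = 0 ↔ g p = 0) : Nonempty (A ≃ₗ[R] B) := by
  have hk : LinearMap.ker f = LinearMap.ker g := by ext p; exact h p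
  exact ⟨(f.quotKerEquivOfSurjective hf).symm ≪≫ₗ Submodule.quotEquivOfEq _ _ hk ≪≫ₗ
    g.quotKerEquivOfSurjective hg⟩

section snake
variable {A0 A1 A2 B0 B1 B2 C0 C1 : Type u}
  [AddCommGroup A0] [Module R A0] [AddCommGroup A1] [Module R A1] [AddCommGroup A2] [Module R A2]
  [AddCommGroup B0] [Module R B0] [AddCommGroup B1] [Module R B1] [AddCommGroup B2] [Module R B2]
  [AddCommGroup C0] [Module R C0] [AddCommGroup C1] [Module R C1]

lemma snake (a0 : A0 →ₗ[R] A1) (a1 : A1 →ₗ[R] A2) (b0 : B0 →ₗ[R] B1) (b1 : B1 →ₗ[R] B2)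
    (c0 : C0 →ₗ[R] C1) (f0 : A0 →ₗ[R] B0) (f1 : A1 →ₗ[R] B1) (f2 : A2 →ₗ[R] B2)
    (p0 : B0 →ₗ[R] C0) (p1 : B1 →ₗ[R] C1)
    (hf1 : Function.Injective f1) (hf2 : Function.Injective f2)
    (hp0 : Function.Surjective p0) (e0 : Function.Exact f0 p0) (e1 : Function.Exact f1 p1)
    (hb : Function.Exact b0 b1)
    (s0 : ∀ x, f1 (a0 x) = b0 (f0 x)) (s1 : ∀ x, f2 (a1 x) = b1 (f1 x))
    (q0 : ∀ x, p1 (b0 x) = c0 (p0 x)) :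
    Nonempty (Hm a0 a1 ≃ₗ[R]
      (LinearMap.ker c0 ⧸ ((LinearMap.ker b0).map p0).submoduleOf (LinearMap.ker c0))) := by
  let P : Submodule R (B0 × A1) := LinearMap.ker
    (b0.comp (LinearMap.fst R B0 A1) - f1.comp (LinearMap.snd R B0 A1))
  have hP : ∀ b a, (b, a) ∈ P ↔ b0 b = f1 a := fun b a => by
    simp [P, sub_eq_zero]
  let α : P →ₗ[R] LinearMap.ker a1 := LinearMap.codRestrict _ ((LinearMap.snd R B0 A1).comp P.subtype) (by
    rintro ⟨⟨b, a⟩, h⟩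
    rw [hP] at h
    change a1 a = 0
    apply hf2
    rw [s1, ← h, map_zero]
    exact (hb _).2 ⟨b, rfl⟩)
  let β : P →ₗ[R] LinearMap.ker c0 := LinearMap.codRestrict _ (p0.comp ((LinearMap.fst R B0 A1).comp P.subtype)) (by
    rintro ⟨⟨b, a⟩, h⟩
    rw [hP] at h
    change c0 (p0 b) = 0
    rw [← q0, h]
    exact (e1 _).2 ⟨a, rfl⟩)
  refine equiv_of_surj ((Submodule.mkQ _).comp α) ((Submodule.mkQ _).comp β) ?_ ?_ ?_
  · intro z
    obtain ⟨⟨a, ha⟩, rfl⟩ := Submodule.Quotient.mk_surjective _ z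
    have : b1 (f1 a) = 0 := by rw [← s1, show a1 a = 0 from ha, map_zero]
    obtain ⟨b, hb⟩ := (hb _).1 this
    exact ⟨⟨(b, a), (hP b a).2 hb⟩, rfl⟩
  · intro z
    obtain ⟨⟨c, hc⟩, rfl⟩ := Submodule.Quotient.mk_surjective _ z
    obtain ⟨b, rfl⟩ := hp0 c
    have : p1 (b0 b) = 0 := by rw [q0]; exact hc
    obtain ⟨a, ha⟩ := (e1 _).1 this
    exact ⟨⟨(b, a), (hP b a).2 ha.symm⟩, rfl⟩
  · rintro ⟨⟨b, a⟩, h⟩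
    have h' := (hP b a).1 h
    have h1 : ((Submodule.mkQ ((LinearMap.range a0).submoduleOf (LinearMap.ker a1))).comp α) ⟨(b, a), h⟩ = 0 ↔ a ∈ LinearMap.range a0 := by
      rw [LinearMap.comp_apply, Submodule.mkQ_apply, Submodule.Quotient.mk_eq_zero]
      rfl
    have h2 : ((Submodule.mkQ (((LinearMap.ker b0).map p0).submoduleOf (LinearMap.ker c0))).comp β) ⟨(b, a), h⟩ = 0 ↔ p0 b ∈ (LinearMap.ker b0).map p0 := by
      rw [LinearMap.comp_apply, Submodule.mkQ_apply, Submodule.Quotient.mk_eq_zero]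
      rfl
    rw [h1, h2]
    constructor
    · rintro ⟨x, rfl⟩
      refine ⟨b - f0 x, ?_, ?_⟩
      · change b0 (b - f0 x) = 0
        rw [map_sub, h', s0, sub_self]
      · rw [map_sub, (e0 _).2 ⟨x, rfl⟩, sub_zero]
    · rintro ⟨b', hb', he⟩
      have : p0 (b - b') = 0 := by rw [map_sub, he, sub_self]
      obtain ⟨x, hx⟩ := (e0 _).1 this
      refine ⟨x, hf1 ?_⟩
      rw [s0, hx, map_sub, h', show b0 b' = 0 from hb', sub_zero]

end snake

lemma sub_equiv {A B : Type u} [AddCommGroup A] [Module R A] [AddCommGroup B] [Module R B]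
    (e : A ≃ₗ[R] B) (p : Submodule R A) (q : Submodule R B) (h : ∀ x, x ∈ p ↔ e x ∈ q) :
    Nonempty (p ≃ₗ[R] q) := by
  refine ⟨e.ofSubmodules p q ?_⟩
  ext y
  constructor
  · rintro ⟨x, hx, rfl⟩
    exact (h x).1 hx
  · intro hy
    refine ⟨e.symm y, (h _).2 ?_, ?_⟩
    · simpa using hy
    · simp

lemma tors_equiv_iff {a : Ideal R} {A B : Type u} [AddCommGroup A] [Module R A] [AddCommGroup B]
    [Module R B] (e : A ≃ₗ[R] B) (x : A) : x ∈ tors a A ↔ e x ∈ tors a B := by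
  rw [mem_tors, mem_tors]
  simp [← map_smul]

def e0 {X0 : Type u} [AddCommGroup X0] [Module R X0] (e : X0 ≃ₗ[R] R) (N : Type u)
    [AddCommGroup N] [Module R N] : X0 ⊗[R] N ≃ₗ[R] N :=
  TensorProduct.congr e (LinearEquiv.refl R N) ≪≫ₗ TensorProduct.lid R N

lemma e0_nat {X0 : Type u} [AddCommGroup X0] [Module R X0] (e : X0 ≃ₗ[R] R) {N N' : Type u}
    [AddCommGroup N] [Module R N] [AddCommGroup N'] [Module R N'] (f : N →ₗ[R] N') (z) :
    e0 e N' (f.lTensor X0 z) = f (e0 e N z) := by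
  induction z with
  | zero => simp
  | add x y hx hy => simp only [map_add, hx, hy]
  | tmul x y => simp [e0]

theorem comp0 {a : Ideal R} {X : ℕ → ModuleCat.{u} R} {d : ∀ i, X i →ₗ[R] X (i + 1)}
    (h : IsCech a X d) (N : ModuleCat.{u} R) :
    Nonempty ((localCohomology a 0).obj N ≃ₗ[R] LinearMap.ker ((d 0).rTensor N)) := by
  obtain ⟨e⟩ := h.zero
  obtain ⟨f⟩ := R0 a N
  obtain ⟨g⟩ := sub_equiv (e0 e N) (LinearMap.ker ((d 0).rTensor N)) (tors a N) (fun x => by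
    rw [LinearMap.mem_ker, h.tors N x, tors_equiv_iff (e0 e N)])
  exact ⟨f ≪≫ₗ g.symm⟩

lemma tsq {A B C D : Type u} [AddCommGroup A] [Module R A] [AddCommGroup B] [Module R B]
    [AddCommGroup C] [Module R C] [AddCommGroup D] [Module R D] (f : A →ₗ[R] B) (g : C →ₗ[R] D) (x) :
    g.lTensor B (f.rTensor C x) = f.rTensor D (g.lTensor A x) := by
  rw [← LinearMap.comp_apply, ← LinearMap.comp_apply, LinearMap.lTensor_comp_rTensor,
    LinearMap.rTensor_comp_lTensor]

lemma exists_inj (N : ModuleCat.{u} R) : ∃ (S : ShortComplex (ModuleCat.{u} R)), S.ShortExact ∧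
    S.X₁ = N ∧ Injective S.X₂ := by
  refine ⟨ShortComplex.mk (Injective.ι N) (cokernel.π (Injective.ι N)) (by simp), ?_, rfl, ?_⟩
  · exact { exact := ShortComplex.exact_cokernel _ }
  · dsimp; infer_instance

lemma cech_snake {a : Ideal R} {X : ℕ → ModuleCat.{u} R} {d : ∀ i, X i →ₗ[R] X (i + 1)}
    (h : IsCech a X d) (i : ℕ) {S : ShortComplex (ModuleCat.{u} R)} (hS : S.ShortExact)
    [Injective S.X₂] :
    Nonempty (Hm ((d i).rTensor S.X₁) ((d (i + 1)).rTensor S.X₁) ≃ₗ[R]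
      (LinearMap.ker ((d i).rTensor S.X₃) ⧸
        ((LinearMap.ker ((d i).rTensor S.X₂)).map (S.g.hom.lTensor (X i))).submoduleOf
          (LinearMap.ker ((d i).rTensor S.X₃)))) := by
  have hI' : Module.Injective R S.X₂ := Module.injective_module_of_injective_object R S.X₂
  have := h.flat
  have hf : Function.Injective S.f.hom := hS.moduleCat_injective_f
  have hg : Function.Surjective S.g.hom := hS.moduleCat_surjective_g
  have hfg : Function.Exact S.f.hom S.g.hom :=
    (ShortComplex.ShortExact.moduleCat_exact_iff_function_exact S).1 hS.exact
  exact snake ((d i).rTensor S.X₁) ((d (i + 1)).rTensor S.X₁) ((d i).rTensor S.X₂)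
      ((d (i + 1)).rTensor S.X₂) ((d i).rTensor S.X₃) (S.f.hom.lTensor (X i))
      (S.f.hom.lTensor (X (i + 1)))
      (S.f.hom.lTensor (X (i + 2))) (S.g.hom.lTensor (X i)) (S.g.hom.lTensor (X (i + 1)))
      (Module.Flat.lTensor_preserves_injective_linearMap _ hf)
      (Module.Flat.lTensor_preserves_injective_linearMap _ hf)
      (LinearMap.lTensor_surjective _ hg)
      (Module.Flat.lTensor_exact _ hfg) (Module.Flat.lTensor_exact _ hfg)
      (fun z => ⟨fun hz => h.exact S.X₂ hI' i z hz, by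
        rintro ⟨y, rfl⟩
        rw [← LinearMap.comp_apply, ← LinearMap.rTensor_comp]
        have : (d (i + 1)).comp (d i) = 0 := LinearMap.ext (h.dd i)
        rw [this]; simp⟩)
      (fun x => tsq _ _ x) (fun x => tsq _ _ x) (fun x => tsq _ _ x)

theorem compS {a : Ideal R} {X : ℕ → ModuleCat.{u} R} {d : ∀ i, X i →ₗ[R] X (i + 1)}
    (h : IsCech a X d) (i : ℕ) : ∀ (N : ModuleCat.{u} R),
    Nonempty ((localCohomology a (i + 1)).obj N ≃ₗ[R]
      Hm ((d i).rTensor N) ((d (i + 1)).rTensor N)) := by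
  induction i with
  | zero =>
    intro N
    obtain ⟨S, hS, rfl, hI⟩ := exists_inj N
    obtain ⟨e⟩ := h.zero
    obtain ⟨s⟩ := cech_snake h 0 hS
    obtain ⟨r⟩ := R1 a hS
    have key : ∀ (N : Type u) [AddCommGroup N] [Module R N] (z : X 0 ⊗[R] N),
        (d 0).rTensor N z = 0 ↔ e0 e N z ∈ tors a N := fun N _ _ z => by
      rw [h.tors N z, tors_equiv_iff (e0 e N)]
    let α : LinearMap.ker ((d 0).rTensor S.X₃) →ₗ[R] tors a S.X₃ :=
      (e0 e S.X₃).toLinearMap.restrict (fun z hz => (key S.X₃ z).1 hz)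
    obtain ⟨t⟩ := equiv_of_surj (Submodule.mkQ (((LinearMap.ker ((d 0).rTensor S.X₂)).map
      (S.g.hom.lTensor (X 0))).submoduleOf (LinearMap.ker ((d 0).rTensor S.X₃))))
      ((Submodule.mkQ (LinearMap.range (torsMap a S.g.hom))).comp α)
      (Submodule.mkQ_surjective _) (by
        rw [LinearMap.coe_comp]
        refine (Submodule.mkQ_surjective _).comp ?_
        rintro ⟨y, hy⟩
        refine ⟨⟨(e0 e S.X₃).symm y, ?_⟩, ?_⟩
        · exact (key _ _).2 (by simpa using hy)
        · apply Subtype.ext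
          simp [α]) (by
        rintro ⟨z, hz⟩
        rw [LinearMap.comp_apply, Submodule.mkQ_apply, Submodule.mkQ_apply,
          Submodule.Quotient.mk_eq_zero, Submodule.Quotient.mk_eq_zero]
        constructor
        · rintro ⟨w, hw, hwz⟩
          refine ⟨⟨e0 e S.X₂ w, (key _ _).1 hw⟩, ?_⟩
          apply Subtype.ext
          change S.g.hom (e0 e S.X₂ w) = e0 e S.X₃ z
          rw [← e0_nat]
          exact congrArg _ hwz
        · rintro ⟨⟨w, hw⟩, hwz⟩
          have hwz' : S.g.hom w = e0 e S.X₃ z := congrArg Subtype.val hwz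
          refine ⟨(e0 e S.X₂).symm w, (key _ _).2 (by simpa using hw), ?_⟩
          apply (e0 e S.X₃).injective
          rw [e0_nat]
          simpa using hwz')
    exact ⟨r ≪≫ₗ t.symm ≪≫ₗ s.symm⟩
  | succ i ih =>
    intro N
    obtain ⟨S, hS, rfl, hI⟩ := exists_inj N
    have hI' : Module.Injective R S.X₂ := Module.injective_module_of_injective_object R S.X₂
    have hg : Function.Surjective S.g.hom := hS.moduleCat_surjective_g
    obtain ⟨s⟩ := cech_snake h (i + 1) hS
    obtain ⟨r⟩ := R2 a hS i
    obtain ⟨t⟩ := ih S.X₃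
    have hm : (LinearMap.ker ((d (i + 1)).rTensor S.X₂)).map (S.g.hom.lTensor (X (i + 1))) =
        LinearMap.range ((d i).rTensor S.X₃) := by
      ext z
      constructor
      · rintro ⟨w, hw, rfl⟩
        obtain ⟨v, rfl⟩ := h.exact S.X₂ hI' i w hw
        exact ⟨S.g.hom.lTensor (X i) v, (tsq _ _ _).symm⟩
      · rintro ⟨v, rfl⟩
        obtain ⟨v, rfl⟩ := LinearMap.lTensor_surjective (X i) hg v
        refine ⟨(d i).rTensor _ v, ?_, tsq _ _ _⟩
        change (d (i + 1)).rTensor _ ((d i).rTensor _ v) = 0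
        rw [← LinearMap.comp_apply, ← LinearMap.rTensor_comp]
        have : (d (i + 1)).comp (d i) = 0 := LinearMap.ext (h.dd i)
        rw [this]; simp
    rw [hm] at s
    exact ⟨r ≪≫ₗ t ≪≫ₗ s.symm⟩

def FD (k : ℕ) (A : Type u) [AddCommGroup A] [Module R A] : Prop :=
  HasInjectiveDimensionLT (ModuleCat.of R (CharacterModule A)) (k + 1)

section FD
variable {A B C : Type u} [AddCommGroup A] [Module R A] [AddCommGroup B] [Module R B]
  [AddCommGroup C] [Module R C]

lemma dual_ses (f : A →ₗ[R] B) (g : B →ₗ[R] C) (hf : Function.Injective f)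
    (hg : Function.Surjective g) (hfg : Function.Exact f g) :
    ∃ w, (ShortComplex.mk (ModuleCat.ofHom (CharacterModule.dual (R := R) g))
      (ModuleCat.ofHom (CharacterModule.dual (R := R) f)) w).ShortExact := by
  have w : (ModuleCat.ofHom (CharacterModule.dual (R := R) g)) ≫
      (ModuleCat.ofHom (CharacterModule.dual (R := R) f)) = 0 := by
    ext c x
    have : g (f x) = 0 := (hfg _).2 ⟨x, rfl⟩
    change (c : C →+ AddCircle (1 : ℚ)) (g (f x)) = 0
    rw [this]
    exact map_zero _
  refine ⟨w, ?_⟩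
  refine ShortComplex.ShortExact.mk' ?_ ?_ ?_
  · rw [ShortComplex.ShortExact.moduleCat_exact_iff_function_exact]
    intro c
    constructor
    · intro hc
      have hk : LinearMap.ker g.toAddMonoidHom.toIntLinearMap ≤
          LinearMap.ker (AddMonoidHom.toIntLinearMap (c : B →+ AddCircle (1 : ℚ))) := by
        intro b hb
        obtain ⟨a, rfl⟩ := (hfg b).1 hb
        exact DFunLike.congr_fun hc a
      refine ⟨((LinearMap.ker g.toAddMonoidHom.toIntLinearMap).liftQ _ hk ∘ₗ
        (g.toAddMonoidHom.toIntLinearMap.quotKerEquivOfSurjective hg).symm.toLinearMap).toAddMonoidHom, ?_⟩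
      apply CharacterModule.ext
      intro b
      change (LinearMap.ker g.toAddMonoidHom.toIntLinearMap).liftQ _ hk
        ((g.toAddMonoidHom.toIntLinearMap.quotKerEquivOfSurjective hg).symm (g b)) = c b
      have : (g.toAddMonoidHom.toIntLinearMap.quotKerEquivOfSurjective hg).symm (g b) =
          Submodule.Quotient.mk b := by
        rw [LinearEquiv.symm_apply_eq]; rfl
      rw [this]
      rfl
    · rintro ⟨c, rfl⟩
      exact congrArg (fun t => t.hom c) w
  · rw [ModuleCat.mono_iff_injective]
    exact CharacterModule.dual_injective_of_surjective g hg
  · rw [ModuleCat.epi_iff_surjective]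
    exact CharacterModule.dual_surjective_of_injective f hf

lemma FD_zero : FD (R := R) 0 A ↔ Module.Flat R A := by
  rw [FD, ← injective_iff_hasInjectiveDimensionLT_one, Module.Flat.iff_characterModule_injective,
    Module.injective_iff_injective_object]

lemma FD_mono {k l : ℕ} (h : k ≤ l) (hA : FD (R := R) k A) : FD (R := R) l A := by
  unfold FD at *
  exact hasInjectiveDimensionLT_of_ge _ (k + 1) _ (by omega)

lemma FD_equiv {k : ℕ} (e : A ≃ₗ[R] B) (hA : FD (R := R) k A) : FD (R := R) k B := by
  unfold FD at *
  exact hasInjectiveDimensionLT_of_iso (CharacterModule.congr e).toModuleIso _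


lemma FD_right {k : ℕ} (f : A →ₗ[R] B) (g : B →ₗ[R] C) (hf : Function.Injective f)
    (hg : Function.Surjective g) (hfg : Function.Exact f g)
    (hB : Module.Flat R B) (hA : FD (R := R) k A) : FD (R := R) (k + 1) C := by
  obtain ⟨w, h⟩ := dual_ses f g hf hg hfg
  exact h.hasInjectiveDimensionLT_X₁ (k + 1) hA (FD_mono (by omega) (FD_zero.2 hB))

lemma FD_left {k : ℕ} (f : A →ₗ[R] B) (g : B →ₗ[R] C) (hf : Function.Injective f)
    (hg : Function.Surjective g) (hfg : Function.Exact f g)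
    (hB : Module.Flat R B) (hC : FD (R := R) (k + 1) C) : FD (R := R) k A := by
  obtain ⟨w, h⟩ := dual_ses f g hf hg hfg
  exact h.hasInjectiveDimensionLT_X₃ (k + 1) (FD_mono (by omega) (FD_zero.2 hB)) hC

lemma FD_mid {k : ℕ} (f : A →ₗ[R] B) (g : B →ₗ[R] C) (hf : Function.Injective f)
    (hg : Function.Surjective g) (hfg : Function.Exact f g)
    (hA : FD (R := R) k A) (hC : FD (R := R) k C) : FD (R := R) k B := by
  obtain ⟨w, h⟩ := dual_ses f g hf hg hfg
  exact h.hasInjectiveDimensionLT_X₂ (k + 1) hC hA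

end FD

lemma FD_of_ResDimLE (k : ℕ) : ∀ (A : ModuleCat.{u} R),
    Paper.ResDimLE R (fun N => Module.Flat R N) k A → FD (R := R) k A := by
  induction k with
  | zero => exact fun A h => FD_zero.2 h
  | succ k ih =>
    rintro A (h | ⟨X, f, hX, hf, hk⟩)
    · exact FD_mono (Nat.le_succ k) (ih A h)
    · exact FD_right (LinearMap.ker f).subtype f (Submodule.subtype_injective _) hf
        (LinearMap.exact_subtype_ker_map f) hX (ih _ hk)

lemma ResDimLE_equiv (k : ℕ) : ∀ (A B : ModuleCat.{u} R), (A ≃ₗ[R] B) →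
    Paper.ResDimLE R (fun N => Module.Flat R N) k A →
    Paper.ResDimLE R (fun N => Module.Flat R N) k B := by
  induction k with
  | zero => exact fun A B e (h : Module.Flat R A) => Module.Flat.of_linearEquiv e.symm
  | succ k ih =>
    rintro A B e (h | ⟨X, f, hX, hf, hk⟩)
    · exact Or.inl (ih A B e h)
    · refine Or.inr ⟨X, e.toLinearMap.comp f, hX, e.surjective.comp hf, ?_⟩
      rw [LinearEquiv.ker_comp]
      exact hk

section cplx
variable {Y : ℕ → ModuleCat.{u} R} {d : ∀ i, Y i →ₗ[R] Y (i + 1)} {n : ℕ}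

lemma ker_flat (hfl : ∀ i, Module.Flat R (Y i)) (hb : ∃ r : ℕ, ∀ i, r < i → Subsingleton (Y i))
    (hex : ∀ i, i + 1 ≠ n → Function.Exact (d i) (d (i + 1))) :
    ∀ i, n ≤ i → Module.Flat R (LinearMap.ker (d i)) := by
  obtain ⟨r, hr⟩ := hb
  suffices ∀ j i, n ≤ i → r < i + j → Module.Flat R (LinearMap.ker (d i)) from
    fun i hi => this (r + 1) i hi (by omega)
  intro j
  induction j with
  | zero =>
    intro i _ hi
    have := hr i hi
    infer_instance
  | succ j ih =>
    intro i hi hij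
    have h1 := ih (i + 1) (by omega) (by omega)
    let g : Y i →ₗ[R] LinearMap.ker (d (i + 1)) := (d i).codRestrict _ (fun x =>
      (hex i (by omega) _).2 ⟨x, rfl⟩)
    rw [← FD_zero]
    refine FD_left (LinearMap.ker (d i)).subtype g (Submodule.subtype_injective _) ?_ ?_ (hfl i)
      (FD_mono (Nat.zero_le _) (FD_zero.2 h1))
    · rintro ⟨y, hy⟩
      obtain ⟨x, rfl⟩ := (hex i (by omega) _).1 hy
      exact ⟨x, rfl⟩
    · have : LinearMap.ker g = LinearMap.ker (d i) := LinearMap.ker_codRestrict _ _ _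
      rw [← this]
      exact LinearMap.exact_subtype_ker_map g

lemma range_res (hfl : ∀ i, Module.Flat R (Y i)) 
    (hex : ∀ i, i + 1 ≠ n → Function.Exact (d i) (d (i + 1)))
    (h0 : n ≠ 0 → Function.Injective (d 0)) (k : ℕ) : k < n →
    Paper.ResDimLE R (fun N => Module.Flat R N) k (ModuleCat.of R (LinearMap.range (d k))) := by
  induction k with
  | zero =>
    intro hn
    have := hfl 0
    exact Module.Flat.of_linearEquiv (LinearEquiv.ofInjective (d 0) (h0 (by omega))).symm
  | succ k ih =>
    intro hk
    refine Or.inr ⟨Y (k + 1), (d (k + 1)).rangeRestrict, hfl _, LinearMap.surjective_rangeRestrict _, ?_⟩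
    rw [LinearMap.ker_rangeRestrict, LinearMap.exact_iff.1 (hex k (by omega))]
    exact ih (by omega)

lemma H_res {k : ℕ} (hfl : ∀ i, Module.Flat R (Y i)) (hb : ∃ r : ℕ, ∀ i, r < i → Subsingleton (Y i))
    (hdd : ∀ i z, d (i + 1) (d i z) = 0)
    (hex : ∀ i, i + 1 ≠ k + 1 → Function.Exact (d i) (d (i + 1)))
    (h0 : Function.Injective (d 0)) :
    Paper.ResDimLE R (fun N => Module.Flat R N) (k + 1) (ModuleCat.of R (Hm (d k) (d (k + 1)))) := by
  refine Or.inr ⟨ModuleCat.of R (LinearMap.ker (d (k + 1))), Submodule.mkQ _,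
    ker_flat hfl hb hex _ le_rfl, Submodule.mkQ_surjective _, ?_⟩
  rw [Submodule.ker_mkQ]
  refine ResDimLE_equiv k _ _ ?_ (range_res hfl hex (fun _ => h0) k (by omega))
  refine (Submodule.submoduleOfEquivOfLe ?_).symm
  rintro _ ⟨z, rfl⟩
  exact hdd _ _

lemma coker_FD {k : ℕ} (hfl : ∀ i, Module.Flat R (Y i)) (hb : ∃ r : ℕ, ∀ i, r < i → Subsingleton (Y i))
    (hdd : ∀ i z, d (i + 1) (d i z) = 0)
    (hex : ∀ i, i + 1 ≠ k + 1 → Function.Exact (d i) (d (i + 1)))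
    (hH : FD (R := R) k (Hm (d k) (d (k + 1)))) : FD (R := R) k (Y (k + 1) ⧸ LinearMap.range (d k)) := by
  have hker := ker_flat hfl hb hex (k + 2) (by omega)
  have hle : LinearMap.range (d k) ≤ LinearMap.ker (d (k + 1)) := by
    rintro _ ⟨z, rfl⟩
    exact hdd _ _
  let f : Hm (d k) (d (k + 1)) →ₗ[R] (Y (k + 1) ⧸ LinearMap.range (d k)) :=
    Submodule.mapQ _ _ (LinearMap.ker (d (k + 1))).subtype (le_refl _)
  let g : (Y (k + 1) ⧸ LinearMap.range (d k)) →ₗ[R] LinearMap.ker (d (k + 2)) :=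
    Submodule.liftQ _ ((d (k + 1)).codRestrict _ (hdd (k + 1))) (fun x hx => Subtype.ext (hle hx))
  refine FD_mid f g ?_ ?_ ?_ hH (FD_mono (Nat.zero_le _) (FD_zero.2 hker))
  · rw [injective_iff_map_eq_zero]
    intro z
    obtain ⟨z, rfl⟩ := Submodule.Quotient.mk_surjective _ z
    intro hz
    rw [Submodule.Quotient.mk_eq_zero]
    exact (Submodule.Quotient.mk_eq_zero (LinearMap.range (d k))).1 hz
  · rintro ⟨y, hy⟩
    obtain ⟨x, rfl⟩ := (hex (k + 1) (by omega) _).1 hy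
    exact ⟨Submodule.Quotient.mk x, rfl⟩
  · intro y
    obtain ⟨y, rfl⟩ := Submodule.Quotient.mk_surjective _ y
    constructor
    · intro hy
      exact ⟨Submodule.Quotient.mk ⟨y, congrArg Subtype.val hy⟩, rfl⟩
    · rintro ⟨z, hz⟩
      obtain ⟨⟨z, hz'⟩, rfl⟩ := Submodule.Quotient.mk_surjective _ z
      rw [← hz]
      exact Subtype.ext hz'

lemma coker_flat (hfl : ∀ i, Module.Flat R (Y i)) {k : ℕ}
    (hex : ∀ i, i + 1 ≠ k + 1 → Function.Exact (d i) (d (i + 1))) (j : ℕ) : j ≤ k →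
    FD (R := R) j (Y (j + 1) ⧸ LinearMap.range (d j)) → 
    Module.Flat R (Y 1 ⧸ LinearMap.range (d 0)) := by
  induction j with
  | zero => exact fun _ h => FD_zero.1 h
  | succ j ih =>
    intro hj h
    refine ih (by omega) ?_
    have he := LinearMap.exact_iff.1 (hex j (by omega))
    refine FD_left (Submodule.liftQ _ (d (j + 1)) he.ge) (Submodule.mkQ (LinearMap.range (d (j + 1))))
      ?_ (Submodule.mkQ_surjective _) ?_ (hfl _) h
    · rw [← LinearMap.ker_eq_bot]
      exact Submodule.ker_liftQ_eq_bot _ _ _ he.le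
    · rw [LinearMap.exact_iff, Submodule.ker_mkQ, Submodule.range_liftQ]

end cplx
lemma exact_of_rTensor_self {A B C : Type u} [AddCommGroup A] [Module R A] [AddCommGroup B]
    [Module R B] [AddCommGroup C] [Module R C] (f : A →ₗ[R] B) (g : B →ₗ[R] C)
    (h : Subsingleton (Hm (f.rTensor R) (g.rTensor R))) (hz : ∀ x, g (f x) = 0) :
    Function.Exact f g := by
  have hnat : ∀ {P Q : Type u} [AddCommGroup P] [AddCommGroup Q] [Module R P] [Module R Q]
      (k : P →ₗ[R] Q) (z : P ⊗[R] R), TensorProduct.rid R Q (k.rTensor R z) =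
        k (TensorProduct.rid R P z) := by
    intro P Q _ _ _ _ k z
    induction z with
    | zero => simp
    | add x y hx hy => simp only [map_add, hx, hy]
    | tmul x y => simp
  intro y
  constructor
  · intro hy
    have h1 : (TensorProduct.rid R B).symm y ∈ LinearMap.ker (g.rTensor R) := by
      rw [LinearMap.mem_ker]
      apply (TensorProduct.rid R C).injective
      rw [hnat, LinearEquiv.apply_symm_apply, hy, map_zero]
    have h2 := (Submodule.Quotient.mk_eq_zero
      ((LinearMap.range (f.rTensor R)).submoduleOf (LinearMap.ker (g.rTensor R)))).1
      (Subsingleton.elim (Submodule.Quotient.mk ⟨_, h1⟩) 0)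
    obtain ⟨z, hz'⟩ := h2
    refine ⟨TensorProduct.rid R A z, ?_⟩
    rw [← hnat, hz']
    exact LinearEquiv.apply_symm_apply _ _
  · rintro ⟨x, rfl⟩
    exact hz x

theorem final [IsNoetherianRing R] [IsLocalRing R]
    (a : Ideal R) (ha : a ≠ ⊤) (n : ℕ) (hR : Paper.IsRelCM R a n R)
    (M : Type u) [AddCommGroup M] [Module R M] [Module.FaithfullyFlat R M] :
    Paper.flatDim R (Paper.lcoh R a n M) = n := by
  obtain ⟨X, d, h⟩ := exists_cech a
  let Y : ℕ → ModuleCat.{u} R := fun i => ModuleCat.of R (X i ⊗[R] M)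
  let dY : ∀ i, Y i →ₗ[R] Y (i + 1) := fun i => (d i).rTensor M
  have hflX := h.flat
  have hfl : ∀ i, Module.Flat R (Y i) := fun i => inferInstanceAs (Module.Flat R (X i ⊗[R] M))
  have hb : ∃ r : ℕ, ∀ i, r < i → Subsingleton (Y i) := by
    obtain ⟨r, hr⟩ := h.bdd
    refine ⟨r, fun i hi => ?_⟩
    have := hr i hi
    exact inferInstanceAs (Subsingleton (X i ⊗[R] M))
  have hdd : ∀ i z, dY (i + 1) (dY i z) = 0 := by
    intro i z
    change (d (i + 1)).rTensor M ((d i).rTensor M z) = 0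
    rw [← LinearMap.comp_apply, ← LinearMap.rTensor_comp]
    have : (d (i + 1)).comp (d i) = 0 := LinearMap.ext (h.dd i)
    rw [this]; simp
  have hex : ∀ i, i + 1 ≠ n → Function.Exact (dY i) (dY (i + 1)) := by
    intro i hi
    have h1 : Subsingleton ((localCohomology a (i + 1)).obj (ModuleCat.of R R)) := hR.1 (i + 1) hi
    obtain ⟨e⟩ := compS h i (ModuleCat.of R R)
    exact Module.Flat.rTensor_exact M (exact_of_rTensor_self (d i) (d (i + 1))
      e.symm.toEquiv.subsingleton (h.dd i))
  have hinj : n ≠ 0 → Function.Injective (d 0) := by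
    intro hn
    have h1 : Subsingleton ((localCohomology a 0).obj (ModuleCat.of R R)) := hR.1 0 hn.symm
    obtain ⟨e⟩ := comp0 h (ModuleCat.of R R)
    have h2 : Subsingleton (LinearMap.ker ((d 0).rTensor R)) := e.symm.toEquiv.subsingleton
    have h3 : Function.Injective ((d 0).rTensor R) := by
      rw [← LinearMap.ker_eq_bot]
      exact (Submodule.subsingleton_iff_eq_bot).1 h2
    intro x y hxy
    apply (TensorProduct.rid R (X 0)).symm.injective
    apply h3
    simp [hxy]
  have h0 : n ≠ 0 → Function.Injective (dY 0) := fun hn =>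
    Module.Flat.rTensor_preserves_injective_linearMap _ (hinj hn)
  change sInf _ = _
  apply le_antisymm
  · apply sInf_le
    refine ⟨n, rfl, ?_⟩
    cases n with
    | zero =>
      obtain ⟨e⟩ := comp0 h (ModuleCat.of R M)
      have := ker_flat hfl hb hex 0 le_rfl
      exact ResDimLE_equiv 0 (ModuleCat.of R (LinearMap.ker (dY 0))) _ e.symm this
    | succ k =>
      obtain ⟨e⟩ := compS h k (ModuleCat.of R M)
      exact ResDimLE_equiv (k + 1) (ModuleCat.of R (Hm (dY k) (dY (k + 1)))) _ e.symm
        (H_res hfl hb hdd hex (h0 (by omega)))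
  · apply le_sInf
    rintro _ ⟨j, rfl, hj⟩
    by_contra hlt
    have hjn : j < n := by
      rw [not_le] at hlt
      exact_mod_cast hlt
    cases n with
    | zero => omega
    | succ k =>
      obtain ⟨e⟩ := compS h k (ModuleCat.of R M)
      have hH : FD (R := R) k (Hm (dY k) (dY (k + 1))) :=
        FD_equiv e (FD_mono (by omega) (FD_of_ResDimLE j _ hj))
      have hfl1 := coker_flat hfl hex k le_rfl (coker_FD hfl hb hdd hex hH)
      let κ := IsLocalRing.ResidueField R
      have hi : Function.Injective ((dY 0).lTensor κ) :=
        LinearMap.lTensor_injective_of_exact_of_flat (Submodule.mkQ (LinearMap.range (dY 0)))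
          (Submodule.mkQ_surjective _) (dY 0) (h0 (by omega)) (by
            rw [LinearMap.exact_iff, Submodule.ker_mkQ]) κ
      have hz : ∀ w : κ ⊗[R] (X 0 ⊗[R] M), w = 0 := by
        intro w
        apply hi
        rw [map_zero]
        induction w with
        | zero => simp
        | add x y hx hy => simp only [map_add, hx, hy, add_zero]
        | tmul c y =>
          induction y with
          | zero => simp
          | add x y hx hy =>
            rw [TensorProduct.tmul_add, map_add, hx, hy, add_zero]
          | tmul x m =>
            have h1 : (d 0).rTensor κ (x ⊗ₜ[R] c) = 0 := by
              rw [h.tors, mem_tors]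
              refine ⟨1, fun r hr => ?_⟩
              rw [pow_one] at hr
              rw [← TensorProduct.tmul_smul, Algebra.smul_def,
                IsLocalRing.ResidueField.algebraMap_eq,
                (IsLocalRing.residue_eq_zero_iff r).2 (IsLocalRing.le_maximalIdeal ha hr),
                zero_mul, TensorProduct.tmul_zero]
            have h2 := congrArg (fun t => TensorProduct.assoc R κ (X 1) M
              ((TensorProduct.comm R (X 1) κ).toLinearMap.rTensor M (t ⊗ₜ[R] m))) h1
            simp only [LinearMap.rTensor_tmul, LinearEquiv.coe_coe, TensorProduct.comm_tmul,
              TensorProduct.assoc_tmul, TensorProduct.zero_tmul, map_zero] at h2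
            exact h2
      obtain ⟨e⟩ := h.zero
      have hnt : Nontrivial (κ ⊗[R] M) := Module.FaithfullyFlat.rTensor_nontrivial R M κ
      obtain ⟨w, hw⟩ := exists_ne (0 : κ ⊗[R] M)
      apply hw
      have h3 := hz ((TensorProduct.congr (LinearEquiv.refl R κ) (e0 e M)).symm w)
      exact (LinearEquiv.map_eq_zero_iff _).1 h3

end LC

end

end LCsection

open Paper IsLocalRing

/-- **Corollary 3.2.** If `R` is relative Cohen-Macaulay with respect to a proper ideal
`𝔞` with `ht_R 𝔞 = n`, then for every non-zero faithfully flat `R`-module `M` one has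
`fd_R H^n_𝔞(M) = n`. -/
theorem flatDim_localCohomology_of_faithfullyFlat
    (R : Type u) [CommRing R] [IsNoetherianRing R] [IsLocalRing R]
    (𝔞 : Ideal R) (h𝔞 : 𝔞 ≠ ⊤) (n : ℕ) (hR : IsRelCM R 𝔞 n R)
    (M : Type u) [AddCommGroup M] [Module R M] [Module.FaithfullyFlat R M]
    (hM : Nontrivial M) :
    flatDim R (lcoh R 𝔞 n M) = n := by
  exact LC.final 𝔞 h𝔞 n hR M
end
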